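/- arXiv:0907.0343 — 3 statements merged into one kernel-verified Lean document; each statement's English description precedes it below -/
import Mathlib

section
/- A field K is Hilbertian if and only if every rational finite embedding problem for K is geometrically solvable, i.e., for every finite Galois extension F/K(x) with L = F ∩ K_s, there exists a K-place φ of F, unramified over K(x) with residue field of K(x) equal to K, such that the induced map φ* : Gal(K) → Gal(F/K(x)) is surjective. -/
open Polynomial

noncomputable section

/-- The Hilbert set of `f(X,Y) ∈ K[X][Y]` (with `Y` the outer variable). -/
def HilbertSet {K : Type} [Field K] (f : Polynomial (Polynomial K)) : Set K :=
  {a : K | Irreducible (f.map (Polynomial.evalRingHom a))}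

/-- `K` is Hilbertian: every irreducible `f(X,Y) ∈ K[X,Y]` separable in `Y` has an
infinite Hilbert set. -/
def IsHilbertian (K : Type) [Field K] : Prop :=
  ∀ f : Polynomial (Polynomial K), Irreducible f → f.derivative ≠ 0 →
    (HilbertSet f).Infinite

variable {K F : Type} [Field K] [Field F] [Algebra (RatFunc K) F]

/-- Restriction of a place of `F` (given by its valuation ring) to `K(x)`. -/
def basePlace (O : ValuationSubring F) : ValuationSubring (RatFunc K) :=
  O.comap (algebraMap (RatFunc K) F)

/-- The inclusion of valuation rings corresponding to an extension of places. -/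
def basePlaceHom (O : ValuationSubring F) : ↥(basePlace (K := K) O) →+* ↥O :=
  RingHom.codRestrict ((algebraMap (RatFunc K) F).comp (basePlace (K := K) O).subtype)
    O.toSubring (fun a => a.2)

/-- Given that `O` contains `K`, the natural homomorphism `K → O_φ`. -/
def KtoBase (O : ValuationSubring F)
    (hmem : ∀ c : K, algebraMap K (RatFunc K) c ∈ basePlace (K := K) O) :
    K →+* ↥(basePlace (K := K) O) where
  toFun c := ⟨algebraMap K (RatFunc K) c, hmem c⟩
  map_one' := by ext; simp
  map_mul' a b := by ext; simp
  map_zero' := by ext; simp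
  map_add' a b := by ext; simp

/-- `Φ/φ` is unramified. -/
def IsUnramifiedPlace (O : ValuationSubring F) : Prop :=
  Ideal.map (basePlaceHom (K := K) O) (IsLocalRing.maximalIdeal ↥(basePlace (K := K) O)) =
    IsLocalRing.maximalIdeal ↥O

/-- The rational embedding problem attached to the finite Galois extension `F/K(x)` has
a geometric solution: there is a `K`-place `Φ` of `F` (with valuation ring `O`
containing `K`), unramified over `K(x)`, whose restriction to `K(x)` has residue field
`K`, such that the induced map `Φ* : Gal(K) → Gal(F/K(x))` (characterized by its
compatibility with the residue map, via a `K`-embedding `em` of the residue field of `Φ`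
into `K_s`) is surjective. -/
def HasGeometricSolution (K F : Type) [Field K] [Field F] [Algebra (RatFunc K) F] : Prop :=
  ∃ (O : ValuationSubring F)
    (hmem : ∀ c : K, algebraMap K (RatFunc K) c ∈ basePlace (K := K) O),
    Function.Bijective
      ((IsLocalRing.residue ↥(basePlace (K := K) O)).comp (KtoBase O hmem)) ∧
    IsUnramifiedPlace (K := K) O ∧
    ∃ (θ : ((separableClosure K (AlgebraicClosure K)) ≃ₐ[K]
          (separableClosure K (AlgebraicClosure K))) →* (F ≃ₐ[RatFunc K] F))
      (em : IsLocalRing.ResidueField ↥O →+* (separableClosure K (AlgebraicClosure K))),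
      (∀ c : K,
        em (IsLocalRing.residue ↥O (basePlaceHom (K := K) O (KtoBase O hmem c))) =
          algebraMap K (separableClosure K (AlgebraicClosure K)) c) ∧
      (∀ σ (b : ↥O), ∃ b' : ↥O, (b' : F) = θ σ (b : F) ∧
        σ (em (IsLocalRing.residue ↥O b)) = em (IsLocalRing.residue ↥O b')) ∧
      Function.Surjective θ

/-- The embedding of `K[x]` into an extension of `K(x)`. -/
def polyEmb (K F : Type) [Field K] [Field F] [Algebra (RatFunc K) F] : K[X] →+* F :=
  (algebraMap (RatFunc K) F).comp (algebraMap K[X] (RatFunc K))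

/-- The place with valuation ring `O` is finite on `K[x]` and sends `x` to `a`. -/
def IsCenteredAt (O : ValuationSubring F) (a : K) : Prop :=
  (∀ p : K[X], O.valuation (polyEmb K F p) ≤ 1) ∧ O.valuation (polyEmb K F (X - C a)) < 1

lemma polyEmb_injective : Function.Injective (polyEmb K F) :=
  (algebraMap (RatFunc K) F).injective.comp (IsFractionRing.injective K[X] (RatFunc K))

lemma exists_isCenteredAt (a : K) : ∃ O : ValuationSubring F, IsCenteredAt O a := by
  let e : K[X] ≃+* (polyEmb K F).range :=
    RingEquiv.ofBijective (polyEmb K F).rangeRestrict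
      ⟨fun p q h => polyEmb_injective (congrArg Subtype.val h),
        (polyEmb K F).rangeRestrict_surjective⟩
  let I : Ideal (polyEmb K F).range := (Ideal.span {X - C a}).comap (e.symm : _ →+* K[X])
  have hI : I ≠ ⊤ := by
    intro h
    have h1 : (1 : (polyEmb K F).range) ∈ I := h ▸ Submodule.mem_top
    rw [Ideal.mem_comap, map_one, Ideal.mem_span_singleton] at h1
    exact not_isUnit_X_sub_C a (isUnit_of_dvd_one h1)
  obtain ⟨B, hB, hB'⟩ := Ideal.image_subset_nonunits_valuationSubring I hI
  refine ⟨B, fun p => (B.valuation_le_one_iff _).2 (hB ⟨p, rfl⟩), ?_⟩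
  rw [← ValuationSubring.mem_nonunits_iff]
  refine hB' ⟨e (X - C a), ?_, rfl⟩
  rw [SetLike.mem_coe, Ideal.mem_comap, RingEquiv.coe_toRingHom, e.symm_apply_apply]
  exact Ideal.mem_span_singleton_self _

namespace IsCenteredAt

variable {O : ValuationSubring F} {a : K}

lemma valuation_sub_eval (h : IsCenteredAt O a) (p : K[X]) :
    O.valuation (polyEmb K F (p - C (p.eval a))) < 1 := by
  obtain ⟨q, hq⟩ := X_sub_C_dvd_sub_C_eval (p := p) (a := a)
  rw [hq, map_mul, map_mul]
  exact mul_lt_one_of_lt_of_le h.2 (h.1 q)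

lemma valuation_const (h : IsCenteredAt O a) {c : K} (hc : c ≠ 0) :
    O.valuation (polyEmb K F (C c)) = 1 := by
  refine le_antisymm (h.1 _) ?_
  have h1 : polyEmb K F (C c) * polyEmb K F (C c⁻¹) = 1 := by
    rw [← map_mul, ← C_mul, mul_inv_cancel₀ hc, C_1, map_one]
  have h2 := congrArg O.valuation h1
  rw [map_mul, map_one] at h2
  rw [← h2]
  exact mul_le_of_le_one_right' (h.1 _)

lemma valuation_eq_one (h : IsCenteredAt O a) {p : K[X]} (hp : p.eval a ≠ 0) :
    O.valuation (polyEmb K F p) = 1 := by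
  have h1 := h.valuation_sub_eval p
  rw [map_sub, ← h.valuation_const hp] at h1
  rw [← h.valuation_const hp]
  exact Valuation.map_eq_of_sub_lt _ h1

lemma exists_const (h : IsCenteredAt O a) (u : RatFunc K)
    (hu : O.valuation (algebraMap (RatFunc K) F u) ≤ 1) :
    ∃ c : K, O.valuation (algebraMap (RatFunc K) F u - polyEmb K F (C c)) < 1 := by
  have hd0 : polyEmb K F u.denom ≠ 0 := by
    rw [Ne, map_eq_zero_iff _ polyEmb_injective]; exact u.denom_ne_zero
  have huF : algebraMap (RatFunc K) F u = polyEmb K F u.num / polyEmb K F u.denom := by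
    conv_lhs => rw [← u.num_div_denom, map_div₀]
    rfl
  have hd : u.denom.eval a ≠ 0 := by
    intro hd
    have hn : u.num.eval a ≠ 0 := by
      intro hn
      obtain ⟨s, t, hst⟩ := u.isCoprime_num_denom
      have := congrArg (eval a) hst
      simp [hd, hn] at this
    have h1 := h.valuation_sub_eval u.denom
    rw [hd, C_0, sub_zero] at h1
    rw [huF, map_div₀, h.valuation_eq_one hn] at hu
    have h0 : 0 < O.valuation (polyEmb K F u.denom) := by simpa [zero_lt_iff] using hd0
    rw [div_le_one₀ h0] at hu
    exact absurd hu (not_le.2 h1)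
  refine ⟨u.num.eval a / u.denom.eval a, ?_⟩
  set c := u.num.eval a / u.denom.eval a with hc
  have h1 : algebraMap (RatFunc K) F u - polyEmb K F (C c) =
      polyEmb K F (u.num - C c * u.denom) / polyEmb K F u.denom := by
    rw [huF, map_sub, map_mul]; field_simp
  have h2 := h.valuation_sub_eval (u.num - C c * u.denom)
  have h3 : (u.num - C c * u.denom).eval a = 0 := by
    simp [hc, div_mul_cancel₀ _ hd]
  rw [h3, C_0, sub_zero] at h2
  rw [h1, map_div₀, h.valuation_eq_one hd, div_one]
  exact h2

end IsCenteredAt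

section Integral

variable {O : ValuationSubring F}

lemma valuation_eval₂_le {R : Type*} [Semiring R] {φ : R →+* F} {y : F} (hy : O.valuation y ≤ 1)
    {P : R[X]} (hP : ∀ i, O.valuation (φ (P.coeff i)) ≤ 1) : O.valuation (P.eval₂ φ y) ≤ 1 := by
  rw [eval₂_eq_sum_range]
  refine Valuation.map_sum_le _ fun i _ => ?_
  rw [map_mul, map_pow]
  exact mul_le_one' (hP i) (pow_le_one' hy i)

lemma valuation_eval₂_lt {R : Type*} [Semiring R] {φ : R →+* F} {y : F} (hy : O.valuation y ≤ 1)
    {P : R[X]} (hP : ∀ i, O.valuation (φ (P.coeff i)) < 1) : O.valuation (P.eval₂ φ y) < 1 := by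
  rw [eval₂_eq_sum_range]
  refine Valuation.map_sum_lt _ one_ne_zero fun i _ => ?_
  rw [map_mul, map_pow]
  exact mul_lt_one_of_lt_of_le (hP i) (pow_le_one' hy i)

lemma valuation_le_one_of_eval₂_eq_zero {R : Type*} [CommRing R] {φ : R →+* F} {y : F}
    {f : R[X]} (hlc : O.valuation (φ f.leadingCoeff) = 1)
    (hf : ∀ i, O.valuation (φ (f.coeff i)) ≤ 1) (hy : f.eval₂ φ y = 0) :
    O.valuation y ≤ 1 := by
  by_contra! h
  rw [eval₂_eq_sum_range, Finset.sum_range_succ] at hy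
  have h0 : 0 < O.valuation y := lt_trans zero_lt_one h
  have h1 : O.valuation (∑ i ∈ Finset.range f.natDegree, φ (f.coeff i) * y ^ i) <
      O.valuation (φ (f.coeff f.natDegree) * y ^ f.natDegree) := by
    rw [map_mul, coeff_natDegree, hlc, one_mul, map_pow]
    refine Valuation.map_sum_lt' _ (pow_pos h0 _) fun i hi => ?_
    rw [map_mul, map_pow]
    exact lt_of_le_of_lt (mul_le_of_le_one_left' (hf i))
      (pow_lt_pow_right₀ h (Finset.mem_range.1 hi))
  have h2 := Valuation.map_add_eq_of_lt_right _ h1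
  rw [hy, map_zero] at h2
  rw [← h2] at h1
  exact not_lt_zero h1

end Integral

namespace IsCenteredAt

variable {O : ValuationSubring F} {a : K}

lemma valuation_specialize (h : IsCenteredAt O a) (f : K[X][X]) {y : F} (hy : O.valuation y ≤ 1) :
    O.valuation (f.eval₂ (polyEmb K F) y -
      (f.map (evalRingHom a)).eval₂ ((polyEmb K F).comp C) y) < 1 := by
  have : f.eval₂ (polyEmb K F) y - (f.map (evalRingHom a)).eval₂ ((polyEmb K F).comp C) y =
      (f - (f.map (evalRingHom a)).map C).eval₂ (polyEmb K F) y := by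
    rw [eval₂_sub, eval₂_map]
    congr 1
    simp only [eval₂_map]
  rw [this]
  refine valuation_eval₂_lt hy fun i => ?_
  simpa using h.valuation_sub_eval (f.coeff i)

lemma valuation_integral (h : IsCenteredAt O a) {f : K[X][X]} (hf : f.leadingCoeff.eval a ≠ 0)
    {y : F} (hy : f.eval₂ (polyEmb K F) y = 0) : O.valuation y ≤ 1 :=
  valuation_le_one_of_eval₂_eq_zero (h.valuation_eq_one hf) (fun _ => h.1 _) hy

lemma valuation_eval₂_const (h : IsCenteredAt O a) {f : K[X][X]} (hf : f.Monic) {y : F}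
    (hy : f.eval₂ (polyEmb K F) y = 0) (hirr : Irreducible (f.map (evalRingHom a)))
    {R : K[X]} (hR : R ≠ 0) (hdeg : R.degree < f.degree) :
    O.valuation (R.eval₂ ((polyEmb K F).comp C) y) = 1 := by
  have hy1 : O.valuation y ≤ 1 := h.valuation_integral (by simp [hf.leadingCoeff]) hy
  have hle : ∀ P : K[X], O.valuation (P.eval₂ ((polyEmb K F).comp C) y) ≤ 1 :=
    fun P => valuation_eval₂_le hy1 fun _ => h.1 _
  have hlt := h.valuation_specialize f hy1
  rw [hy, zero_sub, Valuation.map_neg] at hlt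
  have hcop : IsCoprime (f.map (evalRingHom a)) R := by
    refine (hirr.coprime_iff_not_dvd).2 fun hd => ?_
    have := degree_le_of_dvd hd hR
    rw [hf.degree_map] at this
    exact absurd hdeg (not_lt.2 this)
  obtain ⟨A, B, hAB⟩ := hcop
  have h1 := congrArg (eval₂ ((polyEmb K F).comp C) y) hAB
  rw [eval₂_add, eval₂_mul, eval₂_mul, eval₂_one] at h1
  refine le_antisymm (hle R) ?_
  by_contra! hc
  have h2 := Valuation.map_add_lt O.valuation (g := 1)
    (x := A.eval₂ ((polyEmb K F).comp C) y *
      (f.map (evalRingHom a)).eval₂ ((polyEmb K F).comp C) y)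
    (y := B.eval₂ ((polyEmb K F).comp C) y * R.eval₂ ((polyEmb K F).comp C) y)
    (by rw [map_mul, mul_comm]; exact mul_lt_one_of_lt_of_le hlt (hle A))
    (by rw [map_mul, mul_comm]; exact mul_lt_one_of_lt_of_le hc (hle B))
  rw [h1, map_one] at h2
  exact lt_irrefl _ h2

lemma exists_poly_sub_lt (h : IsCenteredAt O a) (P : (RatFunc K)[X])
    (hP : ∀ i, O.valuation (algebraMap (RatFunc K) F (P.coeff i)) ≤ 1) :
    ∃ R : K[X], R.degree ≤ P.degree ∧ (∀ i, O.valuation (algebraMap (RatFunc K) F (P.coeff i) -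
      polyEmb K F (C (R.coeff i))) < 1) ∧ ∀ y : F, O.valuation y ≤ 1 →
      O.valuation (aeval y P - R.eval₂ ((polyEmb K F).comp C) y) < 1 := by
  choose c hc using fun i => h.exists_const _ (hP i)
  let R : K[X] := ∑ i ∈ P.support, monomial i (c i)
  have hco : ∀ i, R.coeff i = if i ∈ P.support then c i else 0 := by
    intro i; simp [R, coeff_monomial]
  have hR : ∀ i, O.valuation (algebraMap (RatFunc K) F (P.coeff i) -
      polyEmb K F (C (R.coeff i))) < 1 := by
    intro i
    rw [hco]
    split_ifs with hi
    · exact hc i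
    · simp [notMem_support_iff.1 hi]
  refine ⟨R, ?_, hR, fun y hy => ?_⟩
  · rw [degree_le_iff_coeff_zero]
    intro m hm
    rw [hco, if_neg]
    rw [notMem_support_iff]
    exact coeff_eq_zero_of_degree_lt hm
  · have h1 : ((polyEmb K F).comp C) = (algebraMap (RatFunc K) F).comp
        ((algebraMap K[X] (RatFunc K)).comp C) := rfl
    rw [h1, ← eval₂_map, aeval_def, ← eval₂_sub]
    refine valuation_eval₂_lt hy fun i => ?_
    rw [coeff_sub, map_sub, coeff_map]
    exact hR i

lemma exists_scaled (h : IsCenteredAt O a) {f : K[X][X]} (hf : f.Monic) {y : F}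
    (hy : f.eval₂ (polyEmb K F) y = 0) (hirr : Irreducible (f.map (evalRingHom a)))
    (hgen : ∀ z : F, ∃ P : (RatFunc K)[X], P.degree < f.degree ∧ aeval y P = z) {z : F}
    (hz : z ≠ 0) :
    ∃ (c : RatFunc K) (Q : (RatFunc K)[X]),
      (∀ i, O.valuation (algebraMap (RatFunc K) F (Q.coeff i)) ≤ 1) ∧
      O.valuation (aeval y Q) = 1 ∧ z = algebraMap (RatFunc K) F c * aeval y Q := by
  have hy1 : O.valuation y ≤ 1 := h.valuation_integral (by simp [hf.leadingCoeff]) hy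
  obtain ⟨P, hPdeg, rfl⟩ := hgen z
  have hP0 : P ≠ 0 := by rintro rfl; simp at hz
  obtain ⟨j, hj, hmax⟩ := Finset.exists_max_image P.support
    (fun i => O.valuation (algebraMap (RatFunc K) F (P.coeff i))) (support_nonempty.2 hP0)
  have hc0 : P.coeff j ≠ 0 := mem_support_iff.1 hj
  have hv0 : 0 < O.valuation (algebraMap (RatFunc K) F (P.coeff j)) := by
    simpa [zero_lt_iff] using hc0
  let Q : (RatFunc K)[X] := C (P.coeff j)⁻¹ * P
  have hQ : ∀ i, O.valuation (algebraMap (RatFunc K) F (Q.coeff i)) ≤ 1 := by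
    intro i
    by_cases hi : i ∈ P.support
    · rw [coeff_C_mul, map_mul, map_mul, map_inv₀, map_inv₀, inv_mul_le_one₀ hv0]
      exact hmax i hi
    · simp [Q, notMem_support_iff.1 hi]
  obtain ⟨R, hRdeg, hRc, hRy⟩ := h.exists_poly_sub_lt Q hQ
  have hR0 : R ≠ 0 := by
    rintro rfl
    have := hRc j
    simp [Q, inv_mul_cancel₀ hc0] at this
  have hQdeg : Q.degree = P.degree := by
    simp [Q, degree_mul, degree_C (inv_ne_zero hc0)]
  have h1 := h.valuation_eval₂_const hf hy hirr hR0
    (lt_of_le_of_lt (hRdeg.trans hQdeg.le) hPdeg)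
  refine ⟨P.coeff j, Q, hQ, ?_, ?_⟩
  · rw [← h1]
    exact Valuation.map_eq_of_sub_lt _ (by rw [h1]; exact hRy y hy1)
  · simp only [Q, map_mul, aeval_C]
    rw [← mul_assoc, ← map_mul, mul_inv_cancel₀ hc0, map_one, one_mul]

end IsCenteredAt

section Places

variable {O : ValuationSubring F}

lemma mem_maximalIdeal_basePlace (c : basePlace (K := K) O) :
    c ∈ IsLocalRing.maximalIdeal (basePlace (K := K) O) ↔
      O.valuation (algebraMap (RatFunc K) F c) < 1 := by
  have hc : O.valuation (algebraMap (RatFunc K) F c) ≤ 1 := (O.valuation_le_one_iff _).2 c.2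
  rw [IsLocalRing.mem_maximalIdeal, mem_nonunits_iff, ← not_le, not_iff_not]
  constructor
  · intro h
    obtain ⟨d, hd⟩ := h.exists_right_inv
    have h1 := congrArg
      (fun t : basePlace (K := K) O => O.valuation (algebraMap (RatFunc K) F t)) hd
    simp only [MulMemClass.coe_mul, map_mul, OneMemClass.coe_one, map_one] at h1
    rw [← h1]
    exact mul_le_of_le_one_right' ((O.valuation_le_one_iff _).2 d.2)
  · intro h
    have h1 := le_antisymm hc h
    have h0 : (c : RatFunc K) ≠ 0 := by
      intro h0
      rw [h0, map_zero, map_zero] at h1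
      exact zero_ne_one h1
    have hinv : (c : RatFunc K)⁻¹ ∈ basePlace (K := K) O := by
      refine ValuationSubring.mem_comap.2 ((O.valuation_le_one_iff _).1 ?_)
      rw [map_inv₀, map_inv₀, h1, inv_one]
    exact IsUnit.of_mul_eq_one ⟨_, hinv⟩ (Subtype.ext (mul_inv_cancel₀ h0))

lemma polyEmb_C (c : K) :
    polyEmb K F (C c) = algebraMap (RatFunc K) F (algebraMap K (RatFunc K) c) := by
  rw [IsScalarTower.algebraMap_apply K K[X] (RatFunc K)]; rfl

/-- The ring homomorphism from polynomials to the valuation ring of a finite place. -/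
def polyO {a : K} (h : IsCenteredAt O a) : K[X] →+* O :=
  (polyEmb K F).codRestrict O.toSubring fun p => (O.valuation_le_one_iff _).1 (h.1 p)

lemma residue_polyO {a : K} (h : IsCenteredAt O a) (p : K[X]) :
    IsLocalRing.residue O (polyO h p) = IsLocalRing.residue O (polyO h (C (p.eval a))) := by
  rw [← sub_eq_zero, ← map_sub, ← map_sub, IsLocalRing.residue_eq_zero_iff,
    ValuationSubring.valuation_lt_one_iff]
  exact h.valuation_sub_eval p

lemma residue_eq_eval₂ {a : K} (h : IsCenteredAt O a) {b y : O} {R : K[X]}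
    (hR : O.valuation ((b : F) - R.eval₂ ((polyEmb K F).comp C) (y : F)) < 1) :
    IsLocalRing.residue O b =
      R.eval₂ ((IsLocalRing.residue O).comp ((polyO h).comp C)) (IsLocalRing.residue O y) := by
  rw [← hom_eval₂, ← sub_eq_zero, ← map_sub, IsLocalRing.residue_eq_zero_iff,
    ValuationSubring.valuation_lt_one_iff]
  have h1 := hom_eval₂ R ((polyO h).comp C) O.subtype y
  have h2 : ((b - R.eval₂ ((polyO h).comp C) y : O) : F) =
      (b : F) - R.eval₂ ((polyEmb K F).comp C) (y : F) := congrArg (fun t => (b : F) - t) h1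
  rwa [h2]

end Places

namespace IsCenteredAt

variable {O : ValuationSubring F} {a : K}

lemma exists_integral_coeff (h : IsCenteredAt O a) {f : K[X][X]} (hf : f.Monic) {y : F}
    (hy : f.eval₂ (polyEmb K F) y = 0) (hirr : Irreducible (f.map (evalRingHom a)))
    (hgen : ∀ z : F, ∃ P : (RatFunc K)[X], P.degree < f.degree ∧ aeval y P = z) {z : F}
    (hz : O.valuation z ≤ 1) :
    ∃ P : (RatFunc K)[X],
      (∀ i, O.valuation (algebraMap (RatFunc K) F (P.coeff i)) ≤ 1) ∧ aeval y P = z := by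
  obtain rfl | hz0 := eq_or_ne z 0
  · exact ⟨0, by simp, by simp⟩
  obtain ⟨c, Q, hQ, hQy, rfl⟩ := h.exists_scaled hf hy hirr hgen hz0
  rw [map_mul, hQy, mul_one] at hz
  refine ⟨C c * Q, fun i => ?_, by simp⟩
  rw [coeff_C_mul, map_mul, map_mul]
  exact mul_le_one' hz (hQ i)

lemma isUnramifiedPlace (h : IsCenteredAt O a) {f : K[X][X]} (hf : f.Monic) {y : F}
    (hy : f.eval₂ (polyEmb K F) y = 0) (hirr : Irreducible (f.map (evalRingHom a)))
    (hgen : ∀ z : F, ∃ P : (RatFunc K)[X], P.degree < f.degree ∧ aeval y P = z) :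
    IsUnramifiedPlace (K := K) O := by
  apply le_antisymm
  · rw [Ideal.map_le_iff_le_comap]
    intro c hc
    rw [Ideal.mem_comap, ValuationSubring.valuation_lt_one_iff]
    exact (mem_maximalIdeal_basePlace c).1 hc
  · intro z hz
    obtain rfl | hz0 := eq_or_ne z 0
    · exact Ideal.zero_mem _
    obtain ⟨c, Q, hQ, hQy, hzc⟩ :=
      h.exists_scaled hf hy hirr hgen (fun h0 => hz0 (Subtype.ext h0) : (z : F) ≠ 0)
    rw [ValuationSubring.valuation_lt_one_iff, hzc, map_mul, hQy, mul_one] at hz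
    have hc : c ∈ basePlace (K := K) O :=
      ValuationSubring.mem_comap.2 ((O.valuation_le_one_iff _).1 hz.le)
    have hzeq : z = basePlaceHom (K := K) O ⟨c, hc⟩ *
        ⟨aeval y Q, (O.valuation_le_one_iff _).1 hQy.le⟩ := Subtype.ext hzc
    rw [hzeq]
    exact Ideal.mul_mem_right _ _ (Ideal.mem_map_of_mem _ ((mem_maximalIdeal_basePlace _).2 hz))

lemma bijective_residue (h : IsCenteredAt O a)
    (hmem : ∀ c : K, algebraMap K (RatFunc K) c ∈ basePlace (K := K) O) :
    Function.Bijective ((IsLocalRing.residue (basePlace (K := K) O)).comp (KtoBase O hmem)) := by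
  refine ⟨RingHom.injective _, fun r => ?_⟩
  obtain ⟨u, rfl⟩ := IsLocalRing.residue_surjective r
  obtain ⟨c, hc⟩ := h.exists_const u ((O.valuation_le_one_iff _).2 u.2)
  refine ⟨c, ?_⟩
  rw [RingHom.comp_apply, eq_comm, ← sub_eq_zero, ← map_sub, IsLocalRing.residue_eq_zero_iff,
    mem_maximalIdeal_basePlace]
  rw [polyEmb_C, ← map_sub] at hc
  exact hc

end IsCenteredAt

lemma prod_X_sub_C_galois [FiniteDimensional (RatFunc K) F] [IsGalois (RatFunc K) F]
    {f : K[X][X]} (hf : f.Monic) {y : F} (hy : f.eval₂ (polyEmb K F) y = 0)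
    (hdeg : f.natDegree = Module.finrank (RatFunc K) F)
    (hinj : Function.Injective fun g : F ≃ₐ[RatFunc K] F => g y) :
    f.map (polyEmb K F) = ∏ g : F ≃ₐ[RatFunc K] F, (X - C (g y)) := by
  have hm : (∏ g : F ≃ₐ[RatFunc K] F, (X - C (g y))).Monic :=
    monic_prod_of_monic _ _ fun g _ => monic_X_sub_C _
  refine (eq_of_monic_of_dvd_of_natDegree_le hm (hf.map _) ?_ ?_)
  · refine Finset.prod_dvd_of_coprime (fun g _ g' _ hne => ?_) fun g _ => ?_
    · exact isCoprime_X_sub_C_of_isUnit_sub (sub_ne_zero.2 (fun e => hne (hinj e))).isUnit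
    · rw [dvd_iff_isRoot, IsRoot.def, eval_map]
      have h1 : polyEmb K F = (g : F →+* F).comp (polyEmb K F) := by
        ext p <;> simp [polyEmb]
      have h2 := hom_eval₂ f (polyEmb K F) (g : F →+* F) y
      rw [hy, map_zero, ← h1] at h2
      exact h2.symm
  · rw [hf.natDegree_map, hdeg, natDegree_prod_of_monic _ _ fun g _ => monic_X_sub_C _]
    simp [← IsGalois.card_aut_eq_finrank, Nat.card_eq_fintype_card]

lemma IsCenteredAt.hasGeometricSolution [FiniteDimensional (RatFunc K) F]
    [IsGalois (RatFunc K) F] {O : ValuationSubring F} {a : K} (h : IsCenteredAt O a)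
    {f : K[X][X]} (hf : f.Monic) {y : F} (hy : f.eval₂ (polyEmb K F) y = 0)
    (hirr : Irreducible (f.map (evalRingHom a))) (hsep : (f.map (evalRingHom a)).Separable)
    (hdeg : f.natDegree = Module.finrank (RatFunc K) F)
    (hgen : ∀ z : F, ∃ P : (RatFunc K)[X], P.degree < f.degree ∧ aeval y P = z) :
    HasGeometricSolution K F := by
  have hmem : ∀ c : K, algebraMap K (RatFunc K) c ∈ basePlace (K := K) O := fun c => by
    refine ValuationSubring.mem_comap.2 ((O.valuation_le_one_iff _).1 ?_)
    rw [← polyEmb_C]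
    exact h.1 _
  have hbase : ∀ c, basePlaceHom (K := K) O (KtoBase O hmem c) = polyO h (C c) :=
    fun c => Subtype.ext (polyEmb_C c).symm
  have hmin : ∀ g : F ≃ₐ[RatFunc K] F, f.eval₂ (polyEmb K F) (g y) = 0 := fun g => by
    have h1 : polyEmb K F = (g : F →+* F).comp (polyEmb K F) := by
      ext p <;> simp [polyEmb]
    have h2 := hom_eval₂ f (polyEmb K F) (g : F →+* F) y
    rw [hy, map_zero, ← h1] at h2
    exact h2.symm
  have hgy : ∀ g : F ≃ₐ[RatFunc K] F, O.valuation (g y) ≤ 1 := fun g =>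
    h.valuation_integral (by simp [hf.leadingCoeff]) (hmin g)
  have hinj : Function.Injective fun g : F ≃ₐ[RatFunc K] F => g y := fun g g' hgg => by
    ext z
    obtain ⟨P, -, rfl⟩ := hgen z
    have hgg' : g y = g' y := hgg
    rw [← aeval_algHom_apply, ← aeval_algHom_apply, hgg']
  have happrox : ∀ z : F, O.valuation z ≤ 1 → ∃ R : K[X], ∀ g : F ≃ₐ[RatFunc K] F,
      O.valuation (g z) ≤ 1 ∧
      O.valuation (g z - R.eval₂ ((polyEmb K F).comp C) (g y)) < 1 := fun z hz => by
    obtain ⟨P, hP, rfl⟩ := h.exists_integral_coeff hf hy hirr hgen hz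
    obtain ⟨R, -, -, hR⟩ := h.exists_poly_sub_lt P hP
    refine ⟨R, fun g => ?_⟩
    rw [← aeval_algHom_apply]
    exact ⟨valuation_eval₂_le (hgy g) hP, hR _ (hgy g)⟩
  let act : (F ≃ₐ[RatFunc K] F) → O → O := fun g b => ⟨g b, by
    obtain ⟨R, hR⟩ := happrox b ((O.valuation_le_one_iff _).2 b.2)
    exact (O.valuation_le_one_iff _).1 (hR g).1⟩
  let yO : O := ⟨y, (O.valuation_le_one_iff _).1 (hgy 1)⟩
  let : Algebra K (IsLocalRing.ResidueField O) :=
    ((IsLocalRing.residue O).comp ((polyO h).comp C)).toAlgebra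
  have halg : ∀ c : K, algebraMap K (IsLocalRing.ResidueField O) c =
    IsLocalRing.residue O (polyO h (C c)) := fun _ => rfl
  have hres : ∀ b : O, ∃ R : K[X], ∀ g,
      IsLocalRing.residue O (act g b) = aeval (IsLocalRing.residue O (act g yO)) R := fun b => by
    obtain ⟨R, hR⟩ := happrox b ((O.valuation_le_one_iff _).2 b.2)
    exact ⟨R, fun g => residue_eq_eval₂ h (hR g).2⟩
  have hact1 : ∀ b, act 1 b = b := fun _ => rfl
  have hprodO : f.map (polyO h) = ∏ g : F ≃ₐ[RatFunc K] F, (X - C (act g yO)) := by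
    refine map_injective O.subtype Subtype.val_injective ?_
    rw [Polynomial.map_map, Polynomial.map_prod]
    simp only [Polynomial.map_sub, Polynomial.map_X, Polynomial.map_C]
    exact prod_X_sub_C_galois hf hy hdeg hinj
  have hprodk : (f.map (evalRingHom a)).map (algebraMap K (IsLocalRing.ResidueField O)) =
      ∏ g : F ≃ₐ[RatFunc K] F, (X - C (IsLocalRing.residue O (act g yO))) := by
    have h1 := congrArg (Polynomial.map (IsLocalRing.residue O)) hprodO
    rw [Polynomial.map_map, Polynomial.map_prod] at h1
    simp only [Polynomial.map_sub, Polynomial.map_X, Polynomial.map_C] at h1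
    rw [← h1, Polynomial.map_map]
    congr 1
    ext p
    · simp [halg]
    · simp only [RingHom.comp_apply, coe_evalRingHom, halg]
      exact (residue_polyO h X).symm
  have hsepy : IsSeparable K (IsLocalRing.residue O yO) := by
    refine hsep.of_dvd (minpoly.dvd K _ ?_)
    rw [aeval_def, ← eval_map, hprodk, eval_prod]
    exact Finset.prod_eq_zero (Finset.mem_univ 1) (by simp [hact1])
  have : Algebra.IsSeparable K (IsLocalRing.ResidueField O) := by
    have htop : IntermediateField.adjoin K {IsLocalRing.residue O yO} = ⊤ := by
      refine eq_top_iff.2 fun r _ => ?_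
      obtain ⟨b, rfl⟩ := IsLocalRing.residue_surjective r
      obtain ⟨R, hR⟩ := hres b
      have h1 := hR 1
      rw [hact1, hact1] at h1
      rw [h1]
      exact IntermediateField.algebra_adjoin_le_adjoin K _ (aeval_mem_adjoin_singleton K _)
    have h2 := (IntermediateField.isSeparable_adjoin_simple_iff_isSeparable K _).2 hsepy
    rw [htop] at h2
    exact AlgEquiv.Algebra.isSeparable IntermediateField.topEquiv
  let Ks := separableClosure K (AlgebraicClosure K)
  let em : IsLocalRing.ResidueField O →ₐ[K] Ks := IsSepClosed.lift
  let rt : (F ≃ₐ[RatFunc K] F) → Ks := fun g => em (IsLocalRing.residue O (act g yO))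
  have hprod : (f.map (evalRingHom a)).map (algebraMap K Ks) =
      ∏ g : F ≃ₐ[RatFunc K] F, (X - C (rt g)) := by
    have h1 := congrArg (Polynomial.map (em : IsLocalRing.ResidueField O →+* Ks)) hprodk
    rw [Polynomial.map_map, Polynomial.map_prod] at h1
    simp only [Polynomial.map_sub, Polynomial.map_X, Polynomial.map_C, em.comp_algebraMap] at h1
    exact h1
  have hroots : ((f.map (evalRingHom a)).map (algebraMap K Ks)).roots =
      Finset.univ.val.map rt := by
    rw [hprod, roots_prod _ _ (Finset.prod_ne_zero_iff.2 fun g _ => X_sub_C_ne_zero _)]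
    simp [Multiset.bind_singleton]
  have hrtinj : Function.Injective rt := by
    have h1 := nodup_roots (hsep.map (f := algebraMap K Ks))
    rw [hroots] at h1
    intro g g' hgg
    exact Multiset.inj_on_of_nodup_map h1 g (Finset.mem_univ g) g' (Finset.mem_univ g') hgg
  have hroot : ∀ g, aeval (rt g) (f.map (evalRingHom a)) = 0 := fun g => by
    rw [aeval_def, ← eval_map, hprod, eval_prod]
    exact Finset.prod_eq_zero (Finset.mem_univ g) (by simp)
  have hex : ∀ σ : Ks ≃ₐ[K] Ks, ∃ g, rt g = σ (rt 1) := fun σ => by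
    have h1 : aeval (σ (rt 1)) (f.map (evalRingHom a)) = 0 := by
      rw [aeval_algHom_apply, hroot, map_zero]
    rw [aeval_def, ← eval_map, hprod, eval_prod, Finset.prod_eq_zero_iff] at h1
    obtain ⟨g, -, hg⟩ := h1
    refine ⟨g, ?_⟩
    rw [eval_sub, eval_X, eval_C, sub_eq_zero] at hg
    exact hg.symm
  choose θ hθ using hex
  have hcompat : ∀ σ (b : O), σ (em (IsLocalRing.residue O b)) =
      em (IsLocalRing.residue O (act (θ σ) b)) := fun σ b => by
    obtain ⟨R, hR⟩ := hres b
    have h1 := hR 1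
    rw [hact1] at h1
    rw [h1, hR, ← aeval_algHom_apply, ← aeval_algHom_apply, ← aeval_algHom_apply]
    congr 1
    congr 1
    exact (hθ σ).symm
  have hmul : ∀ σ τ, θ (σ * τ) = θ σ * θ τ := fun σ τ => by
    apply hrtinj
    rw [hθ, AlgEquiv.mul_apply, ← hθ τ]
    exact hcompat σ _
  refine ⟨O, hmem, h.bijective_residue hmem, h.isUnramifiedPlace hf hy hirr hgen,
    MonoidHom.mk' θ hmul, em, fun c => ?_, fun σ b => ⟨act (θ σ) b, rfl, hcompat σ b⟩, fun g => ?_⟩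
  · rw [hbase]
    exact em.commutes c
  · have hmp : minpoly K (rt 1) = f.map (evalRingHom a) :=
      (minpoly.eq_of_irreducible_of_monic hirr (hroot 1) (hf.map _)).symm
    obtain ⟨σ, hσ⟩ := minpoly.exists_algEquiv_of_root' (K := K) (L := Ks) (x := rt g) (y := rt 1)
      (Algebra.IsAlgebraic.isAlgebraic _) (by rw [hmp, hroot])
    exact ⟨σ, hrtinj ((hθ σ).trans hσ)⟩

lemma IsHilbertian.hasGeometricSolution (hK : IsHilbertian K) [FiniteDimensional (RatFunc K) F]
    [IsGalois (RatFunc K) F] : HasGeometricSolution K F := by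
  classical
  let : Algebra K[X] F := (polyEmb K F).toAlgebra
  have : IsScalarTower K[X] (RatFunc K) F := .of_algebraMap_eq fun _ => rfl
  have : FaithfulSMul K[X] F := (faithfulSMul_iff_algebraMap_injective _ _).2 polyEmb_injective
  obtain ⟨y₀, hy₀⟩ := Field.exists_primitive_element (RatFunc K) F
  have halg : IsAlgebraic K[X] y₀ :=
    (IsFractionRing.isAlgebraic_iff K[X] (RatFunc K) F).2 (Algebra.IsAlgebraic.isAlgebraic y₀)
  obtain ⟨c, hc0, hint⟩ := halg.exists_integral_multiple
  set y := c • y₀ with hy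
  have htop : IntermediateField.adjoin (RatFunc K) {y} = ⊤ := by
    rw [eq_top_iff, ← hy₀, IntermediateField.adjoin_simple_le_iff]
    have h1 : y₀ = (algebraMap K[X] (RatFunc K) c)⁻¹ • y := by
      rw [hy, ← IsScalarTower.algebraMap_smul (RatFunc K) c y₀, smul_smul, inv_mul_cancel₀,
        one_smul]
      simpa using hc0
    rw [h1]
    exact IntermediateField.smul_mem _ (IntermediateField.mem_adjoin_simple_self _ _)
  let f := minpoly K[X] y
  have hf : f.Monic := minpoly.monic hint
  have hmap : minpoly (RatFunc K) y = f.map (algebraMap K[X] (RatFunc K)) :=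
    minpoly.isIntegrallyClosed_eq_field_fractions' (RatFunc K) hint
  have hyint : IsIntegral (RatFunc K) y := Algebra.IsIntegral.isIntegral y
  have hdeg : f.natDegree = Module.finrank (RatFunc K) F := by
    rw [← hf.natDegree_map (algebraMap K[X] (RatFunc K)), ← hmap]
    exact (Field.primitive_element_iff_minpoly_natDegree_eq (RatFunc K) y).1 htop
  have hgen : ∀ z : F, ∃ P : (RatFunc K)[X], P.degree < f.degree ∧ aeval y P = z := by
    intro z
    have hz : z ∈ (IntermediateField.adjoin (RatFunc K) {y}).toSubalgebra := by rw [htop]; trivial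
    rw [IntermediateField.adjoin_simple_toSubalgebra_of_isAlgebraic hyint.isAlgebraic,
      Algebra.adjoin_singleton_eq_range_aeval] at hz
    obtain ⟨P, rfl⟩ := hz
    refine ⟨P %ₘ minpoly (RatFunc K) y, ?_, ?_⟩
    · rw [← hf.degree_map (algebraMap K[X] (RatFunc K)), ← hmap]
      exact degree_modByMonic_lt _ (minpoly.monic hyint)
    · exact aeval_modByMonic_eq_self_of_root (minpoly.aeval _ _)
  have hf' : f.derivative ≠ 0 := by
    intro h0
    have h1 := (separable_iff_derivative_ne_zero (minpoly.irreducible hyint)).1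
      (Algebra.IsSeparable.isSeparable (RatFunc K) y)
    rw [hmap, derivative_map, h0, Polynomial.map_zero] at h1
    exact h1 rfl
  have hfirr : Irreducible f := (minpoly.prime_of_isIntegrallyClosed hint).irreducible
  obtain ⟨a, ha, hla⟩ := ((hK f hfirr hf').sdiff
    (f.derivative.leadingCoeff.roots.toFinset.finite_toSet)).nonempty
  obtain ⟨O, hO⟩ := exists_isCenteredAt (F := F) a
  refine hO.hasGeometricSolution hf (minpoly.aeval K[X] y) ha ?_ hdeg hgen
  refine (separable_iff_derivative_ne_zero ha).2 fun h0 => hla ?_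
  rw [derivative_map] at h0
  have h1 := congrArg (fun p => coeff p f.derivative.natDegree) h0
  simp only [coeff_map, coe_evalRingHom, coeff_zero, coeff_natDegree] at h1
  rw [Finset.mem_coe, Multiset.mem_toFinset, mem_roots (leadingCoeff_ne_zero.2 hf')]
  exact h1

section Places

variable {O : ValuationSubring F}

lemma isCenteredAt_of_valuation_sub_lt (hC : ∀ c : K, O.valuation (polyEmb K F (C c)) ≤ 1) {a : K}
    (ha : O.valuation (polyEmb K F (X - C a)) < 1) : IsCenteredAt O a := by
  have hX : O.valuation (polyEmb K F X) ≤ 1 := by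
    rw [← sub_add_cancel X (C a), map_add]
    exact Valuation.map_add_le _ ha.le (hC a)
  refine ⟨fun p => ?_, ha⟩
  have h1 : polyEmb K F p = p.eval₂ ((polyEmb K F).comp C) (polyEmb K F X) := by
    rw [← hom_eval₂, eval₂_C_X]
  rw [h1]
  exact valuation_eval₂_le hX fun i => hC _

/-- There is a rational function vanishing at prescribed finite points and at infinity for which the
quadratic equation `s ^ 2 - s = r` has no rational solution. -/
lemma exists_ratFunc_quadratic (T : Finset K) :
    ∃ r : RatFunc K, (∀ s : RatFunc K, s ^ 2 - s ≠ r) ∧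
      ∀ (F : Type) [Field F] [Algebra (RatFunc K) F] (O : ValuationSubring F),
        (∀ c : K, O.valuation (polyEmb K F (C c)) ≤ 1) →
        (1 < O.valuation (polyEmb K F X) ∨ ∃ a ∈ T, O.valuation (polyEmb K F (X - C a)) < 1) →
        O.valuation (algebraMap (RatFunc K) F r) < 1 := by
  let g : K[X] := ∏ a ∈ T, (X - C a)
  let q : K[X] := X * g ^ 2 + C 1
  have hg : g.Monic := monic_prod_of_monic _ _ fun a _ => monic_X_sub_C a
  have hqdeg : q.natDegree = g.natDegree * 2 + 1 := by
    rw [natDegree_add_C, natDegree_X_mul (pow_ne_zero _ hg.ne_zero), natDegree_pow, mul_comm]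
  have hq0 : q ≠ 0 := by
    intro h; rw [h, natDegree_zero] at hqdeg; omega
  have hqR : algebraMap K[X] (RatFunc K) q ≠ 0 := by simpa using hq0
  refine ⟨algebraMap K[X] (RatFunc K) (g ^ 2) / algebraMap K[X] (RatFunc K) q, ?_, ?_⟩
  · intro s hs
    set u := s.num
    set w := s.denom
    have hw0 : w ≠ 0 := s.denom_ne_zero
    have hwR : algebraMap K[X] (RatFunc K) w ≠ 0 := by simpa using hw0
    have hsu : s = algebraMap K[X] (RatFunc K) u / algebraMap K[X] (RatFunc K) w :=
      s.num_div_denom.symm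
    rw [hsu] at hs
    have h1 : (u ^ 2 - u * w) * q = g ^ 2 * w ^ 2 := by
      apply IsFractionRing.injective K[X] (RatFunc K)
      simp only [map_mul, map_sub, map_pow] at hs ⊢
      field_simp at hs
      linear_combination hs
    have hcop : IsCoprime q (g ^ 2) := ⟨1, -X, by simp only [q, C_1]; ring⟩
    have hwu : IsCoprime w u := s.isCoprime_num_denom.symm
    have hwu' : IsCoprime (w ^ 2) (u ^ 2 - u * w) := by
      have : u ^ 2 - u * w = u * (u + w * (-1)) := by ring
      rw [this]
      exact (hwu.mul_right (hwu.add_mul_left_right (-1))).pow_left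
    have hd1 : q ∣ w ^ 2 := hcop.dvd_of_dvd_mul_left (h1 ▸ Dvd.intro_left _ rfl)
    have hd2 : w ^ 2 ∣ q := hwu'.dvd_of_dvd_mul_left (h1 ▸ Dvd.intro_left _ rfl)
    have h2 := natDegree_le_of_dvd hd1 (pow_ne_zero _ hw0)
    have h3 := natDegree_le_of_dvd hd2 hq0
    rw [natDegree_pow] at h2 h3
    omega
  · intro F _ _ O hC hO
    have hr : algebraMap (RatFunc K) F
        (algebraMap K[X] (RatFunc K) (g ^ 2) / algebraMap K[X] (RatFunc K) q) =
        polyEmb K F (g ^ 2) / polyEmb K F q := map_div₀ _ _ _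
    have hq : polyEmb K F q = 1 + polyEmb K F (X * g ^ 2) := by
      simp only [q, map_add, map_one]; ring
    rw [hr, map_div₀]
    rcases hO with hX | ⟨a, haT, ha⟩
    · have hg1 : 1 ≤ O.valuation (polyEmb K F (g ^ 2)) := by
        rw [map_pow, map_pow, map_prod, map_prod]
        refine one_le_pow₀ (Finset.one_le_prod'' fun a => ?_)
        rw [map_sub, Valuation.map_sub_eq_of_lt_left _ ((hC a).trans_lt hX)]
        exact hX.le
      have hXg : 1 < O.valuation (polyEmb K F (X * g ^ 2)) := by
        rw [map_mul, map_mul]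
        exact one_lt_mul_of_lt_of_le hX hg1
      have h0 : O.valuation (polyEmb K F (g ^ 2)) ≠ 0 := (zero_lt_one.trans_le hg1).ne'
      rw [hq, Valuation.map_add_eq_of_lt_right _ (by rwa [map_one]), map_mul, map_mul,
        div_mul_cancel_right₀ h0]
      exact inv_lt_one_of_one_lt₀ hX
    · have h := isCenteredAt_of_valuation_sub_lt hC ha
      have hgd : X - C a ∣ g ^ 2 := dvd_pow (Finset.dvd_prod_of_mem _ haT) two_ne_zero
      have hlt : O.valuation (polyEmb K F (g ^ 2)) < 1 := by
        obtain ⟨t, ht⟩ := hgd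
        rw [ht, map_mul, map_mul]
        exact mul_lt_one_of_lt_of_le ha (h.1 t)
      rw [hq, Valuation.map_one_add_of_lt, div_one]
      · exact hlt
      · rw [map_mul, map_mul, mul_comm]
        exact mul_lt_one_of_lt_of_le hlt (h.1 X)

/-- An element with `y ^ 2 - y` in the maximal ideal is fixed by all automorphisms preserving the
valuation ring. -/
lemma fixed_of_valuation_sq_sub_lt {G : Type*} [Group G] [MulSemiringAction G F]
    (hO : ∀ (g : G) (b : F), O.valuation b ≤ 1 → O.valuation (g • b) ≤ 1) {y : F} (g : G)
    (hfix : g • (y ^ 2 - y) = y ^ 2 - y) (hy : O.valuation (y ^ 2 - y) < 1) : g • y = y := by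
  have hm : ∀ b : F, O.valuation b < 1 → O.valuation (g • b) < 1 := by
    intro b hb
    by_contra! hgb
    have hgb0 : g • b ≠ 0 := by
      intro h0
      rw [h0, map_zero] at hgb
      exact not_lt_zero (zero_lt_one.trans_le hgb)
    have hb0 : b ≠ 0 := by rintro rfl; simp at hgb0
    have h1 : O.valuation ((g • b)⁻¹) ≤ 1 := by
      rw [map_inv₀]; exact inv_le_one_of_one_le₀ hgb
    have h2 := hO g⁻¹ _ h1
    rw [smul_inv'', inv_smul_smul, map_inv₀, inv_le_one₀ (by simpa [zero_lt_iff] using hb0)] at h2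
    exact absurd hb (not_lt.2 h2)
  by_contra hne
  have h1 : g • y = 1 - y := by
    rw [smul_sub, smul_pow'] at hfix
    have h2 : (g • y - y) * (g • y - (1 - y)) = 0 := by linear_combination hfix
    exact sub_eq_zero.1 ((mul_eq_zero.1 h2).resolve_left (sub_ne_zero.2 hne))
  have hcontra : O.valuation y < 1 → O.valuation (1 - y) < 1 → False := fun h2 h3 => by
    have h4 := Valuation.map_add_lt _ h2 h3
    rw [add_sub_cancel, map_one] at h4
    exact lt_irrefl _ h4
  have hfac : y ^ 2 - y = y * (y - 1) := by ring
  rw [hfac, map_mul] at hy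
  obtain h2 | h2 := lt_or_ge (O.valuation y) 1
  · exact hcontra h2 (h1 ▸ hm y h2)
  obtain h3 | h3 := lt_or_ge (O.valuation (y - 1)) 1
  · rw [Valuation.map_sub_swap] at h3
    have h4 := hm _ h3
    rw [smul_sub, smul_one, h1, sub_sub_cancel] at h4
    exact hcontra h4 h3
  · exact absurd hy (not_lt.2 (one_le_mul h2 h3))

lemma exists_root_lift {Ω : Type*} [Field Ω] (ρ : O →+* Ω) {f : O[X]}
    (hlc : ρ f.leadingCoeff ≠ 0) (hs : (f.map O.subtype).Splits)
    (hr : ∀ z : F, (f.map O.subtype).IsRoot z → z ∈ O) {w : Ω} (hw : f.eval₂ ρ w = 0) :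
    ∃ z : O, f.IsRoot z ∧ ρ z = w := by
  have hinj : Function.Injective O.subtype := Subtype.val_injective
  have hf0 : f ≠ 0 := by rintro rfl; simp at hlc
  obtain ⟨s, hsr⟩ : ∃ s : Multiset O, s.map O.subtype = (f.map O.subtype).roots := by
    have : CanLift F O O.subtype (· ∈ O) := ⟨fun x hx => ⟨⟨x, hx⟩, rfl⟩⟩
    exact CanLift.prf (β := Multiset O) (f.map O.subtype).roots
      fun z hz => hr z (isRoot_of_mem_roots hz)
  have hprod : f = C f.leadingCoeff * (s.map fun z => X - C z).prod := by
    apply map_injective O.subtype hinj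
    conv_lhs => rw [hs.eq_prod_roots, ← hsr, leadingCoeff_map_of_injective hinj]
    rw [Polynomial.map_mul, Polynomial.map_multiset_prod, Multiset.map_map, Multiset.map_map]
    simp
  rw [hprod, eval₂_mul, eval₂_C, mul_eq_zero, or_iff_right hlc, eval₂_multiset_prod,
    Multiset.prod_eq_zero_iff, Multiset.map_map, Multiset.mem_map] at hw
  obtain ⟨z, hz, hzw⟩ := hw
  refine ⟨z, ?_, ?_⟩
  · rw [hprod, IsRoot.def, eval_mul, eval_multiset_prod, Multiset.prod_eq_zero, mul_zero]
    rw [Multiset.map_map, Multiset.mem_map]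
    exact ⟨z, hz, by simp⟩
  · simp only [Function.comp_apply, eval₂_sub, eval₂_X, eval₂_C] at hzw
    exact (sub_eq_zero.1 hzw).symm

end Places

section GaussLemma

variable {R L : Type*} [CommRing R] [IsDomain R] [IsGCDMonoid R] [Field L] [Algebra R L]
  [IsFractionRing R L] {f : R[X]}

lemma irreducible_map_fractionRing (hf : Irreducible f) (hf' : f.derivative ≠ 0) :
    Irreducible (f.map (algebraMap R L)) :=
  ((hf.isPrimitive fun h => hf' (derivative_of_natDegree_zero h)
    ).irreducible_iff_irreducible_map_fraction_map).1 hf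

lemma separable_map_fractionRing (hf : Irreducible f) (hf' : f.derivative ≠ 0) :
    (f.map (algebraMap R L)).Separable := by
  refine (separable_iff_derivative_ne_zero (irreducible_map_fractionRing hf hf')).2
    fun h0 => hf' ?_
  rw [derivative_map] at h0
  exact (Polynomial.map_eq_zero_iff (IsFractionRing.injective R L)).1 h0

lemma exists_bezout_derivative (hf : Irreducible f) (hf' : f.derivative ≠ 0) :
    ∃ d : R, d ≠ 0 ∧ ∃ u v : R[X], u * f + v * f.derivative = C d := by
  let L := FractionRing R
  obtain ⟨u, v, huv⟩  : (f.map (algebraMap R L)).Separable :=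
    separable_map_fractionRing hf hf'
  obtain ⟨b, hb, hb'⟩ := IsLocalization.integerNormalization_spec (nonZeroDivisors R) u
  obtain ⟨c, hc, hc'⟩ := IsLocalization.integerNormalization_spec (nonZeroDivisors R) v
  refine ⟨b * c, mul_ne_zero (nonZeroDivisors.ne_zero hb) (nonZeroDivisors.ne_zero hc),
    C c * IsLocalization.integerNormalization (nonZeroDivisors R) u,
    C b * IsLocalization.integerNormalization (nonZeroDivisors R) v, ?_⟩
  apply map_injective _ (IsFractionRing.injective R L)
  rw [derivative_map] at huv
  simp only [Polynomial.map_add, Polynomial.map_mul, hb', hc', map_C, map_mul,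
    algebra_compatible_smul L b u, algebra_compatible_smul L c v, smul_eq_C_mul]
  linear_combination (C (algebraMap R L b) * C (algebraMap R L c)) * huv

end GaussLemma

lemma isGalois_splittingField_mul {k : Type*} [Field k] {p q : k[X]} (hp : p.Separable)
    (hq : q.Separable) : IsGalois k (p * q).SplittingField := by
  have hn : Normal k (p * q).SplittingField := Normal.of_isSplittingField (p * q)
  have : Algebra.IsSeparable k (p * q).SplittingField := by
    have h1 := (isSplittingField_iff_intermediateField (K := k) (L := (p * q).SplittingField)
      (p := p * q)).1 inferInstance
    have h2 : Algebra.IsSeparable k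
        (IntermediateField.adjoin k ((p * q).rootSet (p * q).SplittingField)) := by
      rw [IntermediateField.isSeparable_adjoin_iff_isSeparable]
      intro x hx
      have hx0 := (mem_rootSet'.1 hx).2
      rw [map_mul, mul_eq_zero] at hx0
      rcases hx0 with h | h
      · exact hp.of_dvd (minpoly.dvd _ _ h)
      · exact hq.of_dvd (minpoly.dvd _ _ h)
    rw [h1.2] at h2
    exact AlgEquiv.Algebra.isSeparable_iff IntermediateField.topEquiv |>.1 h2
  exact ⟨⟩

lemma separable_sq_sub {k : Type*} [Field k] {r : k} (hr : ∀ s : k, s ^ 2 - s ≠ r) :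
    (X ^ 2 - X - C r : k[X]).Separable := by
  have h4 : (1 + 4 * r : k) ≠ 0 := by
    intro h
    have h2 : (2 : k) ≠ 0 := fun h2 => by
      have : (1 : k) = 0 := by linear_combination h - 2 * r * h2
      exact one_ne_zero this
    refine hr (1 / 2) ?_
    field_simp
    linear_combination -h
  refine ⟨C (-4 / (1 + 4 * r)), C (1 / (1 + 4 * r)) * (2 * X - 1), ?_⟩
  have h5 : (C (-4 / (1 + 4 * r)) : k[X]) = - 4 * C (1 / (1 + 4 * r)) := by
    rw [show (-4 / (1 + 4 * r) : k) = -4 * (1 / (1 + 4 * r)) by ring, C_mul, map_neg]; rfl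
  have h6 : (C (1 / (1 + 4 * r)) : k[X]) * (1 + 4 * C r) = 1 := by
    have : (1 + 4 * C r : k[X]) = C (1 + 4 * r) := by
      rw [C_add, C_mul, C_1, map_ofNat]
    rw [this, ← C_mul, one_div_mul_cancel h4, C_1]
  rw [h5]
  simp only [derivative_sub, derivative_X_pow, derivative_X, derivative_C]
  push_cast
  simp only [map_ofNat, pow_one, sub_zero]
  linear_combination h6

lemma map_polyEmb (f : K[X][X]) :
    f.map (polyEmb K F) = (f.map (algebraMap K[X] (RatFunc K))).map (algebraMap (RatFunc K) F) := by
  rw [Polynomial.map_map]; rfl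

lemma IsCenteredAt.irreducible_specialize [FiniteDimensional (RatFunc K) F] [IsGalois (RatFunc K) F]
    {O : ValuationSubring F} {a : K} (h : IsCenteredAt O a) {Ω : Type*} [Field Ω] [Algebra K Ω]
    [Algebra.IsAlgebraic K Ω] [IsSepClosed Ω] (ρ : O →+* Ω)
    (hρ : ∀ p : K[X], ρ (polyO h p) = algebraMap K Ω (p.eval a))
    (hsurj : ∀ g : F ≃ₐ[RatFunc K] F, ∃ σ : Ω ≃ₐ[K] Ω,
      ∀ b : O, ∃ b' : O, (b' : F) = g b ∧ σ (ρ b) = ρ b')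
    {f : K[X][X]} (hirr : Irreducible (f.map (algebraMap K[X] (RatFunc K))))
    (hs : (f.map (polyEmb K F)).Splits) (hlc : f.leadingCoeff.eval a ≠ 0)
    (hsep : (f.map (evalRingHom a)).Separable) : Irreducible (f.map (evalRingHom a)) := by
  let fO := f.map (polyO h)
  have hinj : Function.Injective (polyO h) := fun p q hpq =>
    polyEmb_injective (K := K) (F := F) (congrArg Subtype.val hpq)
  have hfO : fO.map O.subtype = f.map (polyEmb K F) := by
    rw [Polynomial.map_map]; rfl
  have hρf : fO.map ρ = (f.map (evalRingHom a)).map (algebraMap K Ω) := by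
    rw [Polynomial.map_map, Polynomial.map_map]
    congr 1
    exact RingHom.ext hρ
  have hlc' : ρ fO.leadingCoeff ≠ 0 := by
    rw [leadingCoeff_map_of_injective hinj, hρ]
    simpa using hlc
  have hr : ∀ z : F, (fO.map O.subtype).IsRoot z → z ∈ O := fun z hz => by
    rw [hfO, IsRoot.def, eval_map] at hz
    exact (O.valuation_le_one_iff _).1 (h.valuation_integral hlc hz)
  have hdeg : (f.map (polyEmb K F)).degree ≠ 0 := by
    rw [map_polyEmb, degree_map]
    exact hirr.degree_pos.ne'
  obtain ⟨z₁, hz₁⟩ := hs.exists_eval_eq_zero hdeg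
  have hz₁O : z₁ ∈ O := hr z₁ (by rwa [hfO])
  have hroot : ∀ z : O, fO.IsRoot z → aeval (ρ z) (f.map (evalRingHom a)) = 0 := fun z hz => by
    rw [aeval_def, ← eval_map, ← hρf, eval_map, eval₂_hom, hz.eq_zero, map_zero]
  have hz₁r : fO.IsRoot ⟨z₁, hz₁O⟩ :=
    IsRoot.of_map (f := O.subtype) (by rw [hfO]; exact hz₁) Subtype.val_injective
  set c := ρ ⟨z₁, hz₁O⟩ with hc
  have hcint : IsIntegral K c := Algebra.IsIntegral.isIntegral c
  obtain ⟨q, hq⟩ := minpoly.dvd K c (hroot _ hz₁r)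
  suffices hu : IsUnit q by
    rw [hq]
    exact (irreducible_mul_isUnit hu).2 (minpoly.irreducible hcint)
  by_contra hu
  have hq0 : q ≠ 0 := by
    rintro rfl
    rw [hq, mul_zero] at hsep
    exact not_separable_zero hsep
  have hqs : q.Separable := hsep.of_dvd (Dvd.intro_left _ hq.symm)
  obtain ⟨w, hw⟩ := IsSepClosed.exists_aeval_eq_zero Ω q
    (fun h0 => hu (isUnit_iff_degree_eq_zero.2 h0)) hqs
  have hwf : fO.eval₂ ρ w = 0 := by
    rw [← eval_map, hρf, hq, eval_map, ← aeval_def, map_mul, hw, mul_zero]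
  obtain ⟨z, hz, hzw⟩ := exists_root_lift ρ hlc' (by rwa [hfO]) hr hwf
  obtain ⟨g, hg⟩ : ∃ g : F ≃ₐ[RatFunc K] F, g z₁ = z := by
    have hz' : (f.map (polyEmb K F)).eval (z : F) = 0 := by
      rw [← hfO]; exact hz.map (f := O.subtype)
    rw [map_polyEmb, eval_map_algebraMap] at hz₁ hz'
    refine minpoly.exists_algEquiv_of_root' (Algebra.IsAlgebraic.isAlgebraic z₁) ?_
    have hm := minpoly.eq_of_irreducible hirr hz₁
    rw [← hm, map_mul, hz', zero_mul]
  obtain ⟨σ, hσ⟩ := hsurj g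
  obtain ⟨b', hb', hσb⟩ := hσ ⟨z₁, hz₁O⟩
  have hb'z : b' = z := Subtype.ext (hb'.trans hg)
  have hwc : w = σ c := by rw [hσb, hb'z, hzw]
  have hpw : aeval w (minpoly K c) = 0 := by
    rw [hwc, aeval_algHom_apply, minpoly.aeval, map_zero]
  rw [hq] at hsep
  obtain ⟨s, t, hst⟩ := hsep.isCoprime
  have := congrArg (aeval w) hst
  simp [hpw, hw] at this

/-- A place with residue field `K` on `K(x)` and decomposition group the whole Galois group is
centred outside `T`, if `F` contains a root of `y ^ 2 - y = r` with `r` vanishing on `T` and at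
infinity. -/
lemma exists_isCenteredAt_notMem [FiniteDimensional (RatFunc K) F] [IsGalois (RatFunc K) F]
    {O : ValuationSubring F} (hmem : ∀ c : K, algebraMap K (RatFunc K) c ∈ basePlace (K := K) O)
    (hbij : Function.Bijective
      ((IsLocalRing.residue ↥(basePlace (K := K) O)).comp (KtoBase O hmem)))
    (hO : ∀ (g : F ≃ₐ[RatFunc K] F) (b : F), O.valuation b ≤ 1 → O.valuation (g b) ≤ 1)
    {T : Finset K} {r : RatFunc K} (hr : ∀ s : RatFunc K, s ^ 2 - s ≠ r)
    (hT : (1 < O.valuation (polyEmb K F X) ∨ ∃ a ∈ T, O.valuation (polyEmb K F (X - C a)) < 1) →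
      O.valuation (algebraMap (RatFunc K) F r) < 1)
    {y : F} (hy : y ^ 2 - y = algebraMap (RatFunc K) F r) :
    ∃ a ∉ T, IsCenteredAt O a := by
  have hC : ∀ c : K, O.valuation (polyEmb K F (C c)) ≤ 1 := fun c => by
    rw [polyEmb_C]; exact (O.valuation_le_one_iff _).2 (hmem c)
  have hnr : ¬ O.valuation (algebraMap (RatFunc K) F r) < 1 := fun hlt => by
    obtain ⟨s, hs⟩ := (IsGalois.mem_range_algebraMap_iff_fixed (F := RatFunc K) y).2 fun g =>
      fixed_of_valuation_sq_sub_lt (G := F ≃ₐ[RatFunc K] F) hO g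
        (by rw [hy]; exact g.commutes r) (by rwa [hy])
    refine hr s ((algebraMap (RatFunc K) F).injective ?_)
    rw [map_sub, map_pow, hs, hy]
  have hX : algebraMap K[X] (RatFunc K) X ∈ basePlace (K := K) O :=
    (O.valuation_le_one_iff _).1 (not_lt.1 fun h => hnr (hT (Or.inl h)))
  obtain ⟨a, ha⟩ := hbij.2 (IsLocalRing.residue _ ⟨_, hX⟩)
  rw [RingHom.comp_apply, eq_comm, ← sub_eq_zero, ← map_sub, IsLocalRing.residue_eq_zero_iff,
    mem_maximalIdeal_basePlace] at ha
  have ha' : O.valuation (polyEmb K F (X - C a)) < 1 := by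
    rw [map_sub, polyEmb_C, polyEmb, RingHom.comp_apply, ← map_sub]
    exact ha
  exact ⟨a, fun haT => hnr (hT (Or.inr ⟨a, haT, ha'⟩)), isCenteredAt_of_valuation_sub_lt hC ha'⟩

lemma isHilbertian_of_hasGeometricSolution
    (H : ∀ (F : Type) [Field F] [Algebra (RatFunc K) F],
      FiniteDimensional (RatFunc K) F → IsGalois (RatFunc K) F → HasGeometricSolution K F) :
    IsHilbertian K := by
  classical
  intro f hf hf'
  by_contra hfin
  rw [Set.not_infinite] at hfin
  have hf0 : f ≠ 0 := hf.ne_zero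
  obtain ⟨d, hd, u, v, huv⟩ := exists_bezout_derivative hf hf'
  let T : Finset K := hfin.toFinset ∪ (f.leadingCoeff.roots.toFinset ∪ d.roots.toFinset)
  obtain ⟨r, hr, hrT⟩ := exists_ratFunc_quadratic T
  let p := f.map (algebraMap K[X] (RatFunc K))
  let q : (RatFunc K)[X] := X ^ 2 - X - C r
  have hp : p.Separable := separable_map_fractionRing hf hf'
  have hq : q.Separable := separable_sq_sub hr
  let F := (p * q).SplittingField
  have hgal : IsGalois (RatFunc K) F := isGalois_splittingField_mul hp hq
  have hsplit : ((p * q).map (algebraMap (RatFunc K) F)).Splits := SplittingField.splits _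
  have hpq : (p * q).map (algebraMap (RatFunc K) F) ≠ 0 :=
    Polynomial.map_ne_zero (mul_ne_zero hp.ne_zero hq.ne_zero)
  have hqdeg : q.degree ≠ 0 := by
    have : q.degree = 2 := by simp only [q]; compute_degree!
    rw [this]
    exact two_ne_zero
  obtain ⟨y, hy⟩ := Splits.exists_eval_eq_zero
    (hsplit.of_dvd hpq (Polynomial.map_dvd _ (dvd_mul_left q p))) (by rwa [degree_map])
  have hy' : y ^ 2 - y = algebraMap (RatFunc K) F r := by
    simpa [q, sub_eq_zero] using hy
  obtain ⟨O, hmem, hbij, -, θ, em, hem, hcomp, hsurj⟩ := H F inferInstance hgal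
  have hO : ∀ (g : F ≃ₐ[RatFunc K] F) (b : F), O.valuation b ≤ 1 → O.valuation (g b) ≤ 1 := by
    intro g b hb
    obtain ⟨σ, rfl⟩ := hsurj g
    obtain ⟨b', hb', -⟩ := hcomp σ ⟨b, (O.valuation_le_one_iff _).1 hb⟩
    exact hb' ▸ (O.valuation_le_one_iff _).2 b'.2
  obtain ⟨a, haT, ha⟩ := exists_isCenteredAt_notMem hmem hbij hO hr (hrT F O (fun c => by
    rw [polyEmb_C]; exact (O.valuation_le_one_iff _).2 (hmem c))) hy'
  simp only [T, Finset.mem_union, Set.Finite.mem_toFinset, Multiset.mem_toFinset, not_or] at haT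
  obtain ⟨haH, hal, had⟩ := haT
  rw [mem_roots (leadingCoeff_ne_zero.2 hf0)] at hal
  rw [mem_roots hd] at had
  refine haH (ha.irreducible_specialize (em.comp (IsLocalRing.residue O)) (fun P => ?_)
    (fun g => ?_) (irreducible_map_fractionRing hf hf') ?_ hal ?_)
  · rw [RingHom.comp_apply, residue_polyO, ← hem]
    congr 2
  · obtain ⟨σ, rfl⟩ := hsurj g
    exact ⟨σ, hcomp σ⟩
  · rw [map_polyEmb]
    exact hsplit.of_dvd hpq (Polynomial.map_dvd _ (dvd_mul_right p q))
  · have h1 := congrArg (Polynomial.map (evalRingHom a)) huv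
    rw [Polynomial.map_add, Polynomial.map_mul, Polynomial.map_mul, ← derivative_map, map_C,
      coe_evalRingHom] at h1
    refine ⟨C (d.eval a)⁻¹ * u.map (evalRingHom a), C (d.eval a)⁻¹ * v.map (evalRingHom a), ?_⟩
    rw [mul_assoc, mul_assoc, ← mul_add, h1, ← C_mul, inv_mul_cancel₀ had, C_1]

/-- A field `K` is Hilbertian if and only if every rational finite
embedding problem for `K` is geometrically solvable: for every finite Galois extension
`F/K(x)` there is a `K`-place `φ` of `F`, unramified over `K(x)` with residue field of
`K(x)` equal to `K`, such that the induced map `φ* : Gal(K) → Gal(F/K(x))` is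
surjective. -/
theorem isHilbertian_iff_geometric_solvable (K : Type) [Field K] :
    IsHilbertian K ↔
      ∀ (F : Type) [Field F] [Algebra (RatFunc K) F],
        FiniteDimensional (RatFunc K) F → IsGalois (RatFunc K) F →
          HasGeometricSolution K F := by
  exact ⟨fun hK F _ _ _ _ => hK.hasGeometricSolution, isHilbertian_of_hasGeometricSolution⟩

end
end

section
/- There exists a non-Hilbertian field K whose absolute Galois group is ω-free (every finite embedding problem for Gal(K) is solvable). Concretely, with K₀ = ℂ(x), the restriction map Gal(K₀((t))) → Gal(K₀) splits, and the fixed field K of the image of a section has Gal(K) ≅ Gal(K₀) free of infinite rank, while K is Henselian and hence not Hilbertian. -/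
open Polynomial

/-- The absolute Galois group of `K` (automorphisms of the separable closure inside a
fixed algebraic closure), carrying the Krull topology. -/
abbrev AbsGal (K : Type) [Field K] :=
  (separableClosure K (AlgebraicClosure K)) ≃ₐ[K] (separableClosure K (AlgebraicClosure K))

/-- A profinite group is `ω`-free if every finite embedding problem for it is solvable:
for all finite groups `A`, `B`, every continuous epimorphism `ν : G → A` and epimorphism
`α : B → A` admit a continuous epimorphism `θ : G → B` with `α ∘ θ = ν`.  (Continuity of
a homomorphism to a finite discrete group means its kernel is open.) -/
def IsOmegaFree (G : Type) [Group G] [TopologicalSpace G] : Prop :=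
  ∀ (A B : Type) [Group A] [Group B] [Finite A] [Finite B]
    (ν : G →* A) (α : B →* A),
    Function.Surjective ν → IsOpen (ν.ker : Set G) → Function.Surjective α →
    ∃ θ : G →* B, Function.Surjective θ ∧ IsOpen (θ.ker : Set G) ∧ α.comp θ = ν

/-- Let `Γ` act on an algebraically closed field by isometries of a nonarchimedean absolute value.
If the fixed field contains elements of arbitrarily small absolute value and is not quadratically
closed, then it is not Hilbertian. -/
theorem not_isHilbertian_fixedPoints {Γ Ω : Type} [Group Γ] [Field Ω] [IsAlgClosed Ω]
    [MulSemiringAction Γ Ω] (v : AbsoluteValue Ω ℝ) (hv : IsNonarchimedean v)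
    (hinv : ∀ (γ : Γ) (y : Ω), v (γ • y) = v y) (h2 : (2 : Ω) ≠ 0)
    (hsmall : ∀ ε > 0, ∃ s : FixedPoints.subfield Γ Ω, s ≠ 0 ∧ v s < ε)
    {d : Ω} (hd : d ≠ 0) (hd2 : d ^ 2 ∈ FixedPoints.subfield Γ Ω) {γ₀ : Γ} (hγ₀ : γ₀ • d = -d) :
    ¬ IsHilbertian (FixedPoints.subfield Γ Ω) := by
  intro hH
  set K := FixedPoints.subfield Γ Ω with hK
  have hfix (γ : Γ) (x : K) : γ • (x : Ω) = x := x.2 γ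
  have hv2 : 0 < v 2 := v.pos h2
  obtain ⟨s, hs0, hs⟩ := hsmall (v 2 ^ 2 * v (2 * d) ^ 2)
    (mul_pos (pow_pos hv2 2) (pow_pos (v.pos (mul_ne_zero h2 hd)) 2))
  set a : K := ⟨d ^ 2, hd2⟩ with ha
  -- values of `X ^ 2 - a` are bounded away from zero
  have hbound (x : K) : v (2 * d) ^ 2 ≤ v ((x ^ 2 - a : K) : Ω) := by
    have hconj : v (x + d) = v (x - d) := by
      rw [← hinv γ₀ (x - d), smul_sub, hfix, hγ₀, sub_neg_eq_add]
    have hle : v (2 * d) ≤ v (x - d) := by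
      have := hv (x + d) (-(x - d))
      rw [v.map_neg, hconj, max_self] at this
      rwa [show (x : Ω) + d + -(x - d) = 2 * d by ring] at this
    have : ((x ^ 2 - a : K) : Ω) = (x - d) * (x + d) := by
      change (x : Ω) ^ 2 - d ^ 2 = _
      ring
    rw [this, v.map_mul (_ - d), hconj, ← sq]
    exact pow_le_pow_left₀ (v.nonneg _) hle 2
  have hb0 (x : K) : x ^ 2 - a ≠ 0 := by
    intro h
    have := hbound x
    rw [h] at this
    simp only [ZeroMemClass.coe_zero, map_zero] at this
    exact absurd this (not_le.2 (pow_pos (v.pos (mul_ne_zero h2 hd)) 2))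
  -- elements close to one are squares
  have hsq (u : K) (hu : v u < v 2 ^ 2) : ∃ w : K, w ^ 2 = 1 + u := by
    obtain ⟨w, hw⟩ := IsAlgClosed.exists_pow_nat_eq ((1 + u : K) : Ω) (n := 2) two_pos
    obtain ⟨w, hw, hw1⟩ : ∃ w : Ω, w ^ 2 = ((1 + u : K) : Ω) ∧ v (w - 1) < v 2 := by
      by_cases h : v (w - 1) < v 2
      · exact ⟨w, hw, h⟩
      refine ⟨-w, by rw [neg_sq, hw], ?_⟩
      rw [show -w - 1 = -(w + 1) by ring, v.map_neg]
      by_contra! h'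
      have h4 : v u = v (w - 1) * v (w + 1) := by
        rw [← map_mul]
        congr 1
        push_cast at hw
        linear_combination -hw
      rw [h4, sq] at hu
      exact absurd hu (not_lt.2 (mul_le_mul (not_lt.1 h) h' hv2.le (v.nonneg _)))
    refine ⟨⟨w, fun γ => ?_⟩, Subtype.ext hw⟩
    have h1 : (γ • w) ^ 2 = w ^ 2 := by rw [← smul_pow', hw, hfix]
    rcases sq_eq_sq_iff_eq_or_eq_neg.1 h1 with h | h
    · exact h
    · exfalso
      have h3 : v (w + 1) = v (w - 1) := by
        rw [← hinv γ (w - 1), smul_sub, smul_one, h, ← v.map_neg]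
        congr 1
        ring
      have := hv (w + 1) (-(w - 1))
      rw [v.map_neg, h3, max_self, show w + 1 + -(w - 1) = 2 by ring] at this
      exact absurd hw1 (not_lt.2 this)
  set p : K[X] := X ^ 2 - C a with hp
  set q : K[X] := p * (p + C s) with hq
  have hp_irr : Irreducible p := by
    have hm : p.Monic := monic_X_pow_sub_C a two_ne_zero
    have hdeg : p.natDegree = 2 := natDegree_X_pow_sub_C
    rw [hm.irreducible_iff_roots_eq_zero_of_degree_le_three hdeg.ge (by omega)]
    refine Multiset.eq_zero_of_forall_notMem fun x hx => hb0 x ?_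
    have := (mem_roots'.1 hx).2
    simpa [hp] using this
  have hq_sq (g : K[X]) : g ^ 2 ≠ q := by
    intro h
    have hpg : p ∣ g := hp_irr.prime.dvd_of_dvd_pow (h.symm ▸ Dvd.intro _ rfl : p ∣ g ^ 2)
    have : p * p ∣ p * (p + C s) := by
      rw [← hq, ← h, sq]
      exact mul_dvd_mul hpg hpg
    have h1 : p ∣ p + C s := (mul_dvd_mul_iff_left hp_irr.ne_zero).1 this
    have h2 : p ∣ C s := (dvd_add_right (dvd_refl p)).1 h1
    exact hp_irr.not_isUnit (isUnit_of_dvd_unit h2 (isUnit_C.2 (isUnit_iff_ne_zero.2 hs0)))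
  set f : K[X][X] := X ^ 2 - C q with hf
  have hf_irr : Irreducible f := by
    have hm : f.Monic := monic_X_pow_sub_C q two_ne_zero
    have hdeg : f.natDegree = 2 := natDegree_X_pow_sub_C
    rw [hm.irreducible_iff_roots_eq_zero_of_degree_le_three hdeg.ge (by omega)]
    refine Multiset.eq_zero_of_forall_notMem fun g hg => hq_sq g ?_
    have := (mem_roots'.1 hg).2
    rw [IsRoot.def, hf, eval_sub, eval_pow, eval_X, eval_C, sub_eq_zero] at this
    exact this
  have h2K : (2 : K) ≠ 0 := fun h => h2 (congrArg (Subtype.val) h)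
  have hf_der : f.derivative ≠ 0 := by
    intro h
    have := congrArg (fun r => (r.coeff 1).coeff 0) h
    simp [hf, one_add_one_eq_two, h2K] at this
  refine (hH f hf_irr hf_der).nonempty.elim fun x hx => ?_
  have hbx := hb0 x
  obtain ⟨w, hw⟩ := hsq (s / (x ^ 2 - a)) (by
    have h0 : 0 < v ((x ^ 2 - a : K) : Ω) := v.pos (by exact_mod_cast hbx)
    rw [show ((s / (x ^ 2 - a) : K) : Ω) = (s : Ω) / ((x ^ 2 - a : K) : Ω) by push_cast; rfl,
      map_div₀, div_lt_iff₀ h0]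
    exact hs.trans_le (mul_le_mul_of_nonneg_left (hbound x) (sq_nonneg _)))
  have hmap : f.map (evalRingHom x) = X ^ 2 - C (((x ^ 2 - a) * w) ^ 2) := by
    rw [mul_pow, hw]
    simp only [hf, hq, hp, Polynomial.map_sub, Polynomial.map_pow, map_X, map_C, coe_evalRingHom,
      eval_mul, eval_add, eval_sub, eval_pow, eval_X, eval_C]
    congr 2
    field_simp
  have hx' : Irreducible (X ^ 2 - C (((x ^ 2 - a) * w) ^ 2) : K[X]) := hmap ▸ hx
  rw [C_pow, sq_sub_sq] at hx'
  rcases hx'.isUnit_or_isUnit rfl with h | h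
  · rw [← sub_neg_eq_add, ← C_neg] at h
    exact not_isUnit_X_sub_C _ h
  · exact not_isUnit_X_sub_C _ h

/-- A topological group with a dense homomorphism from the free group on `ℕ` through which every
homomorphism to a finite group extends continuously is `ω`-free. -/
theorem isOmegaFree_of_dense {G : Type} [Group G] [TopologicalSpace G] [IsTopologicalGroup G]
    (ρ : FreeGroup ℕ →* G) (hρ : DenseRange ρ)
    (hext : ∀ (B : Type) [Group B] [Finite B] (τ : FreeGroup ℕ →* B),
      ∃ θ : G →* B, IsOpen (θ.ker : Set G) ∧ θ.comp ρ = τ) :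
    IsOmegaFree G := by
  intro A B _ _ _ _ ν α _ hνo hα
  -- some fibre of the map `ℕ → A` induced by `ν` is infinite
  obtain ⟨a, ha⟩ := Finite.exists_infinite_fiber fun i => ν (ρ (.of i))
  have hF : Infinite {i // ν (ρ (.of i)) = a} := ha
  obtain ⟨b₀, hb₀⟩ := hα a
  have : Nonempty (α ⁻¹' {a}) := ⟨⟨b₀, hb₀⟩⟩
  obtain ⟨g, hg⟩ : ∃ g : {i // ν (ρ (.of i)) = a} → (α ⁻¹' {a} : Set B),
      Function.Surjective g := by
    obtain ⟨n, ⟨e⟩⟩ := Finite.exists_equiv_fin (α ⁻¹' {a} : Set B)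
    obtain ⟨h⟩ : Nonempty ((α ⁻¹' {a} : Set B) ↪ {i // ν (ρ (.of i)) = a}) :=
      ⟨e.toEmbedding.trans (Fin.valEmbedding.trans (Infinite.natEmbedding _))⟩
    exact ⟨Function.invFun h, Function.invFun_surjective h.injective⟩
  classical
  choose r hr using hα
  set τ₀ : ℕ → B := fun i =>
    if h : ν (ρ (.of i)) = a then (g ⟨i, h⟩ : B) else r (ν (ρ (.of i))) with hτ₀
  set τ : FreeGroup ℕ →* B := FreeGroup.lift τ₀ with hτ
  have hατ : α.comp τ = ν.comp ρ := by
    ext i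
    by_cases h : ν (ρ (.of i)) = a
    · have : α (g ⟨i, h⟩) = a := (g ⟨i, h⟩).2
      simp [hτ, hτ₀, h, this]
    · simp [hτ, hτ₀, h, hr]
  obtain ⟨θ, hθo, hθ⟩ := hext B τ
  have happ (σ : G) (U : Set G) (hU : IsOpen U) (h1 : 1 ∈ U) : ∃ γ, σ⁻¹ * ρ γ ∈ U := by
    obtain ⟨γ, hγ⟩ := hρ.exists_mem_open (hU.preimage (continuous_const_mul σ⁻¹)) ⟨σ, by simpa⟩
    exact ⟨γ, hγ⟩
  have hcomp : α.comp θ = ν := by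
    ext σ
    obtain ⟨γ, hγ₁, hγ₂⟩ := happ σ _ (hθo.inter hνo) ⟨one_mem θ.ker, one_mem ν.ker⟩
    simp only [SetLike.mem_coe, MonoidHom.mem_ker, map_mul, map_inv, inv_mul_eq_one] at hγ₁ hγ₂
    rw [MonoidHom.comp_apply, hγ₁, hγ₂]
    rw [← MonoidHom.comp_apply θ, hθ]
    exact DFunLike.congr_fun hατ γ
  refine ⟨θ, ?_, hθo, hcomp⟩
  have hmem (b : B) (hb : α b = a) : b ∈ θ.range := by
    obtain ⟨⟨i, hi⟩, hgi⟩ := hg ⟨b, hb⟩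
    refine ⟨ρ (.of i), ?_⟩
    have := DFunLike.congr_fun hθ (.of i)
    simp only [MonoidHom.comp_apply] at this
    simp [this, hτ, hτ₀, hi, hgi]
  have hker : α.ker ≤ θ.range := by
    intro k hk
    have := mul_mem (inv_mem (hmem b₀ hb₀)) (hmem (b₀ * k) (by simp [hb₀, MonoidHom.mem_ker.1 hk]))
    simpa using this
  intro b
  obtain ⟨σ, hσ⟩ := ‹Function.Surjective ν› (α b)
  have : (θ σ)⁻¹ * b ∈ θ.range := hker (by
    rw [MonoidHom.mem_ker, map_mul, map_inv, inv_mul_eq_one, ← hσ, ← hcomp, MonoidHom.comp_apply])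
  have := mul_mem (⟨σ, rfl⟩ : θ σ ∈ θ.range) this
  rwa [mul_inv_cancel_left] at this

/-- If a permutation representation of `Γ` on a finite family of elements of `Ω` describes the
action of `Γ`, then these elements are integral over the fixed field. -/
theorem isIntegral_of_smul_eq {Γ K Ω : Type*} [Group Γ] [Field K] [Field Ω] [Algebra K Ω]
    [MulSemiringAction Γ Ω] (hfix : ∀ y : Ω, (∀ γ : Γ, γ • y = y) → y ∈ (algebraMap K Ω).range)
    {ι : Type*} [Finite ι] (x : ι → Ω) (φ : Γ →* Equiv.Perm ι)
    (hx : ∀ γ i, γ • x i = x (φ γ i)) (i : ι) : IsIntegral K (x i) := by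
  have := Fintype.ofFinite ι
  set P : Polynomial Ω := ∏ i, (X - C (x i)) with hP
  have hPm : P.Monic := monic_prod_of_monic _ _ fun i _ => monic_X_sub_C _
  have hPγ (γ : Γ) : γ • P = P := by
    rw [hP, Finset.smul_prod']
    simp only [smul_sub, smul_X, smul_C, hx]
    exact Equiv.prod_comp (φ γ) fun i => X - C (x i)
  have hlift : P ∈ lifts (algebraMap K Ω) := by
    rw [lifts_iff_coeff_lifts]
    intro n
    refine hfix _ fun γ => ?_
    rw [← coeff_smul, hPγ]
  obtain ⟨Q, hQ, -, hQm⟩ := lifts_and_degree_eq_and_monic hlift hPm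
  refine ⟨Q, hQm, ?_⟩
  rw [← eval_map, hQ, hP, eval_prod]
  exact Finset.prod_eq_zero (Finset.mem_univ i) (by simp)

/-- Let the free group on `ℕ` act on a field `Ω` with fixed field `K` such that every permutation
representation on `Fin n` occurs in `Ω`. If `S ⊆ Ω` is an algebraically closed Galois extension of
`K`, then its Galois group is `ω`-free. -/
theorem isOmegaFree_gal {K S Ω : Type} [Field K] [Field S] [Field Ω] [Algebra K S] [Algebra S Ω]
    [Algebra K Ω] [IsScalarTower K S Ω] [IsGalois K S] [IsAlgClosed S]
    [MulSemiringAction (FreeGroup ℕ) Ω] [SMulCommClass (FreeGroup ℕ) K Ω]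
    (hfix : ∀ y : Ω, (∀ γ : FreeGroup ℕ, γ • y = y) → y ∈ (algebraMap K Ω).range)
    (hperm : ∀ (n : ℕ) (φ : FreeGroup ℕ →* Equiv.Perm (Fin n)), ∃ x : Fin n → Ω,
      Function.Injective x ∧ ∀ γ i, γ • x i = x (φ γ i)) :
    IsOmegaFree Gal(S/K) := by
  let ρ : FreeGroup ℕ →* Gal(S/K) :=
    (AlgEquiv.restrictNormalHom S).comp (MulSemiringAction.toAlgAut (FreeGroup ℕ) K Ω)
  have hρ (γ : FreeGroup ℕ) (y : S) : algebraMap S Ω (ρ γ y) = γ • algebraMap S Ω y :=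
    AlgEquiv.restrictNormal_commutes (MulSemiringAction.toAlgAut (FreeGroup ℕ) K Ω γ) S y
  have hdense : DenseRange ρ := by
    let H : ClosedSubgroup (Gal(S/K)) :=
      ⟨ρ.range.topologicalClosure, ρ.range.isClosed_topologicalClosure⟩
    have hbot : IntermediateField.fixedField H.toSubgroup = ⊥ := by
      refine eq_bot_iff.2 fun y hy => ?_
      have hy' (γ : FreeGroup ℕ) : γ • algebraMap S Ω y = algebraMap S Ω y := by
        rw [← hρ]
        exact congrArg (algebraMap S Ω) (hy ⟨ρ γ, subset_closure ⟨γ, rfl⟩⟩)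
      obtain ⟨z, hz⟩ := hfix _ hy'
      exact IntermediateField.mem_bot.2 ⟨z, (algebraMap S Ω).injective (by
        rw [← IsScalarTower.algebraMap_apply, hz])⟩
    have htop := InfiniteGalois.fixingSubgroup_fixedField H
    rw [hbot, IntermediateField.fixingSubgroup_bot] at htop
    intro σ
    have : σ ∈ H.toSubgroup := htop ▸ Subgroup.mem_top σ
    exact this
  refine isOmegaFree_of_dense ρ hdense fun B _ _ τ => ?_
  obtain ⟨n, ⟨e⟩⟩ := Finite.exists_equiv_fin B
  obtain ⟨x, hxinj, hx⟩ := hperm n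
    ((e.permCongrHom : _ →* _).comp ((MulAction.toPermHom B B).comp τ))
  have hxB (γ : FreeGroup ℕ) (b : B) : γ • x (e b) = x (e (τ γ * b)) := by
    rw [hx]
    simp [Equiv.permCongrHom]
  have hy (b : B) : ∃ y : S, algebraMap S Ω y = x (e b) := by
    have hint : IsIntegral K (x (e b)) := isIntegral_of_smul_eq hfix x _ hx _
    have hint' : IsIntegral S (x (e b)) := hint.tower_top
    exact minpoly.mem_range_of_degree_eq_one S _
      (IsAlgClosed.degree_eq_one_of_irreducible S (minpoly.irreducible hint'))
  choose y hy using hy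
  have hyinj : Function.Injective y := fun b c h => by
    have := congrArg (algebraMap S Ω) h
    rwa [hy, hy, hxinj.eq_iff, e.injective.eq_iff] at this
  have hyρ (γ : FreeGroup ℕ) (b : B) : ρ γ (y b) = y (τ γ * b) :=
    (algebraMap S Ω).injective (by rw [hρ, hy, hy, hxB])
  have happ (σ : Gal(S/K)) : ∃ γ, ∀ b, σ (y b) = y (τ γ * b) := by
    have hU : IsOpen (⋂ b, (MulAction.stabilizer (Gal(S/K)) (y b) : Set (Gal(S/K)))) :=
      isOpen_iInter_of_finite fun b => stabilizer_isOpen_of_isIntegral (y b)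
    obtain ⟨γ, hγ⟩ := hdense.exists_mem_open (hU.preimage (continuous_const_mul σ⁻¹))
      ⟨σ, by simp [one_mem]⟩
    refine ⟨γ, fun b => ?_⟩
    have : (σ⁻¹ * ρ γ) • y b = y b := Set.mem_iInter.1 hγ b
    rw [mul_smul, inv_smul_eq_iff] at this
    rw [← hyρ]
    exact this.symm
  choose c hc using happ
  have hcτ (γ : FreeGroup ℕ) : τ (c (ρ γ)) = τ γ := by
    have := hc (ρ γ) 1
    rw [hyρ, hyinj.eq_iff, mul_one, mul_one] at this
    exact this.symm
  let θ : Gal(S/K) →* B := MonoidHom.mk' (fun σ => τ (c σ)) fun σ σ' => by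
    have := hc (σ * σ') 1
    rw [AlgEquiv.mul_apply, hc, hc, hyinj.eq_iff, mul_one, mul_one] at this
    exact this.symm
  refine ⟨θ, ?_, MonoidHom.ext hcτ⟩
  refine Subgroup.isOpen_mono (H₁ := MulAction.stabilizer (Gal(S/K)) (y 1)) (fun σ hσ => ?_)
    (stabilizer_isOpen_of_isIntegral (y 1))
  have : σ (y 1) = y 1 := hσ
  rw [hc, hyinj.eq_iff, mul_one] at this
  exact this

/-- If the free group on `ℕ` acts on an algebraically closed field of characteristic zero such that
every permutation representation on `Fin n` occurs, then the absolute Galois group of the fixed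
field is `ω`-free. -/
theorem isOmegaFree_absGal_fixedPoints {Ω : Type} [Field Ω] [IsAlgClosed Ω] [CharZero Ω]
    [MulSemiringAction (FreeGroup ℕ) Ω]
    (hperm : ∀ (n : ℕ) (φ : FreeGroup ℕ →* Equiv.Perm (Fin n)), ∃ x : Fin n → Ω,
      Function.Injective x ∧ ∀ γ i, γ • x i = x (φ γ i)) :
    IsOmegaFree (AbsGal (FixedPoints.subfield (FreeGroup ℕ) Ω)) := by
  let K := FixedPoints.subfield (FreeGroup ℕ) Ω
  let S := separableClosure K (AlgebraicClosure K)
  have : CharZero K := (algebraMap K Ω).charZero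
  have : IsAlgClosed S := IsSepClosed.isAlgClosed_of_perfectField _
  have : Module.IsTorsionFree K S := inferInstanceAs (Module.IsTorsionFree K
    (separableClosure K (AlgebraicClosure K)))
  let j : S →ₐ[K] Ω := IsAlgClosed.lift
  let : Algebra S Ω := j.toRingHom.toAlgebra
  have : IsScalarTower K S Ω := .of_algebraMap_eq fun x => (j.commutes x).symm
  have : IsGalois K S := separableClosure.isGalois K _
  exact isOmegaFree_gal (Ω := Ω) (fun y hy => ⟨⟨y, hy⟩, rfl⟩) hperm

/-- The spectral norm is invariant under semilinear automorphisms over an isometry. -/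
theorem spectralNorm_map_eq {N L : Type*} [NormedField N] [Field L] [Algebra N L]
    [Algebra.IsAlgebraic N L] (σ : N ≃+* N) (hσ : ∀ x, ‖σ x‖ = ‖x‖) (τ : L ≃+* L)
    (hτ : ∀ x, τ (algebraMap N L x) = algebraMap N L (σ x)) (y : L) :
    spectralNorm N L (τ y) = spectralNorm N L y := by
  have hy : IsIntegral N y := Algebra.IsIntegral.isIntegral y
  have hcomp : (algebraMap N L).comp (σ : N →+* N) = (τ : L →+* L).comp (algebraMap N L) :=
    RingHom.ext fun x => (hτ x).symm
  have hmin : (minpoly N y).map (σ : N →+* N) = minpoly N (τ y) := by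
    refine minpoly.eq_of_irreducible_of_monic ?_ ?_ ((minpoly.monic hy).map _)
    · exact (MulEquiv.irreducible_iff (mapEquiv σ)).2 (minpoly.irreducible hy)
    · rw [aeval_def, eval₂_map, hcomp, ← RingEquiv.coe_toRingHom τ, ← hom_eval₂, ← aeval_def,
        minpoly.aeval, map_zero]
  rw [spectralNorm, spectralNorm, ← hmin, spectralValue, spectralValue]
  congr 1
  ext n
  simp only [spectralValueTerms, natDegree_map, coeff_map, RingEquiv.coe_toRingHom, hσ]

/-- The automorphism of a field of Laurent series given by an automorphism of the coefficients. -/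
noncomputable def laurentMapEquiv {F : Type*} [Field F] (σ : F ≃+* F) :
    LaurentSeries F ≃+* LaurentSeries F where
  toFun f := HahnSeries.map f σ
  invFun f := HahnSeries.map f σ.symm
  left_inv f := by ext; simp
  right_inv f := by ext; simp
  map_mul' _ _ := HahnSeries.map_mul (σ : F →ₙ+* F)
  map_add' _ _ := HahnSeries.map_add (σ : F →+ F)

theorem laurentMapEquiv_apply {F : Type*} [Field F] (σ : F ≃+* F) (f : LaurentSeries F) :
    laurentMapEquiv σ f = HahnSeries.map f σ := rfl

theorem valuation_laurentMapEquiv {F : Type*} [Field F] (σ : F ≃+* F) (f : LaurentSeries F) :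
    (Valued.v (laurentMapEquiv σ f) : WithZero (Multiplicative ℤ)) = Valued.v f := by
  refine eq_of_forall_ge_iff fun D => ?_
  rcases eq_or_ne D 0 with rfl | hD
  · simp
  · rw [LaurentSeries.valuation_le_iff_coeff_lt_log_eq_zero F hD,
      LaurentSeries.valuation_le_iff_coeff_lt_log_eq_zero F hD]
    simp [laurentMapEquiv_apply]

/-- The valuation on a field of Laurent series has rank one. -/
noncomputable abbrev laurentRankOne (F : Type*) [Field F] :
    (Valued.v : Valuation (LaurentSeries F) (WithZero (Multiplicative ℤ))).RankOne where
  hom' := (WithZeroMulInt.toNNReal two_ne_zero).comp MonoidWithZeroHom.ValueGroup₀.embedding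
  strictMono' := (WithZeroMulInt.toNNReal_strictMono one_lt_two).comp
    MonoidWithZeroHom.ValueGroup₀.embedding_strictMono
  exists_val_nontrivial := by
    refine ⟨HahnSeries.single 1 1, ?_⟩
    rw [LaurentSeries.valuation_single_zpow]
    decide

theorem FreeGroup.smul_eq_of_forall_of {α X ι : Type*} [MulAction (FreeGroup α) X] (x : ι → X)
    (φ : FreeGroup α →* Equiv.Perm ι)
    (h : ∀ k i, FreeGroup.of k • x i = x (φ (.of k) i)) (γ : FreeGroup α) (i : ι) :
    γ • x i = x (φ γ i) := by
  induction γ using FreeGroup.induction_on generalizing i with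
  | C1 => simp
  | of k => exact h k i
  | inv_of k _ =>
    rw [inv_smul_eq_iff, h, ← Equiv.Perm.mul_apply, ← _root_.map_mul, mul_inv_cancel,
      _root_.map_one, Equiv.Perm.one_apply]
  | mul a b ha hb => rw [mul_smul, hb, ha, _root_.map_mul, Equiv.Perm.mul_apply]

/-- A family of isometric automorphisms of a complete nonarchimedean field extends to an isometric
action of a free group on an algebraic closure. -/
theorem exists_isometric_action {α N : Type} [NontriviallyNormedField N] [IsUltrametricDist N]
    [CompleteSpace N] [CharZero N] (σ : α → N ≃+* N) (hσ : ∀ k x, ‖σ k x‖ = ‖x‖) :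
    ∃ (Ω : Type) (_ : Field Ω) (_ : IsAlgClosed Ω) (_ : CharZero Ω)
      (_ : MulSemiringAction (FreeGroup α) Ω) (v : AbsoluteValue Ω ℝ) (i : N →+* Ω),
      IsNonarchimedean v ∧ (∀ (γ : FreeGroup α) (y : Ω), v (γ • y) = v y) ∧
      (∀ k x, FreeGroup.of k • i x = i (σ k x)) ∧ ∀ x, v (i x) = ‖x‖ := by
  let Ω := AlgebraicClosure N
  let τ (k : α) : RingAut Ω := IsAlgClosure.equivOfEquiv Ω Ω (σ k)
  have hτ (k : α) (x : N) : τ k (algebraMap N Ω x) = algebraMap N Ω (σ k x) :=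
    IsAlgClosure.equivOfEquiv_algebraMap Ω Ω _ x
  let act : MulSemiringAction (FreeGroup α) Ω := MulSemiringAction.compHom Ω (FreeGroup.lift τ)
  have hact (k : α) (y : Ω) : FreeGroup.of k • y = τ k y :=
    congrArg (fun f : RingAut Ω => f y) FreeGroup.lift_apply_of
  let v : AbsoluteValue Ω ℝ :=
    { toFun := spectralNorm N Ω
      map_mul' := map_mul (spectralMulAlgNorm N Ω)
      nonneg' := apply_nonneg (spectralMulAlgNorm N Ω)
      eq_zero' := fun _ => map_eq_zero_iff_eq_zero (spectralMulAlgNorm N Ω)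
      add_le' := map_add_le_add (spectralMulAlgNorm N Ω) }
  have hv (y : Ω) : v y = spectralNorm N Ω y := rfl
  refine ⟨Ω, inferInstance, inferInstance, charZero_of_injective_algebraMap (algebraMap N Ω).injective, act, v,
    algebraMap N Ω, isNonarchimedean_spectralNorm, fun γ y => ?_,
    fun k x => by rw [hact, hτ], spectralNorm_extends⟩
  induction γ using FreeGroup.induction_on generalizing y with
  | C1 => rw [one_smul]
  | of k =>
    rw [hact, hv, hv]
    exact spectralNorm_map_eq (σ k) (hσ k) _ (hτ k) y
  | inv_of k h => rw [← h ((FreeGroup.of k)⁻¹ • y), smul_inv_smul]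
  | mul a b ha hb => rw [mul_smul, ha, hb]

/-- A family of automorphisms of a field of characteristic zero extends to an isometric action of
a free group on an algebraically closed field with a nonarchimedean absolute value, with fixed
elements of arbitrarily small absolute value. -/
theorem exists_isometric_action_extending {α F : Type} [Field F] [CharZero F] (σ : α → F ≃+* F) :
    ∃ (Ω : Type) (_ : Field Ω) (_ : IsAlgClosed Ω) (_ : CharZero Ω)
      (_ : MulSemiringAction (FreeGroup α) Ω) (v : AbsoluteValue Ω ℝ) (i : F →+* Ω),
      IsNonarchimedean v ∧ (∀ (γ : FreeGroup α) (y : Ω), v (γ • y) = v y) ∧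
      (∀ k x, FreeGroup.of k • i x = i (σ k x)) ∧
      ∀ ε > 0, ∃ s : FixedPoints.subfield (FreeGroup α) Ω, s ≠ 0 ∧ v s < ε := by
  let _ := laurentRankOne F
  let _ : NontriviallyNormedField (LaurentSeries F) :=
    Valued.toNontriviallyNormedField _ (WithZero (Multiplicative ℤ))
  have : IsUltrametricDist (LaurentSeries F) := 
    IsUltrametricDist.isUltrametricDist_of_isNonarchimedean_norm
      (Valued.isNonarchimedean_norm (LaurentSeries F) (WithZero (Multiplicative ℤ)))
  have : CompleteSpace (LaurentSeries F) := LaurentSeries.instLaurentSeriesComplete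
  have : CharZero (LaurentSeries F) := charZero_of_injective_ringHom
    (f := (HahnSeries.C : F →+* LaurentSeries F)) (RingHom.injective _)
  obtain ⟨Ω, _, _, _, _, v, i, hv, hinv, hi, hvi⟩ := exists_isometric_action
    (fun k => laurentMapEquiv (σ k)) fun k x => le_antisymm
      (Valued.toNormedField.norm_le_iff.2 (valuation_laurentMapEquiv _ x).le)
      (Valued.toNormedField.norm_le_iff.2 (valuation_laurentMapEquiv _ x).ge)
  refine ⟨Ω, _, ‹_›, ‹_›, _, v, i.comp HahnSeries.C, hv, hinv, fun k x => ?_, fun ε hε => ?_⟩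
  · rw [RingHom.comp_apply, hi, laurentMapEquiv_apply]
    exact congrArg i (HahnSeries.map_C x (σ k : F →+* F))
  · let t : LaurentSeries F := HahnSeries.single 1 1
    have ht : ‖t‖ < 1 := by
      rw [Valued.toNormedField.norm_lt_one_iff, LaurentSeries.valuation_single_zpow]
      decide
    have ht0 : t ≠ 0 := HahnSeries.single_ne_zero one_ne_zero
    have hfix (γ : FreeGroup α) : γ • i t = i t := by
      refine FreeGroup.smul_eq_of_forall_of (fun _ : Unit => i t) 1 (fun k _ => ?_) γ ()
      rw [hi, laurentMapEquiv_apply]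
      refine congrArg i ?_
      ext n
      simp [t, HahnSeries.coeff_single, apply_ite (σ k)]
    obtain ⟨m, hm⟩ := exists_pow_lt_of_lt_one hε ht
    refine ⟨⟨i t, hfix⟩ ^ m, pow_ne_zero m fun h => ht0 ?_, ?_⟩
    · exact i.injective ((congrArg Subtype.val h).trans (map_zero i).symm)
    · rw [SubmonoidClass.coe_pow, map_pow, hvi]
      exact hm

/-- There exists a non-Hilbertian field `K` whose absolute Galois group
is `ω`-free.  (Concretely, take `K₀ = ℂ(x)`; the restriction map
`Gal(K₀((t))) → Gal(K₀)` splits, and the fixed field `K` of the image of a section has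
`Gal(K) ≅ Gal(K₀)` free of infinite rank, while `K` is Henselian and hence not
Hilbertian.) -/
theorem exists_nonHilbertian_omegaFree :
    ∃ (K : Type) (_ : Field K), ¬ IsHilbertian K ∧ IsOmegaFree (AbsGal K) := by
  let I := (n : ℕ) × (ℕ → Equiv.Perm (Fin n)) × Fin n
  let F := FractionRing (MvPolynomial I ℚ)
  let e (k : ℕ) : Equiv.Perm I :=
    Equiv.sigmaCongrRight fun n => Equiv.prodShear (.refl _) fun φ => φ k
  let σ (k : ℕ) : F ≃+* F :=
    IsFractionRing.ringEquivOfRingEquiv (MvPolynomial.renameEquiv ℚ (e k)).toRingEquiv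
  let X (c : I) : F := algebraMap (MvPolynomial I ℚ) F (MvPolynomial.X c)
  have hX : Function.Injective X :=
    (IsFractionRing.injective _ _).comp (MvPolynomial.X_injective)
  have hσ (k : ℕ) (c : I) : σ k (X c) = X (e k c) := by
    simp [σ, X]
  have : CharZero F := charZero_of_injective_ringHom
    (f := (algebraMap (MvPolynomial I ℚ) F).comp MvPolynomial.C) (RingHom.injective _)
  obtain ⟨Ω, _, _, _, _, v, i, hv, hinv, hi, hsmall⟩ := exists_isometric_action_extending σ
  have hperm (n : ℕ) (φ : FreeGroup ℕ →* Equiv.Perm (Fin n)) : ∃ x : Fin n → Ω,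
      Function.Injective x ∧ ∀ γ i, γ • x i = x (φ γ i) := by
    refine ⟨fun m => i (X ⟨n, fun k => φ (.of k), m⟩), fun m m' h => ?_,
      FreeGroup.smul_eq_of_forall_of _ φ fun k m => ?_⟩
    · simpa [I] using hX (i.injective h)
    · rw [hi, hσ]
      rfl
  obtain ⟨x, hxinj, hx⟩ := hperm 2 (FreeGroup.lift fun _ => Equiv.swap 0 1)
  have hd : x 0 - x 1 ≠ 0 := sub_ne_zero.2 (hxinj.ne (by decide))
  have hγ (γ : FreeGroup ℕ) : γ • (x 0 - x 1) = x 0 - x 1 ∨ γ • (x 0 - x 1) = -(x 0 - x 1) := by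
    rw [smul_sub, hx, hx]
    generalize (FreeGroup.lift (fun _ : ℕ => Equiv.swap (0 : Fin 2) 1)) γ = p
    have : p 0 = 0 ∧ p 1 = 1 ∨ p 0 = 1 ∧ p 1 = 0 := by
      revert p
      decide
    rcases this with ⟨h0, h1⟩ | ⟨h0, h1⟩ <;> simp [h0, h1]
  refine ⟨FixedPoints.subfield (FreeGroup ℕ) Ω, inferInstance,
    not_isHilbertian_fixedPoints v hv hinv two_ne_zero hsmall hd (fun γ => ?_)
      (γ₀ := FreeGroup.of 0) ?_, isOmegaFree_absGal_fixedPoints hperm⟩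
  · rw [smul_pow', sq_eq_sq_iff_eq_or_eq_neg]
    exact hγ γ
  · rw [smul_sub, hx, hx]
    simp
end

section
/- Let K be a countable field. Then K is Hilbertian if and only if K is fully Hilbertian. -/
open Polynomial

/-- `K` is fully Hilbertian (stated via the equivalent characterization by absolutely
irreducible polynomials, Theorem 1(2) of Bary-Soroker–Paran): for every absolutely
irreducible `f(X,Y) ∈ K[X,Y]` that is separable in `Y`, there exist `|K|` many
`a ∈ H(f)` together with roots `b_a` of `f(a,Y)` such that the fields `K(b_a)` are
linearly disjoint over `K` (each one is linearly disjoint from the compositum of the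
others). -/
def IsFullyHilbertian (K : Type) [Field K] : Prop :=
  ∀ f : Polynomial (Polynomial K),
    Irreducible (f.map (Polynomial.mapRingHom (algebraMap K (AlgebraicClosure K)))) →
    f.derivative ≠ 0 →
    ∃ (A : Set K) (b : A → AlgebraicClosure K),
      A ⊆ HilbertSet f ∧ Cardinal.mk A = Cardinal.mk K ∧
      (∀ a : A, Polynomial.aeval (b a) (f.map (Polynomial.evalRingHom (a : K))) = 0) ∧
      (∀ a : A,
        (IntermediateField.adjoin K {b a}).LinearDisjoint
          ↥(⨆ (a' : A) (_ : a' ≠ a), IntermediateField.adjoin K {b a'}))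

section Specialization

open Filter IntermediateField Module

variable {K Λ : Type} [Field K] [Field Λ] [Algebra K[X] Λ]

/-- A ring homomorphism `φ` from the integral closure of `K[X]` in `Λ` to a `K`-algebra `κ` is a
specialization at `a` if it extends the evaluation map `K[X] → K`, `X ↦ a`. -/
def IsSpecialization {κ : Type} [Field κ] [Algebra K κ] (a : K)
    (φ : integralClosure K[X] Λ →+* κ) : Prop :=
  ∀ p : K[X], φ (algebraMap K[X] _ p) = algebraMap K κ (p.eval a)

theorem eventually_eval_ne_zero {r : K[X]} (hr : r ≠ 0) : ∀ᶠ a in cofinite, r.eval a ≠ 0 := by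
  have : {a : K | r.IsRoot a}.Finite := Polynomial.finite_setOfPred_isRoot hr
  simpa [eventually_cofinite, IsRoot] using this

theorem exists_specialization [FaithfulSMul K[X] Λ] {N : Type} [Field N] [Algebra K N]
    [Algebra.IsAlgebraic K N] (ι : N →+* Λ)
    (hι : ∀ c : K, ι (algebraMap K N c) = algebraMap K[X] Λ (C c)) (a : K) :
    ∃ (κ : Type) (_ : Field κ) (_ : Algebra K κ) (_ : Algebra N κ) (_ : IsScalarTower K N κ)
      (φ : integralClosure K[X] Λ →+* κ), IsSpecialization a φ ∧
        ∀ (c : N) (x : integralClosure K[X] Λ), (x : Λ) = ι c → φ x = algebraMap N κ c := by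
  set B := integralClosure K[X] Λ
  have hmax : (RingHom.ker (evalRingHom a)).IsMaximal :=
    RingHom.ker_isMaximal_of_surjective _ fun c => ⟨C c, by simp⟩
  have hinj : Function.Injective (algebraMap K[X] B) := by
    have := FaithfulSMul.algebraMap_injective K[X] Λ
    rw [IsScalarTower.algebraMap_eq K[X] B Λ] at this
    exact Function.Injective.of_comp (f := algebraMap B Λ) (by simpa using this)
  obtain ⟨Q, hQ, hQc⟩ := Ideal.exists_ideal_over_maximal_of_isIntegral (S := B)
    (RingHom.ker (evalRingHom a)) (by rw [(RingHom.injective_iff_ker_eq_bot _).mp hinj]; exact bot_le)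
  let _ : Field (B ⧸ Q) := Ideal.Quotient.field Q
  have hint : ∀ c : N, IsIntegral K[X] (ι c) := fun c => by
    obtain ⟨p, hp, hpc⟩ := Algebra.IsIntegral.isIntegral (R := K) c
    refine ⟨p.map C, hp.map C, ?_⟩
    rw [eval₂_map]
    have : (algebraMap K[X] Λ).comp C = ι.comp (algebraMap K N) := by ext c; simp [hι]
    rw [this, ← hom_eval₂, hpc, map_zero]
  let j : N →+* B := ι.codRestrict B.toSubring hint
  let ψ : N →+* B ⧸ Q := (Ideal.Quotient.mk Q).comp j
  let _ : Algebra N (B ⧸ Q) := ψ.toAlgebra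
  let _ : Algebra K (B ⧸ Q) := (ψ.comp (algebraMap K N)).toAlgebra
  have hj : ∀ c : K, j (algebraMap K N c) = algebraMap K[X] B (C c) := fun c => by
    apply Subtype.ext
    exact hι c
  refine ⟨B ⧸ Q, inferInstance, inferInstance, inferInstance,
    IsScalarTower.of_algebraMap_eq fun _ => rfl, Ideal.Quotient.mk Q, fun p => ?_, fun c x hx => ?_⟩
  · have h1 : p - C (p.eval a) ∈ RingHom.ker (evalRingHom a) := by simp [RingHom.mem_ker]
    rw [← hQc, Ideal.mem_comap, map_sub, ← hj] at h1
    exact (Ideal.Quotient.eq).mpr h1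
  · exact congrArg _ (Subtype.ext hx)

namespace IsSpecialization

variable {κ : Type} [Field κ] [Algebra K κ] {a : K} {φ : integralClosure K[X] Λ →+* κ}

theorem aeval_eq_zero (hφ : IsSpecialization a φ) {x : integralClosure K[X] Λ}
    {f : K[X][X]} (hx : aeval (x : Λ) f = 0) :
    aeval (φ x) (f.map (evalRingHom a)) = 0 := by
  have h : aeval x f = 0 :=
    Subtype.ext ((aeval_algebraMap_apply Λ x f).symm.trans hx)
  have hc : (algebraMap K κ).comp (evalRingHom a) = φ.comp (algebraMap K[X] _) :=
    RingHom.ext fun p => (hφ p).symm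
  rw [aeval_def, eval₂_map, hc, ← hom_eval₂, ← aeval_def, h, map_zero]

theorem isIntegral (hφ : IsSpecialization a φ) (x : integralClosure K[X] Λ) :
    IsIntegral K (φ x) := by
  obtain ⟨p, hp, hpx⟩ := x.2
  exact ⟨p.map (evalRingHom a), hp.map _, hφ.aeval_eq_zero hpx⟩

theorem mem_adjoin_of_mem_adjoin (hφ : IsSpecialization a φ)
    {T : Set (integralClosure K[X] Λ)} {x : integralClosure K[X] Λ}
    (hx : x ∈ Algebra.adjoin K[X] T) : φ x ∈ IntermediateField.adjoin K (φ '' T) := by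
  induction hx using Algebra.adjoin_induction with
  | mem x hx => exact subset_adjoin _ _ ⟨x, hx, rfl⟩
  | algebraMap p => rw [hφ]; exact IntermediateField.algebraMap_mem _ _
  | add x y _ _ hx hy => rw [map_add]; exact add_mem hx hy
  | mul x y _ _ hx hy => rw [map_mul]; exact mul_mem hx hy

end IsSpecialization

variable (F : Type) [Field F] [Algebra K[X] F] [IsFractionRing K[X] F] [Algebra F Λ]
  [IsScalarTower K[X] F Λ]

theorem exists_smul_mem_adjoin {T : Set (integralClosure K[X] Λ)} {x : integralClosure K[X] Λ}
    (hx : (x : Λ) ∈ IntermediateField.adjoin F ((↑) '' T)) :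
    ∃ r : K[X], r ≠ 0 ∧ r • x ∈ Algebra.adjoin K[X] T := by
  have halg : ∀ y ∈ ((↑) '' T : Set Λ), IsAlgebraic F y := by
    rintro _ ⟨y, -, rfl⟩
    exact (IsIntegral.tower_top y.2).isAlgebraic
  rw [← mem_toSubalgebra, adjoin_toSubalgebra_of_isAlgebraic halg] at hx
  suffices H : ∀ z : Λ, z ∈ Algebra.adjoin F ((↑) '' T) →
      ∃ r : K[X], r ≠ 0 ∧ ∃ t ∈ Algebra.adjoin K[X] T, (t : Λ) = r • z by
    obtain ⟨r, hr, t, ht, htx⟩ := H x hx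
    refine ⟨r, hr, ?_⟩
    convert ht
    exact Subtype.ext htx.symm
  intro z hz
  induction hz using Algebra.adjoin_induction with
  | mem z hz =>
    obtain ⟨y, hy, rfl⟩ := hz
    exact ⟨1, one_ne_zero, y, Algebra.subset_adjoin hy, (one_smul _ _).symm⟩
  | algebraMap c =>
    obtain ⟨p, q, hq, rfl⟩ := IsFractionRing.div_surjective (A := K[X]) c
    have hq0 := nonZeroDivisors.ne_zero hq
    refine ⟨q, hq0, algebraMap _ _ p, Subalgebra.algebraMap_mem _ _, ?_⟩
    rw [← IsScalarTower.algebraMap_smul F q, Algebra.smul_def, ← map_mul, mul_div_cancel₀]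
    · exact IsScalarTower.algebraMap_apply K[X] F Λ p
    · simpa using hq0
  | add y z _ _ hy hz =>
    obtain ⟨r, hr, t, ht, h⟩ := hy
    obtain ⟨r', hr', t', ht', h'⟩ := hz
    refine ⟨r * r', mul_ne_zero hr hr', r' • t + r • t',
      add_mem (Subalgebra.smul_mem _ ht _) (Subalgebra.smul_mem _ ht' _), ?_⟩
    simp only [Subalgebra.coe_add, Subalgebra.coe_smul, h, h', smul_add, smul_smul, mul_comm]
  | mul y z _ _ hy hz =>
    obtain ⟨r, hr, t, ht, h⟩ := hy
    obtain ⟨r', hr', t', ht', h'⟩ := hz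
    refine ⟨r * r', mul_ne_zero hr hr', t * t', mul_mem ht ht', ?_⟩
    simp only [Subalgebra.coe_mul, h, h', smul_mul_smul_comm]

theorem eventually_mem_adjoin {T : Set (integralClosure K[X] Λ)} {x : integralClosure K[X] Λ}
    (hx : (x : Λ) ∈ IntermediateField.adjoin F ((↑) '' T)) :
    ∀ᶠ a in cofinite, ∀ (κ : Type) [Field κ] [Algebra K κ] (φ : integralClosure K[X] Λ →+* κ),
      IsSpecialization a φ → φ x ∈ IntermediateField.adjoin K (φ '' T) := by
  obtain ⟨r, hr, hrx⟩ := exists_smul_mem_adjoin F hx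
  filter_upwards [eventually_eval_ne_zero hr] with a ha κ _ _ φ hφ
  have h := hφ.mem_adjoin_of_mem_adjoin hrx
  rw [Algebra.smul_def, map_mul, hφ, ← Algebra.smul_def] at h
  simpa [smul_smul, inv_mul_cancel₀ ha] using IntermediateField.smul_mem _ h (x := (r.eval a)⁻¹)

theorem natDegree_minpoly_le_finrank_mul {K L κ : Type*} [Field K] [Field L] [Field κ]
    [Algebra K L] [Algebra K κ] [Algebra L κ] [IsScalarTower K L κ] [FiniteDimensional K L]
    {x : κ} (hx : IsIntegral L x) :
    (minpoly K x).natDegree ≤ finrank K L * (minpoly L x).natDegree := by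
  have : FiniteDimensional L L⟮x⟯ := adjoin.finiteDimensional hx
  have : FiniteDimensional K L⟮x⟯ := FiniteDimensional.trans K L _
  have : Module.Free L L⟮x⟯ := Module.Free.of_divisionRing _ _
  have : IsScalarTower K L⟮x⟯ κ :=
    IsScalarTower.of_algebraMap_eq fun c => by
      rw [IsScalarTower.algebraMap_apply K L κ, IsScalarTower.algebraMap_apply K L L⟮x⟯]
      rfl
  rw [← adjoin.finrank hx, Module.finrank_mul_finrank,
    ← AdjoinSimple.algebraMap_gen L x, minpoly.algebraMap_eq (algebraMap L⟮x⟯ κ).injective]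
  exact minpoly.natDegree_le _

theorem natDegree_minpoly_eq_finrank_mul {y w : Λ} (hw : IsIntegral F w) (hy : y ∈ F⟮w⟯) :
    (minpoly F w).natDegree = (minpoly F y).natDegree * (minpoly F⟮y⟯ w).natDegree := by
  have hyi : IsIntegral F y := by
    have := adjoin.finiteDimensional hw
    exact (isIntegral_algHom_iff F⟮w⟯.val F⟮w⟯.val.injective).mpr
      (IsIntegral.of_finite F (⟨y, hy⟩ : F⟮w⟯))
  have h1 : IntermediateField.restrictScalars F (F⟮y⟯⟮w⟯) = F⟮w⟯ := by
    apply le_antisymm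
    · rw [adjoin_simple_adjoin_simple, adjoin_le_iff]
      rintro _ (rfl | rfl)
      exacts [hy, mem_adjoin_simple_self _ _]
    · rw [adjoin_simple_adjoin_simple]
      exact adjoin.mono _ _ _ (by simp)
  rw [← adjoin.finrank hw, ← adjoin.finrank hyi, ← adjoin.finrank hw.tower_top,
    Module.finrank_mul_finrank, ← h1]
  rfl

theorem eventually_natDegree_mul_le {y w : integralClosure K[X] Λ} (hy : (y : Λ) ∈ F⟮(w : Λ)⟯) :
    ∀ᶠ a in cofinite, ∀ (κ : Type) [Field κ] [Algebra K κ] (φ : integralClosure K[X] Λ →+* κ),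
      IsSpecialization a φ →
        (minpoly K (φ w)).natDegree * (minpoly F (y : Λ)).natDegree ≤
          (minpoly F (w : Λ)).natDegree * (minpoly K (φ y)).natDegree := by
  classical
  have hwi : IsIntegral F (w : Λ) := IsIntegral.tower_top w.2
  have hyi : IsIntegral F (y : Λ) := IsIntegral.tower_top y.2
  rw [natDegree_minpoly_eq_finrank_mul F hwi hy]
  have hwy : IsIntegral F⟮(y : Λ)⟯ (w : Λ) := hwi.tower_top
  set P := minpoly F⟮(y : Λ)⟯ (w : Λ) with hP
  set e := P.natDegree with he
  have hPm : P.Monic := minpoly.monic hwy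
  -- a common denominator making all coefficients of `P` integral
  have : FiniteDimensional F F⟮(y : Λ)⟯ := adjoin.finiteDimensional hyi
  have : IsScalarTower K[X] F F⟮(y : Λ)⟯ := inferInstance
  obtain ⟨r, hr, hri⟩ := exists_integral_multiples K[X] F
    ((Finset.range (e + 1)).image fun i => P.coeff i)
  have hri' : ∀ i, IsIntegral K[X] (r • ((P.coeff i : F⟮(y : Λ)⟯) : Λ)) := fun i => by
    by_cases hi : i < e + 1
    · exact (hri _ (Finset.mem_image_of_mem _ (Finset.mem_range.mpr hi))).map
        (F⟮(y : Λ)⟯.val.restrictScalars K[X])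
    · rw [coeff_eq_zero_of_natDegree_lt (by omega)]
      simpa using isIntegral_zero
  let c : ℕ → integralClosure K[X] Λ := fun i => ⟨_, hri' i⟩
  have hc : ∀ i, (c i : Λ) ∈ IntermediateField.adjoin F ((↑) '' {y}) := fun i => by
    rw [Set.image_singleton]
    change r • ((P.coeff i : F⟮(y : Λ)⟯) : Λ) ∈ _
    rw [← IsScalarTower.algebraMap_smul F r]
    exact IntermediateField.smul_mem _ (P.coeff i).2
  have hrel : ∑ i ∈ Finset.range (e + 1), c i * w ^ i = 0 := by
    apply Subtype.ext
    have := minpoly.aeval F⟮(y : Λ)⟯ (w : Λ)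
    rw [← hP, aeval_eq_sum_range] at this
    have h2 := congrArg (fun x : Λ => r • x) this
    simp only [Finset.smul_sum, smul_zero] at h2
    simp only [AddSubmonoidClass.coe_finsetSum, Subalgebra.coe_mul, Subalgebra.coe_pow,
      ZeroMemClass.coe_zero]
    rw [← h2]
    refine Finset.sum_congr rfl fun i _ => ?_
    change r • ((P.coeff i : F⟮(y : Λ)⟯) : Λ) * _ = _
    rw [smul_mul_assoc]
    rfl
  have hce : c e = algebraMap K[X] _ r := by
    apply Subtype.ext
    change r • ((P.coeff e : F⟮(y : Λ)⟯) : Λ) = algebraMap K[X] Λ r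
    rw [he, hPm.coeff_natDegree, Algebra.algebraMap_eq_smul_one]
    rfl
  filter_upwards [eventually_eval_ne_zero hr, (eventually_all_finset (Finset.range (e + 1))).mpr
    fun i _ => eventually_mem_adjoin F (hc i)] with a ha hca κ _ _ φ hφ
  simp only [Set.image_singleton] at hca
  set E := K⟮φ y⟯
  have hcE : ∀ i ∈ Finset.range (e + 1), φ (c i) ∈ E := fun i hi => hca i hi κ φ hφ
  -- the specialized relation
  let R : E[X] := ∑ i : Fin (e + 1), C ⟨φ (c i), hcE i (by simp; omega)⟩ * X ^ (i : ℕ)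
  have hRc : R.coeff e ≠ 0 := by
    have h0 : (algebraMap K κ) (eval a r) ≠ 0 := by simpa using ha
    have : R.coeff e = ⟨φ (c e), hcE e (by simp)⟩ := by
      simp only [R, finsetSum_coeff, coeff_C_mul_X_pow]
      rw [Finset.sum_eq_single (Fin.last e)]
      · simp
      · intro i _ hi
        rw [if_neg]
        intro h
        exact hi (Fin.ext (by simpa using h.symm))
      · simp
    rw [this, Ne, ← Subtype.coe_inj]
    simpa [hce, hφ r] using ha
  have hR0 : R ≠ 0 := fun h => hRc (by rw [h, coeff_zero])
  have hRd : R.natDegree ≤ e := natDegree_sum_le_of_forall_le _ _ fun i _ =>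
    (natDegree_C_mul_X_pow_le _ _).trans (by omega)
  have hRw : aeval (φ w) R = 0 := by
    have := congrArg φ hrel
    simp only [map_sum, map_mul, map_pow, map_zero, Finset.sum_range] at this
    simp only [R, map_sum, map_mul, aeval_C, map_pow, aeval_X]
    exact this
  have h1 : (minpoly E (φ w)).natDegree ≤ e :=
    (natDegree_le_of_dvd (minpoly.dvd _ _ hRw) hR0).trans hRd
  have hwK := hφ.isIntegral w
  have hyK := hφ.isIntegral y
  have h2 : (minpoly K (φ w)).natDegree ≤ (minpoly K (φ y)).natDegree *
      (minpoly E (φ w)).natDegree := by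
    have : FiniteDimensional K E := adjoin.finiteDimensional hyK
    rw [← adjoin.finrank hyK]
    exact natDegree_minpoly_le_finrank_mul hwK.tower_top
  calc _ ≤ ((minpoly K (φ y)).natDegree * e) * (minpoly F (y : Λ)).natDegree :=
        Nat.mul_le_mul_right _ (h2.trans (Nat.mul_le_mul_left _ h1))
    _ = _ := by ring

end Specialization

section Normalization

open Filter IntermediateField Module

theorem irreducible_of_natDegree_le_natDegree_minpoly {L κ : Type*} [Field L] [Field κ]
    [Algebra L κ] {p : L[X]} {x : κ} (hx : aeval x p = 0) (h0 : p ≠ 0)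
    (h : p.natDegree ≤ (minpoly L x).natDegree) : Irreducible p := by
  have hxi : IsIntegral L x := isAlgebraic_iff_isIntegral.mp ⟨p, h0, hx⟩
  obtain ⟨q, hq⟩ := minpoly.dvd L x hx
  have hq0 : q ≠ 0 := by rintro rfl; exact h0 (by simpa using hq)
  have hd := congrArg natDegree hq
  rw [natDegree_mul (minpoly.ne_zero hxi) hq0] at hd
  have hu : IsUnit q := isUnit_iff_degree_eq_zero.mpr
    (degree_eq_natDegree hq0 ▸ by exact_mod_cast (by omega : q.natDegree = 0))
  rw [hq]
  exact (associated_mul_unit_right _ _ hu).irreducible (minpoly.irreducible hxi)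

theorem natDegree_minpoly_eq_of_irreducible {L κ : Type*} [Field L] [Field κ]
    [Algebra L κ] {p : L[X]} (hp : Irreducible p) {x : κ} (hx : aeval x p = 0) :
    (minpoly L x).natDegree = p.natDegree := by
  rw [← minpoly.eq_of_irreducible hp hx, natDegree_mul_C]
  simpa using hp.ne_zero

theorem natDegree_minpoly_algebraMap_mul {L κ : Type*} [Field L] [Field κ]
    [Algebra L κ] {x : κ} {c : L} (hx : IsIntegral L x) (hc : c ≠ 0) :
    (minpoly L (algebraMap L κ c * x)).natDegree = (minpoly L x).natDegree := by
  have h : L⟮algebraMap L κ c * x⟯ = L⟮x⟯ := by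
    apply le_antisymm <;> rw [adjoin_simple_le_iff]
    · exact mul_mem (IntermediateField.algebraMap_mem _ _) (mem_adjoin_simple_self _ _)
    · have h1 := mul_mem (IntermediateField.algebraMap_mem L⟮algebraMap L κ c * x⟯ c⁻¹)
        (mem_adjoin_simple_self L (algebraMap L κ c * x))
      rwa [← mul_assoc, ← map_mul, inv_mul_cancel₀ hc, map_one, one_mul] at h1
  rw [← adjoin.finrank hx, ← adjoin.finrank (isIntegral_algebraMap.mul hx), h]

theorem irreducible_integralNormalization_iff {L : Type*} [Field L] {p : L[X]}
    (hp : 1 ≤ p.natDegree) : Irreducible p.integralNormalization ↔ Irreducible p := by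
  have h0 : p ≠ 0 := by rintro rfl; simp at hp
  have hl : p.leadingCoeff ≠ 0 := by simpa using h0
  obtain ⟨x, hx⟩ := IsAlgClosed.exists_aeval_eq_zero (AlgebraicClosure L) p
    (natDegree_pos_iff_degree_pos.mp hp).ne'
  have hx' := integralNormalization_aeval_eq_zero hx
    (fun c hc => by simpa using hc)
  have hS := natDegree_minpoly_algebraMap_mul (Algebra.IsIntegral.isIntegral (R := L) x) hl
  constructor
  · intro h
    refine irreducible_of_natDegree_le_natDegree_minpoly hx h0 ?_
    rw [← hS, natDegree_minpoly_eq_of_irreducible h hx', natDegree_integralNormalization]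
  · intro h
    refine irreducible_of_natDegree_le_natDegree_minpoly hx'
      (monic_integralNormalization h0).ne_zero ?_
    rw [hS, natDegree_minpoly_eq_of_irreducible h hx, natDegree_integralNormalization]

theorem one_le_natDegree_of_derivative_ne_zero {R : Type*} [Semiring R] {f : R[X]}
    (hf : derivative f ≠ 0) : 1 ≤ f.natDegree := by
  by_contra h
  exact hf (derivative_of_natDegree_zero (by omega))

variable {K : Type} [Field K]

theorem irreducible_integralNormalization {f : K[X][X]} (hf : Irreducible f)
    (hd : 1 ≤ f.natDegree) : Irreducible f.integralNormalization := by
  rw [(monic_integralNormalization hf.ne_zero).irreducible_iff_irreducible_map_fraction_map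
    (K := FractionRing K[X]),
    ← integralNormalization_map _ _ (by simpa using hf.ne_zero),
    irreducible_integralNormalization_iff,
    ← (hf.isPrimitive (by omega)).irreducible_iff_irreducible_map_fraction_map]
  · exact hf
  · rwa [natDegree_map_eq_of_injective (IsFractionRing.injective _ _)]

theorem derivative_integralNormalization_ne_zero {R : Type*} [CommRing R] [IsDomain R] {f : R[X]}
    (hf : derivative f ≠ 0) : derivative f.integralNormalization ≠ 0 := by
  intro h
  apply hf
  ext i
  have hi := congrArg (coeff · i) h
  simp only [coeff_derivative, coeff_zero, mul_eq_zero] at hi ⊢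
  refine hi.imp_left fun hi => ?_
  by_contra hc
  have : i + 1 ∈ f.integralNormalization.support := by simpa using hc
  exact mem_support_iff.mp this hi

theorem eventually_natDegree_map_evalRingHom {f : K[X][X]} (hf : f ≠ 0) :
    ∀ᶠ a in cofinite, (f.map (evalRingHom a)).natDegree = f.natDegree := by
  filter_upwards [eventually_eval_ne_zero (leadingCoeff_ne_zero.mpr hf)] with a ha
  exact natDegree_map_of_leadingCoeff_ne_zero _ ha

theorem eventually_derivative_map_evalRingHom_ne_zero {f : K[X][X]} (hf : derivative f ≠ 0) :
    ∀ᶠ a in cofinite, derivative (f.map (evalRingHom a)) ≠ 0 := by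
  filter_upwards [eventually_eval_ne_zero (leadingCoeff_ne_zero.mpr hf)] with a ha h
  rw [derivative_map] at h
  have := congrArg (coeff · (derivative f).natDegree) h
  rw [coeff_map, coeff_zero] at this
  exact ha this

theorem eventually_irreducible_integralNormalization_iff {f : K[X][X]} (hf : f ≠ 0)
    (hd : 1 ≤ f.natDegree) (L : Type) [Field L] [Algebra K L] :
    ∀ᶠ a in cofinite,
      Irreducible ((f.integralNormalization.map (evalRingHom a)).map (algebraMap K L)) ↔
        Irreducible ((f.map (evalRingHom a)).map (algebraMap K L)) := by
  filter_upwards [eventually_eval_ne_zero (leadingCoeff_ne_zero.mpr hf),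
    eventually_natDegree_map_evalRingHom hf] with a ha hda
  have ha' : evalRingHom a f.leadingCoeff ≠ 0 := ha
  rw [← integralNormalization_map _ _ ha', ← integralNormalization_map,
    irreducible_integralNormalization_iff]
  · rwa [natDegree_map, hda]
  · rw [leadingCoeff_map_of_leadingCoeff_ne_zero _ ha']
    simpa using ha

end Normalization

section Core

open Filter IntermediateField Module

variable {K Λ : Type} [Field K] [Field Λ] [Algebra K[X] Λ]
  (F : Type) [Field F] [Algebra K[X] F] [IsFractionRing K[X] F] [Algebra F Λ]
  [IsScalarTower K[X] F Λ]

theorem exists_adjoin_simple_eq_adjoin {T : Set (integralClosure K[X] Λ)} (hT : T.Finite)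
    (hs : ∀ x ∈ T, IsSeparable F (x : Λ)) :
    ∃ w : integralClosure K[X] Λ,
      F⟮(w : Λ)⟯ = IntermediateField.adjoin F ((↑) '' T) ∧ IsSeparable F (w : Λ) := by
  obtain ⟨α, hα, hsep⟩ : ∃ α : Λ, F⟮α⟯ = IntermediateField.adjoin F ((↑) '' T) ∧
      IsSeparable F α := by
    have : Algebra.IsSeparable F (IntermediateField.adjoin F ((↑) '' T : Set Λ)) :=
      (isSeparable_adjoin_iff_isSeparable F Λ).mpr (by rintro _ ⟨x, hx, rfl⟩; exact hs x hx)
    have : Finite ((↑) '' T : Set Λ) := hT.image _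
    have : FiniteDimensional F (IntermediateField.adjoin F ((↑) '' T : Set Λ)) :=
      finiteDimensional_adjoin (by rintro _ ⟨x, hx, rfl⟩; exact (hs x hx).isIntegral)
    obtain ⟨α, hα⟩ := Field.exists_primitive_element F
      (IntermediateField.adjoin F ((↑) '' T : Set Λ))
    refine ⟨α, ?_, isSeparable_of_mem_isSeparable F Λ α.2⟩
    have := congrArg IntermediateField.lift hα
    rwa [lift_adjoin, IntermediateField.lift_top, Set.image_singleton] at this
  rw [← hα]
  have hαi : IsAlgebraic K[X] α :=
    (IsFractionRing.isAlgebraic_iff K[X] F Λ).mpr hsep.isIntegral.isAlgebraic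
  obtain ⟨r, hr, hri⟩ := hαi.exists_integral_multiple
  have hr' : algebraMap K[X] F r ≠ 0 := by simpa using hr
  have hmem : r • α ∈ F⟮α⟯ := by
    rw [← IsScalarTower.algebraMap_smul F r]
    exact IntermediateField.smul_mem _ (mem_adjoin_simple_self _ _)
  refine ⟨⟨_, hri⟩, le_antisymm (adjoin_simple_le_iff.mpr hmem) ?_, ?_⟩
  · have h2 := IntermediateField.smul_mem _ (mem_adjoin_simple_self F (r • α))
      (x := (algebraMap K[X] F r)⁻¹)
    rwa [← IsScalarTower.algebraMap_smul F r α, smul_smul, inv_mul_cancel₀ hr', one_smul,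
      IsScalarTower.algebraMap_smul F r α, ← adjoin_simple_le_iff] at h2
  · have := (isSeparable_adjoin_simple_iff_isSeparable F Λ).mpr hsep
    exact isSeparable_of_mem_isSeparable F Λ hmem

theorem minpoly_irreducible_and_derivative_ne_zero [FaithfulSMul K[X] Λ]
    (w : integralClosure K[X] Λ) (hw : IsSeparable F (w : Λ)) :
    Irreducible (minpoly K[X] (w : Λ)) ∧ derivative (minpoly K[X] (w : Λ)) ≠ 0 ∧
      (minpoly K[X] (w : Λ)).natDegree = (minpoly F (w : Λ)).natDegree := by
  have h := minpoly.isIntegrallyClosed_eq_field_fractions' (R := K[X]) F w.2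
  refine ⟨minpoly.irreducible w.2, fun h0 => ?_, ?_⟩
  · have h1 := (separable_iff_derivative_ne_zero (minpoly.irreducible hw.isIntegral)).mp hw
    rw [h, derivative_map, h0, Polynomial.map_zero] at h1
    exact h1 rfl
  · rw [h, natDegree_map_eq_of_injective (IsFractionRing.injective _ _)]

theorem natDegree_minpoly_le_natDegree_minpoly {K κ : Type} [Field K] [Field κ] [Algebra K κ]
    {x y : κ} (hy : IsIntegral K y) (hx : x ∈ K⟮y⟯) :
    (minpoly K x).natDegree ≤ (minpoly K y).natDegree := by
  rw [natDegree_minpoly_eq_finrank_mul K hy hx]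
  exact Nat.le_mul_of_pos_right _ (minpoly.natDegree_pos hy.tower_top)

theorem finrank_le_natDegree_minpoly [FaithfulSMul K[X] Λ] {L : Type} [Field L] [Algebra K L]
    [FiniteDimensional K L] (ι : L →+* Λ)
    (hι : ∀ c : K, ι (algebraMap K L c) = algebraMap K[X] Λ (C c))
    {θ : L} (hθ : K⟮θ⟯ = ⊤) {x : integralClosure K[X] Λ} (hx : (x : Λ) = ι θ) :
    finrank K L ≤ (minpoly F (x : Λ)).natDegree := by
  obtain ⟨κ, _, _, _, _, φ, hφ, hφι⟩ := exists_specialization ι hι 0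
  have h := hφ.aeval_eq_zero (minpoly.aeval K[X] (x : Λ))
  have hm := minpoly.monic x.2
  rw [minpoly.isIntegrallyClosed_eq_field_fractions' (R := K[X]) F x.2,
    natDegree_map_eq_of_injective (IsFractionRing.injective _ _),
    ← hm.natDegree_map (evalRingHom 0),
    ← (Field.primitive_element_iff_minpoly_natDegree_eq K θ).mp hθ,
    ← minpoly.algebraMap_eq (algebraMap L κ).injective, ← hφι θ x hx]
  exact natDegree_le_natDegree (minpoly.min K _ (hm.map _) h)

theorem natDegree_minpoly_tower_le {F F' Λ : Type*} [Field F] [Field F'] [Field Λ] [Algebra F F']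
    [Algebra F Λ] [Algebra F' Λ] [IsScalarTower F F' Λ] {t : F'} {y : Λ} (hy : IsIntegral F y) :
    (minpoly F' y).natDegree ≤ (minpoly F⟮algebraMap F' Λ t⟯ y).natDegree := by
  set E := F⟮algebraMap F' Λ t⟯
  have hE : E ≤ (IsScalarTower.toAlgHom F F' Λ).fieldRange :=
    adjoin_simple_le_iff.mpr ⟨t, rfl⟩
  have hm := minpoly.monic (A := E) (x := y) hy.tower_top
  obtain ⟨q, hq, hqd, hqm⟩ := lifts_and_natDegree_eq_and_monic (f := algebraMap F' Λ)
    (p := (minpoly E y).map (algebraMap E Λ)) (by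
      rw [lifts_iff_coeff_lifts]
      intro i
      rw [coeff_map]
      exact hE (Subtype.prop _)) (hm.map _)
  rw [natDegree_map] at hqd
  rw [← hqd]
  refine natDegree_le_natDegree (minpoly.min F' y hqm ?_)
  rw [aeval_def, ← eval_map, hq, eval_map, ← aeval_def, minpoly.aeval]

end Core

section HilbertianExtension

open Filter IntermediateField Module

variable {K : Type} [Field K]

theorem frequently_irreducible_map_of_root (hK : IsHilbertian K) {Λ : Type} [Field Λ]
    [Algebra K[X] Λ] (F : Type) [Field F] [Algebra K[X] F] [IsFractionRing K[X] F] [Algebra F Λ]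
    [IsScalarTower K[X] F Λ] {L : Type} [Field L] [Algebra K L] [FiniteDimensional K L]
    [Algebra.IsSeparable K L] {F' : Type} [Field F'] [Algebra F F'] [Algebra F' Λ]
    [IsScalarTower F F' Λ] (ι : L →+* F')
    (hι : ∀ c : K, algebraMap F' Λ (ι (algebraMap K L c)) = algebraMap K[X] Λ (C c))
    {g : K[X][X]} (hg : g.Monic) {y : integralClosure K[X] Λ} (hgy : aeval (y : Λ) g = 0)
    (hy : IsSeparable F (y : Λ)) (hgn : g.natDegree ≤ (minpoly F' (y : Λ)).natDegree) :
    ∃ᶠ a in cofinite, Irreducible ((g.map (evalRingHom a)).map (algebraMap K L)) := by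
  have hinj : FaithfulSMul K[X] Λ := (faithfulSMul_iff_algebraMap_injective _ _).mpr (by
    rw [IsScalarTower.algebraMap_eq K[X] F Λ]
    exact (algebraMap F Λ).injective.comp (IsFractionRing.injective _ _))
  obtain ⟨θ, hθ⟩ := Field.exists_primitive_element K L
  let j : L →+* Λ := (algebraMap F' Λ).comp ι
  have hjalg (p : K[X]) (t : L) : aeval (j t) (p.map C) = j (aeval t p) := by
    have hj : (algebraMap K[X] Λ).comp C = j.comp (algebraMap K L) :=
      RingHom.ext fun c => (hι c).symm
    rw [aeval_def, eval₂_map, hj, ← hom_eval₂, ← aeval_def]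
  have hθs : IsSeparable F (j θ) := by
    have h1 : Separable (((minpoly K θ).map C).map (algebraMap K[X] F)) := by
      rw [Polynomial.map_map]
      exact Separable.map (Algebra.IsSeparable.isSeparable K θ : (minpoly K θ).Separable)
    refine h1.of_dvd (minpoly.dvd F _ ?_)
    rw [aeval_map_algebraMap, hjalg, minpoly.aeval, map_zero]
  have hθi : IsIntegral K[X] (j θ) := by
    refine ⟨(minpoly K θ).map C, (minpoly.monic (Algebra.IsIntegral.isIntegral θ)).map _, ?_⟩
    rw [← aeval_def, hjalg, minpoly.aeval, map_zero]
  let θ' : integralClosure K[X] Λ := ⟨j θ, hθi⟩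
  obtain ⟨w, hw, hws⟩ := exists_adjoin_simple_eq_adjoin F (T := {θ', y}) (by simp) (by
    rintro x (rfl | rfl)
    exacts [hθs, hy])
  obtain ⟨hwirr, hwd, hwdeg⟩ := minpoly_irreducible_and_derivative_ne_zero F w hws
  have hwi := hws.isIntegral
  have hθw : j θ ∈ F⟮(w : Λ)⟯ := hw ▸ subset_adjoin _ _ ⟨θ', by simp, rfl⟩
  have hyw : (y : Λ) ∈ F⟮(w : Λ)⟯ := hw ▸ subset_adjoin _ _ ⟨y, by simp, rfl⟩
  -- the degree of `w` over `F`
  have hdeg : finrank K L * g.natDegree ≤ (minpoly K[X] (w : Λ)).natDegree := by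
    rw [hwdeg, natDegree_minpoly_eq_finrank_mul F hwi hθw]
    refine Nat.mul_le_mul (finrank_le_natDegree_minpoly F j hι hθ (x := θ') rfl) (hgn.trans ?_)
    refine (natDegree_minpoly_tower_le (t := ι θ) hy.isIntegral).trans ?_
    refine natDegree_minpoly_le_natDegree_minpoly hwi.tower_top ?_
    have : F⟮(w : Λ)⟯ ≤ (F⟮j θ⟯⟮(w : Λ)⟯).restrictScalars F :=
      adjoin_simple_le_iff.mpr (mem_adjoin_simple_self F⟮j θ⟯ _)
    exact this hyw
  have hB := eventually_mem_adjoin F (T := {θ', y}) (x := w) (hw ▸ mem_adjoin_simple_self _ _)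
  have hH : ∃ᶠ a in cofinite, a ∈ HilbertSet (minpoly K[X] (w : Λ)) :=
    frequently_cofinite_iff_infinite.mpr (hK _ hwirr hwd)
  refine (hH.and_eventually hB).mono fun a ⟨haH, haB⟩ => ?_
  obtain ⟨κ, _, _, _, _, φ, hφ, hφι⟩ := exists_specialization j hι a
  have hwa := natDegree_minpoly_eq_of_irreducible haH
    (hφ.aeval_eq_zero (minpoly.aeval K[X] (w : Λ)))
  rw [(minpoly.monic w.2).natDegree_map] at hwa
  have hyL : IsIntegral L (φ y) := (hφ.isIntegral y).tower_top
  have hwL : IsIntegral L (φ w) := (hφ.isIntegral w).tower_top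
  have hmem : φ w ∈ L⟮φ y⟯ := by
    have h1 := haB κ φ hφ
    have h2 : IntermediateField.adjoin K (φ '' {θ', y}) ≤ (L⟮φ y⟯).restrictScalars K := by
      rw [adjoin_le_iff]
      rintro _ ⟨x, hx | hx, rfl⟩
      · rw [hφι θ x (congrArg _ hx)]
        exact IntermediateField.algebraMap_mem L⟮φ y⟯ θ
      · rw [Set.mem_singleton_iff.mp hx]
        exact mem_adjoin_simple_self L _
    exact h2 h1
  have h3 := hdeg.trans (hwa.symm.le.trans ((natDegree_minpoly_le_finrank_mul (L := L) hwL).trans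
    (Nat.mul_le_mul_left _ (natDegree_minpoly_le_natDegree_minpoly hyL hmem))))
  have hga := hg.map (evalRingHom a)
  refine irreducible_of_natDegree_le_natDegree_minpoly (x := φ y) ?_ (hga.map _).ne_zero ?_
  · rw [aeval_map_algebraMap]
    exact hφ.aeval_eq_zero hgy
  · rw [hga.natDegree_map, hg.natDegree_map]
    exact Nat.le_of_mul_le_mul_left h3 finrank_pos

theorem frequently_irreducible_map (hK : IsHilbertian K) (L : Type) [Field L] [Algebra K L]
    [FiniteDimensional K L] [Algebra.IsSeparable K L] {g : K[X][X]} (hg : g.Monic)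
    (hgd : derivative g ≠ 0) (hgL : Irreducible (g.map (mapRingHom (algebraMap K L)))) :
    ∃ᶠ a in cofinite, Irreducible ((g.map (evalRingHom a)).map (algebraMap K L)) := by
  let F := FractionRing K[X]
  let F' := FractionRing L[X]
  let Λ := AlgebraicClosure F'
  let _ : Algebra K[X] F' := ((algebraMap L[X] F').comp (mapRingHom (algebraMap K L))).toAlgebra
  have : FaithfulSMul K[X] F' := (faithfulSMul_iff_algebraMap_injective _ _).mpr
    ((IsFractionRing.injective L[X] F').comp (map_injective _ (algebraMap K L).injective))
  let _ : Algebra F F' := FractionRing.liftAlgebra K[X] F'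
  have : IsScalarTower K[X] F F' := FractionRing.isScalarTower_liftAlgebra K[X] F'
  have : IsScalarTower K[X] F Λ := inferInstance
  have : IsScalarTower F F' Λ := inferInstance
  have hgL' := hgL
  rw [(hg.map _).irreducible_iff_irreducible_map_fraction_map (K := F'), Polynomial.map_map]
    at hgL'
  have hgF : Irreducible (g.map (algebraMap K[X] F)) := by
    rw [← (hg).irreducible_iff_irreducible_map_fraction_map]
    exact hg.irreducible_of_irreducible_map _ _ hgL
  obtain ⟨y, hy⟩ := IsAlgClosed.exists_aeval_eq_zero Λ (g.map (algebraMap K[X] F'))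
    (degree_pos_of_irreducible hgL').ne'
  have hn := natDegree_minpoly_eq_of_irreducible hgL' hy
  rw [aeval_map_algebraMap] at hy
  have hyi : IsIntegral K[X] y := ⟨g, hg, hy⟩
  have hgF0 : aeval y (g.map (algebraMap K[X] F)) = 0 := by rw [aeval_map_algebraMap, hy]
  refine frequently_irreducible_map_of_root hK F (L := L) (F' := F') (Λ := Λ)
    ((algebraMap L[X] F').comp C) (fun c => ?_) hg (y := ⟨y, hyi⟩) hy ?_ ?_
  · rw [IsScalarTower.algebraMap_apply K[X] F' Λ]
    congr 1
    change _ = algebraMap L[X] F' (mapRingHom _ (C c))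
    simp
  · refine Separable.of_dvd ?_ (minpoly.dvd F _ hgF0)
    rw [separable_iff_derivative_ne_zero hgF, derivative_map]
    exact (Polynomial.map_ne_zero_iff (IsFractionRing.injective K[X] F)).mpr hgd
  · change _ ≤ (minpoly F' y).natDegree
    rw [hn, hg.natDegree_map]

end HilbertianExtension

section HilbertianToFully

open Filter IntermediateField Module

theorem linearDisjoint_adjoin_image_compl {K Ω : Type*} [Field K] [Field Ω] [Algebra K Ω]
    [Algebra.IsAlgebraic K Ω] {B : ℕ → Ω} {n : ℕ}
    (h1 : ∀ i, finrank K K⟮B i⟯ = n)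
    (h2 : ∀ r : ℕ, finrank K (IntermediateField.adjoin K (B '' Finset.range r)) = n ^ r) (k : ℕ) :
    K⟮B k⟯.LinearDisjoint (IntermediateField.adjoin K (B '' {k}ᶜ)) := by
  have hfin : ∀ s : Finset ℕ, FiniteDimensional K (IntermediateField.adjoin K (B '' s)) := fun s =>
    have : Finite (B '' s) := (s.finite_toSet.image B).to_subtype
    finiteDimensional_adjoin fun x _ => Algebra.IsIntegral.isIntegral x
  have hfin' : FiniteDimensional K K⟮B k⟯ :=
    adjoin.finiteDimensional (Algebra.IsIntegral.isIntegral _)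
  have hle : ∀ s : Finset ℕ, finrank K (IntermediateField.adjoin K (B '' s)) ≤ n ^ s.card := by
    intro s
    induction s using Finset.induction_on with
    | empty =>
      rw [Finset.coe_empty, Set.image_empty, adjoin_empty, IntermediateField.finrank_bot]
      simp
    | insert i s hi ih =>
      rw [Finset.coe_insert, Set.image_insert_eq, Set.insert_eq, adjoin_union,
        Finset.card_insert_of_notMem hi, pow_succ']
      exact (finrank_sup_le _ _).trans (Nat.mul_le_mul (h1 i).le ih)
  have hmem : ∀ x ∈ IntermediateField.adjoin K (B '' {k}ᶜ),
      ∀ᶠ r in atTop, x ∈ IntermediateField.adjoin K (B '' (Finset.range r).erase k) := by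
    intro x hx
    induction hx using adjoin_induction with
    | mem x hx =>
      obtain ⟨i, hi, rfl⟩ := hx
      filter_upwards [eventually_gt_atTop i] with r hr
      exact subset_adjoin _ _ ⟨i, by simpa using ⟨hr, hi⟩, rfl⟩
    | algebraMap c => exact Eventually.of_forall fun r => IntermediateField.algebraMap_mem _ c
    | add x y _ _ hx hy => filter_upwards [hx, hy] with r hx hy using add_mem hx hy
    | inv x _ hx => filter_upwards [hx] with r hx using inv_mem hx
    | mul x y _ _ hx hy => filter_upwards [hx, hy] with r hx hy using mul_mem hx hy
  rw [linearDisjoint_iff']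
  have : Algebra.IsIntegral K (IntermediateField.adjoin K (B '' {k}ᶜ)).toSubalgebra :=
    inferInstanceAs (Algebra.IsIntegral K (IntermediateField.adjoin K (B '' {k}ᶜ)))
  refine Subalgebra.LinearDisjoint.of_linearDisjoint_finite_right _ _ fun B' hB' hB'f => ?_
  obtain ⟨s, hs⟩ := (Subalgebra.fg_of_fg_toSubmodule (Module.Finite.iff_fg.mp hB'f) : B'.FG)
  obtain ⟨r, hr, hkr⟩ := (((eventually_all_finset s).mpr fun x hx =>
    hmem x (hB' (hs ▸ Algebra.subset_adjoin hx))).and (eventually_gt_atTop k)).exists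
  have hB'le : B' ≤ (IntermediateField.adjoin K (B '' (Finset.range r).erase k)).toSubalgebra := by
    rw [← hs, Algebra.adjoin_le_iff]
    exact hr
  have hk : k ∈ Finset.range r := Finset.mem_range.mpr hkr
  have hd : K⟮B k⟯.LinearDisjoint
      (IntermediateField.adjoin K (B '' (Finset.range r).erase k)) := by
    have := hfin ((Finset.range r).erase k)
    apply LinearDisjoint.of_finrank_sup
    have h3 : K⟮B k⟯ ⊔ IntermediateField.adjoin K (B '' (Finset.range r).erase k) =
        IntermediateField.adjoin K (B '' Finset.range r) := by
      rw [← adjoin_union, ← Set.insert_eq, ← Set.image_insert_eq, ← Finset.coe_insert,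
        Finset.insert_erase hk]
    refine le_antisymm (finrank_sup_le _ _) ?_
    rw [h3, h2, h1]
    refine (Nat.mul_le_mul_left _ (hle _)).trans ?_
    rw [Finset.card_erase_of_mem hk, Finset.card_range, ← pow_succ']
    exact (congrArg _ (by omega)).le
  exact (linearDisjoint_iff'.mp hd).of_le_right_of_flat hB'le

theorem irreducible_of_irreducible_map_mapRingHom {K L : Type*} [Field K] [Field L] (i : K →+* L)
    {f : K[X][X]} (hf : Irreducible (f.map (mapRingHom i))) : Irreducible f := by
  have hu : ∀ g : K[X][X], IsUnit (g.map (mapRingHom i)) → IsUnit g := by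
    intro g hg
    have hd := natDegree_eq_zero_of_isUnit hg
    rw [natDegree_map_eq_of_injective (map_injective i i.injective)] at hd
    rw [eq_C_of_natDegree_eq_zero hd] at hg ⊢
    rw [map_C, isUnit_C, coe_mapRingHom, isUnit_map] at hg
    rwa [isUnit_C]
  refine ⟨fun h => hf.not_isUnit (h.map (mapRingHom (mapRingHom i))), fun g h hgh => ?_⟩
  have := hf.isUnit_or_isUnit (a := g.map (mapRingHom i)) (b := h.map (mapRingHom i))
    (by rw [hgh, Polynomial.map_mul])
  exact this.imp (hu g) (hu h)

theorem IsHilbertian.isFullyHilbertian {K : Type} [Field K] [Countable K] (hK : IsHilbertian K) :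
    IsFullyHilbertian K := by
  classical
  intro f hf hd
  have hn := one_le_natDegree_of_derivative_ne_zero hd
  set n := f.natDegree with hndef
  have hf0 := irreducible_of_irreducible_map_mapRingHom _ hf
  have hfreq : ∀ (L : IntermediateField K (AlgebraicClosure K)) [FiniteDimensional K L]
      [Algebra.IsSeparable K L], ∃ᶠ a in cofinite,
        Irreducible ((f.map (evalRingHom a)).map (algebraMap K L)) ∧
        (f.map (evalRingHom a)).natDegree = n ∧ derivative (f.map (evalRingHom a)) ≠ 0 := by
    intro L _ _
    have hfL : Irreducible (f.map (mapRingHom (algebraMap K L))) := by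
      refine irreducible_of_irreducible_map_mapRingHom (algebraMap L (AlgebraicClosure K)) ?_
      rwa [Polynomial.map_map, mapRingHom_comp, ← IsScalarTower.algebraMap_eq]
    have hinj : Function.Injective (mapRingHom (algebraMap K L)) :=
      map_injective _ (algebraMap K L).injective
    have h := frequently_irreducible_map hK L (monic_integralNormalization hf0.ne_zero)
      (derivative_integralNormalization_ne_zero hd) (by
        rw [← integralNormalization_map]
        · refine irreducible_integralNormalization hfL ?_
          rwa [natDegree_map_eq_of_injective hinj]
        · rw [Ne, map_eq_zero_iff _ hinj]
          exact leadingCoeff_ne_zero.mpr hf0.ne_zero)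
    refine (h.and_eventually
      ((eventually_irreducible_integralNormalization_iff hf0.ne_zero hn L).and
        ((eventually_natDegree_map_evalRingHom hf0.ne_zero).and
          (eventually_derivative_map_evalRingHom_ne_zero hd)))).mono ?_
    rintro a ⟨h1, h2, h3, h4⟩
    exact ⟨h2.mp h1, h3, h4⟩
  have hb : ∀ a : K, ∃ b : AlgebraicClosure K, IsSeparable K b ∧
      ((f.map (evalRingHom a)).Separable → (f.map (evalRingHom a)).natDegree = n →
        aeval b (f.map (evalRingHom a)) = 0) := by
    intro a
    by_cases h : (f.map (evalRingHom a)).Separable ∧ (f.map (evalRingHom a)).natDegree = n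
    · obtain ⟨b, hb⟩ := IsAlgClosed.exists_aeval_eq_zero (AlgebraicClosure K)
        (f.map (evalRingHom a)) (natDegree_pos_iff_degree_pos.mp (by omega)).ne'
      exact ⟨b, h.1.of_dvd (minpoly.dvd _ _ hb), fun _ _ => hb⟩
    · exact ⟨algebraMap K _ 0, isSeparable_algebraMap _, fun h1 h2 => (h ⟨h1, h2⟩).elim⟩
  choose b hbs hbr using hb
  have hstep : ∀ S : Finset K, ∃ a ∉ S,
      Irreducible ((f.map (evalRingHom a)).map
        (algebraMap K (IntermediateField.adjoin K (b '' S)))) ∧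
      Irreducible (f.map (evalRingHom a)) ∧ (f.map (evalRingHom a)).natDegree = n ∧
      aeval (b a) (f.map (evalRingHom a)) = 0 := by
    intro S
    have : Finite (b '' S) := (S.finite_toSet.image b).to_subtype
    have : FiniteDimensional K (IntermediateField.adjoin K (b '' S)) :=
      finiteDimensional_adjoin fun x _ => Algebra.IsIntegral.isIntegral x
    have : Algebra.IsSeparable K (IntermediateField.adjoin K (b '' S)) :=
      (isSeparable_adjoin_iff_isSeparable K _).mpr (by rintro _ ⟨a, -, rfl⟩; exact hbs a)
    obtain ⟨a, ⟨h1, h2, h3⟩, h4⟩ := ((hfreq (IntermediateField.adjoin K (b '' S))).and_eventually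
      S.finite_toSet.eventually_cofinite_notMem).exists
    have h5 : Irreducible (f.map (evalRingHom a)) := by
      refine @Irreducible.of_map _ _ _ _ _ (mapRingHom (algebraMap K _)) _ _ _ ⟨fun g hg => ?_⟩ h1
      rwa [coe_mapRingHom, isUnit_map] at hg
    exact ⟨a, h4, h1, h5, h2, hbr a ((separable_iff_derivative_ne_zero h5).mpr h3) h2⟩
  choose next hnext hirrL hirr hdeg hroot using hstep
  obtain ⟨S, hS0, hSs⟩ : ∃ S : ℕ → Finset K, S 0 = ∅ ∧
      ∀ k, S (k + 1) = insert (next (S k)) (S k) :=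
    ⟨fun k => Nat.rec ∅ (fun _ s => insert (next s) s) k, rfl, fun _ => rfl⟩
  let a : ℕ → K := fun k => next (S k)
  have hS : ∀ k, S k = (Finset.range k).image a := by
    intro k
    induction k with
    | zero => rw [hS0, Finset.range_zero, Finset.image_empty]
    | succ k ih =>
      rw [hSs, Finset.range_add_one, Finset.image_insert, ← ih]
  have hlt : ∀ i k, i < k → a i ≠ a k := fun i k hik h => hnext (S k) (by
    change a k ∈ S k
    rw [hS, ← h]
    exact Finset.mem_image_of_mem a (Finset.mem_range.mpr hik))
  have hinj : Function.Injective a := fun i k h => by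
    rcases lt_trichotomy i k with hik | hik | hik
    exacts [(hlt i k hik h).elim, hik, (hlt k i hik h.symm).elim]
  have h1 : ∀ i, finrank K K⟮b (a i)⟯ = n := fun i => by
    rw [adjoin.finrank (Algebra.IsIntegral.isIntegral _),
      natDegree_minpoly_eq_of_irreducible (hirr (S i)) (hroot (S i)), hdeg]
  have h2 : ∀ r : ℕ,
      finrank K (IntermediateField.adjoin K ((fun i => b (a i)) '' Finset.range r)) = n ^ r := by
    intro r
    induction r with
    | zero =>
      rw [Finset.range_zero, Finset.coe_empty, Set.image_empty, adjoin_empty, IntermediateField.finrank_bot, pow_zero]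
    | succ r ih =>
      have himg : (fun i => b (a i)) '' Finset.range r = b '' (S r : Set K) := by
        rw [hS, Finset.coe_image, Set.image_image]
      rw [himg] at ih
      rw [Finset.range_add_one, Finset.coe_insert, Set.image_insert_eq, himg, Set.insert_eq,
        Set.union_comm, ← adjoin_adjoin_left, pow_succ, ← ih]
      have := adjoin.finrank (K := IntermediateField.adjoin K (b '' (S r : Set K))) (x := b (a r))
        (Algebra.IsIntegral.isIntegral _)
      rw [natDegree_minpoly_eq_of_irreducible (hirrL (S r))
        (by rw [aeval_map_algebraMap]; exact hroot (S r)), natDegree_map, hdeg] at this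
      rw [← this, Module.finrank_mul_finrank]
      rfl
  refine ⟨Set.range a, fun x => b x, ?_, ?_, ?_, ?_⟩
  · rintro _ ⟨k, rfl⟩
    exact hirr (S k)
  · have := Infinite.of_injective a hinj
    rw [Cardinal.mk_range_eq a hinj, Cardinal.mk_eq_aleph0, Cardinal.mk_eq_aleph0]
  · rintro ⟨_, k, rfl⟩
    exact hroot (S k)
  · rintro ⟨_, k, rfl⟩
    refine (linearDisjoint_adjoin_image_compl (B := fun i => b (a i)) h1 h2 k).of_le_right ?_
    refine iSup₂_le fun x hx => ?_
    obtain ⟨_, i, rfl⟩ := x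
    rw [adjoin_simple_le_iff]
    refine subset_adjoin _ _ ⟨i, ?_, rfl⟩
    rintro rfl
    exact hx rfl

end HilbertianToFully

section ConstantExtension

open Filter IntermediateField Module

theorem eventually_irreducible_of_irreducible_map {K Λ : Type} [Field K] [Field Λ] [Algebra K[X] Λ]
    [FaithfulSMul K[X] Λ] (F : Type) [Field F] [Algebra K[X] F] [IsFractionRing K[X] F]
    [Algebra F Λ] [IsScalarTower K[X] F Λ] {N : Type} [Field N] [Algebra K N]
    [FiniteDimensional K N] [Algebra.IsSeparable K N] (j : N →+* Λ)
    (hj : ∀ c : K, j (algebraMap K N c) = algebraMap K[X] Λ (C c))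
    {θ : N} (hθ : K⟮θ⟯ = ⊤) {f : K[X][X]} (hf : Irreducible f) (hfm : f.Monic)
    {y z : integralClosure K[X] Λ} (hfy : aeval (y : Λ) f = 0) (hz : IsSeparable F (z : Λ))
    (hy : (y : Λ) ∈ IntermediateField.adjoin F {j θ, (z : Λ)}) :
    ∀ᶠ a in cofinite,
      Irreducible (((minpoly K[X] (z : Λ)).map (evalRingHom a)).map (algebraMap K N)) →
        Irreducible (f.map (evalRingHom a)) := by
  classical
  have hjalg : ∀ p : K[X], aeval (j θ) (p.map C) = j (aeval θ p) := fun p => by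
    have hj : (algebraMap K[X] Λ).comp C = j.comp (algebraMap K N) :=
      RingHom.ext fun c => (hj c).symm
    rw [aeval_def, eval₂_map, hj, ← hom_eval₂, ← aeval_def]
  have hθF : aeval (j θ) (((minpoly K θ).map C).map (algebraMap K[X] F)) = 0 := by
    rw [aeval_map_algebraMap, hjalg, minpoly.aeval, map_zero]
  have hθm := minpoly.monic (Algebra.IsIntegral.isIntegral (R := K) θ)
  have hθK : (minpoly K θ).natDegree = finrank K N :=
    (Field.primitive_element_iff_minpoly_natDegree_eq K θ).mp hθ
  have hθs : IsSeparable F (j θ) := by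
    refine Separable.of_dvd ?_ (minpoly.dvd F _ hθF)
    rw [Polynomial.map_map]
    exact Separable.map (Algebra.IsSeparable.isSeparable K θ : (minpoly K θ).Separable)
  have hθi : IsIntegral K[X] (j θ) := by
    refine ⟨(minpoly K θ).map C, hθm.map _, ?_⟩
    rw [← aeval_def, hjalg, minpoly.aeval, map_zero]
  have hθd : (minpoly F (j θ)).natDegree ≤ finrank K N := by
    refine (natDegree_le_of_dvd (minpoly.dvd F _ hθF) ((hθm.map _).map _).ne_zero).trans ?_
    rw [(hθm.map _).natDegree_map, hθm.natDegree_map, hθK]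
  let θ' : integralClosure K[X] Λ := ⟨j θ, hθi⟩
  obtain ⟨w, hw, hws⟩ := exists_adjoin_simple_eq_adjoin F (T := {θ', z}) (by simp) (by
    rintro x (rfl | rfl)
    exacts [hθs, hz])
  rw [Set.image_pair] at hw
  have hwi := hws.isIntegral
  set d := (minpoly K[X] (z : Λ)).natDegree with hd
  have hzd : (minpoly F (z : Λ)).natDegree = d :=
    (minpoly_irreducible_and_derivative_ne_zero F z hz).2.2.symm
  have hwd : (minpoly F (w : Λ)).natDegree ≤ finrank K N * d := by
    rw [← adjoin.finrank hwi, hw, Set.insert_eq, adjoin_union, ← hzd]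
    refine (finrank_sup_le _ _).trans ?_
    rw [adjoin.finrank hθs.isIntegral, adjoin.finrank hz.isIntegral]
    exact Nat.mul_le_mul_right _ hθd
  have hθw : j θ ∈ F⟮(w : Λ)⟯ := hw ▸ subset_adjoin _ _ (Or.inl rfl)
  have hzw : (z : Λ) ∈ F⟮(w : Λ)⟯ := hw ▸ subset_adjoin _ _ (by simp)
  have hyw : (y : Λ) ∈ F⟮(w : Λ)⟯ := hw ▸ hy
  have hyn : (minpoly F (y : Λ)).natDegree = f.natDegree := by
    rw [natDegree_minpoly_eq_of_irreducible
      (hfm.irreducible_iff_irreducible_map_fraction_map.mp hf) (by rwa [aeval_map_algebraMap]),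
      hfm.natDegree_map]
  filter_upwards [eventually_natDegree_mul_le F hyw,
    eventually_mem_adjoin F (T := {w}) (x := θ') (by simpa using hθw),
    eventually_mem_adjoin F (T := {w}) (x := z) (by simpa using hzw)] with a ha hθa hza hirr
  obtain ⟨κ, _, _, _, _, φ, hφ, hφj⟩ := exists_specialization j hj a
  have hθ' := hθa κ φ hφ
  have hz' := hza κ φ hφ
  rw [Set.image_singleton] at hθ' hz'
  rw [hφj θ θ' rfl] at hθ'
  have hwφ := hφ.isIntegral w
  have h1 : finrank K N * d ≤ (minpoly K (φ w)).natDegree := by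
    rw [natDegree_minpoly_eq_finrank_mul K hwφ hθ', minpoly.algebraMap_eq
      (algebraMap N κ).injective, hθK]
    refine Nat.mul_le_mul_left _ ?_
    have h2 := natDegree_minpoly_eq_of_irreducible hirr (x := φ z) (by
      rw [aeval_map_algebraMap]
      exact hφ.aeval_eq_zero (minpoly.aeval K[X] (z : Λ)))
    rw [natDegree_map, (minpoly.monic z.2).natDegree_map, ← hd] at h2
    rw [← h2]
    refine (natDegree_minpoly_tower_le (t := θ) (hφ.isIntegral z)).trans ?_
    refine natDegree_minpoly_le_natDegree_minpoly hwφ.tower_top ?_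
    have : K⟮φ w⟯ ≤ (K⟮algebraMap N κ θ⟯⟮φ w⟯).restrictScalars K :=
      adjoin_simple_le_iff.mpr (mem_adjoin_simple_self K⟮algebraMap N κ θ⟯ _)
    exact this hz'
  have h3 := (Nat.mul_le_mul_right _ h1).trans
    ((ha κ φ hφ).trans (Nat.mul_le_mul_right _ hwd))
  refine irreducible_of_natDegree_le_natDegree_minpoly (hφ.aeval_eq_zero hfy)
    (hfm.map _).ne_zero ?_
  rw [hfm.natDegree_map, ← hyn]
  refine Nat.le_of_mul_le_mul_left h3 (Nat.mul_pos finrank_pos ?_)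
  exact minpoly.natDegree_pos z.2

end ConstantExtension

section PowerSeries

variable {K : Type} [Field K]

theorem exists_linearMap_apply_one (L : Type) [Field L] [Algebra K L] :
    ∃ l : L →ₗ[K] K, l 1 = 1 := by
  obtain ⟨l, hl⟩ := (Algebra.linearMap K L).exists_leftInverse_of_injective
    (LinearMap.ker_eq_bot.mpr (algebraMap K L).injective)
  exact ⟨l, by simpa using LinearMap.congr_fun hl 1⟩

theorem algebraMap_powerSeries_injective (L : Type) [Field L] :
    Function.Injective (algebraMap L[X] (PowerSeries L)) :=
  coe_injective L

theorem algebraMap_powerSeries_comp_mapRingHom (L : Type) [Field L] [Algebra K L] :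
    (algebraMap L[X] (PowerSeries L)).comp (mapRingHom (algebraMap K L)) =
      (PowerSeries.map (algebraMap K L)).comp (algebraMap K[X] (PowerSeries K)) := by
  ext <;> simp [PowerSeries.algebraMap_apply']

theorem aeval_powerSeries_map (L : Type) [Field L] [Algebra K L] (z : PowerSeries K)
    (p : K[X][X]) :
    aeval (PowerSeries.map (algebraMap K L) z) (p.map (mapRingHom (algebraMap K L))) =
      PowerSeries.map (algebraMap K L) (aeval z p) := by
  rw [aeval_def, eval₂_map, algebraMap_powerSeries_comp_mapRingHom, ← hom_eval₂, ← aeval_def]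

theorem isIntegral_powerSeries_map (L : Type) [Field L] [Algebra K L] {z : PowerSeries K}
    (hz : IsIntegral K[X] z) : IsIntegral L[X] (PowerSeries.map (algebraMap K L) z) :=
  ⟨_, (minpoly.monic hz).map (mapRingHom (algebraMap K L)), by
    rw [← aeval_def, aeval_powerSeries_map, minpoly.aeval, map_zero]⟩

theorem exists_powerSeries_retraction (L : Type) [Field L] [Algebra K L] :
    ∃ ρ : PowerSeries L →+ PowerSeries K, ρ 1 = 1 ∧
      (∀ s t, ρ (s * PowerSeries.map (algebraMap K L) t) = ρ s * t) ∧
      ∀ p : L[X], ∃ q : K[X], ρ (algebraMap L[X] _ p) = algebraMap K[X] _ q := by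
  obtain ⟨l, hl⟩ := exists_linearMap_apply_one (K := K) L
  refine ⟨⟨⟨fun s => PowerSeries.mk fun k => l (s.coeff k), ?_⟩, fun s t => ?_⟩, ?_,
    fun s t => ?_, fun p => ?_⟩
  · ext k; simp
  · ext k; simp
  · ext k
    by_cases hk : k = 0 <;> simp [PowerSeries.coeff_one, hk, hl]
  · ext k
    simp only [AddMonoidHom.coe_mk, ZeroHom.coe_mk, PowerSeries.coeff_mk, PowerSeries.coeff_mul,
      PowerSeries.coeff_map, map_sum]
    refine Finset.sum_congr rfl fun x _ => ?_
    rw [mul_comm, ← Algebra.smul_def, map_smul, smul_eq_mul, mul_comm]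
  · refine ⟨PowerSeries.trunc (p.natDegree + 1) (PowerSeries.mk fun k => l (p.coeff k)), ?_⟩
    ext k
    simp only [AddMonoidHom.coe_mk, ZeroHom.coe_mk, PowerSeries.algebraMap_apply',
      PowerSeries.coeff_mk, Algebra.algebraMap_self, PowerSeries.map_id]
    change l ((p : PowerSeries L).coeff k) = ((PowerSeries.trunc _ _ : K[X]) : PowerSeries K).coeff k
    simp only [coeff_coe, PowerSeries.coeff_trunc, PowerSeries.coeff_mk]
    split_ifs with h
    · rfl
    · rw [coeff_eq_zero_of_natDegree_lt (by omega), map_zero]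

theorem exists_monic_aeval_eq_zero_of_powerSeries_map (L : Type) [Field L] [Algebra K L]
    {z : PowerSeries K} {g : L[X][X]} (hgm : g.Monic)
    (hg : aeval (PowerSeries.map (algebraMap K L) z) g = 0) :
    ∃ p : K[X][X], p.Monic ∧ p.natDegree = g.natDegree ∧ aeval z p = 0 := by
  obtain ⟨ρ, hρ1, hρ, hρc⟩ := exists_powerSeries_retraction (K := K) L
  have hρ' : ∀ t, ρ (PowerSeries.map (algebraMap K L) t) = t := fun t => by
    rw [← one_mul (PowerSeries.map _ t), hρ, hρ1, one_mul]
  choose c hc using hρc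
  set e := g.natDegree with he
  let q : K[X][X] := ∑ i ∈ Finset.range e, C (c (g.coeff i)) * X ^ i
  have hlt : degree q < e := by
    refine (degree_sum_le _ _).trans_lt ((Finset.sup_lt_iff (WithBot.bot_lt_coe e)).mpr ?_)
    intro i hi
    exact (degree_C_mul_X_pow_le i _).trans_lt
      (WithBot.coe_lt_coe.mpr (Finset.mem_range.mp hi))
  refine ⟨X ^ e + q, monic_X_pow_add hlt, natDegree_eq_of_degree_eq_some ?_, ?_⟩
  · rw [degree_add_eq_left_of_degree_lt (by rwa [degree_X_pow]), degree_X_pow]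
  · have h1 := congrArg ρ hg
    rw [aeval_eq_sum_range, ← he, Finset.sum_range_succ, hgm.coeff_natDegree, one_smul,
      map_add, map_sum, map_zero, ← map_pow, hρ'] at h1
    simp only [Algebra.smul_def, ← map_pow, hρ, hc] at h1
    rw [map_add, map_pow, aeval_X, add_comm, ← h1]
    simp [q]

theorem minpoly_powerSeries_map (L : Type) [Field L] [Algebra K L] {z : PowerSeries K}
    (hz : IsIntegral K[X] z) :
    minpoly L[X] (PowerSeries.map (algebraMap K L) z) =
      (minpoly K[X] z).map (mapRingHom (algebraMap K L)) := by
  have hm := (minpoly.monic hz).map (mapRingHom (algebraMap K L))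
  have hzL := isIntegral_powerSeries_map L hz
  have : FaithfulSMul L[X] (PowerSeries L) := (faithfulSMul_iff_algebraMap_injective _ _).mpr
    (algebraMap_powerSeries_injective L)
  refine (eq_of_monic_of_dvd_of_natDegree_le (minpoly.monic hzL) hm
    (minpoly.isIntegrallyClosed_dvd hzL (by
      rw [aeval_powerSeries_map, minpoly.aeval, map_zero])) ?_).symm
  obtain ⟨p, hpm, hpd, hp0⟩ :=
    exists_monic_aeval_eq_zero_of_powerSeries_map L (minpoly.monic hzL) (minpoly.aeval _ _)
  rw [(minpoly.monic hz).natDegree_map, ← hpd]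
  exact natDegree_le_natDegree (minpoly.min K[X] z hpm hp0)

theorem irreducible_map_minpoly_powerSeries (L : Type) [Field L] [Algebra K L] {z : PowerSeries K}
    (hz : IsIntegral K[X] z) :
    Irreducible ((minpoly K[X] z).map (mapRingHom (algebraMap K L))) := by
  rw [← minpoly_powerSeries_map L hz]
  exact minpoly.irreducible (isIntegral_powerSeries_map L hz)

theorem exists_powerSeries_aeval_eq_zero {f : K[X][X]} (hf : f.Monic)
    {N : Type} [Field N] [Algebra K N] {c : N} (hc : aeval c (f.map (evalRingHom 0)) = 0)
    (hc' : aeval c (derivative (f.map (evalRingHom 0))) ≠ 0) :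
    ∃ y : PowerSeries N, aeval y f = 0 := by
  have hH : HenselianRing (PowerSeries N) (Ideal.span {PowerSeries.X}) := inferInstance
  have hcomp : (PowerSeries.constantCoeff (R := N)).comp (algebraMap K[X] (PowerSeries N)) =
      (algebraMap K N).comp (evalRingHom 0) := by
    ext <;> simp [PowerSeries.algebraMap_apply']
  have heval : ∀ g : K[X][X], PowerSeries.constantCoeff
      ((g.map (algebraMap K[X] (PowerSeries N))).eval (PowerSeries.C c)) =
      aeval c (g.map (evalRingHom 0)) := fun g => by
    rw [eval_map, hom_eval₂, hcomp, aeval_def, eval₂_map, PowerSeries.constantCoeff_C]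
  obtain ⟨y, hy, -⟩ := hH.is_henselian _ (hf.map (algebraMap K[X] (PowerSeries N)))
    (PowerSeries.C c) (by
      rw [Ideal.mem_span_singleton, PowerSeries.X_dvd_iff, heval, hc]) (by
      refine IsUnit.map _ ?_
      rw [PowerSeries.isUnit_iff_constantCoeff, derivative_map, heval, ← derivative_map]
      exact hc'.isUnit)
  exact ⟨y, by rwa [IsRoot, eval_map, ← aeval_def] at hy⟩

theorem exists_separable_map_evalRingHom [Infinite K] {f : K[X][X]} (hf : Irreducible f)
    (hfm : f.Monic) (hd : derivative f ≠ 0) : ∃ a : K, (f.map (evalRingHom a)).Separable := by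
  let F := FractionRing K[X]
  have hs : (f.map (algebraMap K[X] F)).Separable := by
    rw [separable_iff_derivative_ne_zero
      (hfm.irreducible_iff_irreducible_map_fraction_map.mp hf), derivative_map]
    exact (Polynomial.map_ne_zero_iff (IsFractionRing.injective K[X] F)).mpr hd
  obtain ⟨u, v, huv⟩ := hs
  obtain ⟨b, hbm, hb⟩ := IsLocalization.integerNormalization_spec (nonZeroDivisors K[X]) u
  obtain ⟨b', hbm', hb'⟩ := IsLocalization.integerNormalization_spec (nonZeroDivisors K[X]) v
  set U := IsLocalization.integerNormalization (nonZeroDivisors K[X]) u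
  set V := IsLocalization.integerNormalization (nonZeroDivisors K[X]) v
  have h : C b' * U * f + C b * V * derivative f = C (b * b') := by
    apply map_injective (algebraMap K[X] F) (IsFractionRing.injective K[X] F)
    have h1 : ∀ (r : K[X]) (p : F[X]), r • p = C (algebraMap K[X] F r) * p := fun r p => by
      rw [← smul_eq_C_mul, algebraMap_smul]
    rw [h1] at hb hb'
    simp only [Polynomial.map_add, Polynomial.map_mul, map_C, hb, hb', map_mul]
    rw [derivative_map] at huv
    linear_combination (C (algebraMap K[X] F b) * C (algebraMap K[X] F b')) * huv
  have hr : b * b' ≠ 0 := mul_ne_zero (nonZeroDivisors.ne_zero hbm)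
    (nonZeroDivisors.ne_zero hbm')
  obtain ⟨a, ha⟩ := (eventually_eval_ne_zero hr).exists
  refine ⟨a, ?_⟩
  have h2 := congrArg (Polynomial.map (evalRingHom a)) h
  simp only [Polynomial.map_add, Polynomial.map_mul, map_C] at h2
  refine ⟨C ((b * b').eval a)⁻¹ * (C (b'.eval a) * U.map (evalRingHom a)),
    C ((b * b').eval a)⁻¹ * (C (b.eval a) * V.map (evalRingHom a)), ?_⟩
  have h3 : (C ((b * b').eval a)⁻¹ * C ((b * b').eval a) : K[X]) = 1 := by
    rw [← C_mul, inv_mul_cancel₀ ha, C_1]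
  rw [derivative_map]
  simp only [coe_evalRingHom] at h2
  linear_combination C ((b * b').eval a)⁻¹ * h2 + h3

end PowerSeries

section PowerSeriesDescent

open IntermediateField Module

variable {K : Type} [Field K]

theorem exists_powerSeries_coordinates (N : Type) [Field N] [Algebra K N] [FiniteDimensional K N]
    [IsGalois K N] :
    ∃ (ι : Type) (_ : Fintype ι) (e e' : ι → N), ∀ y : PowerSeries N, ∃ u : ι → PowerSeries K,
      y = ∑ i, PowerSeries.C (e i) * PowerSeries.map (algebraMap K N) (u i) ∧
      ∀ i, PowerSeries.map (algebraMap K N) (u i) =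
        ∑ σ : N ≃ₐ[K] N, PowerSeries.map (σ : N →+* N) y * PowerSeries.C (σ (e' i)) := by
  classical
  let b := Module.finBasis K N
  refine ⟨_, inferInstance, b, b.traceDual, fun y =>
    ⟨fun i => PowerSeries.mk fun k => Algebra.trace K N (y.coeff k * b.traceDual i), ?_, ?_⟩⟩
  · ext k
    have h := b.sum_repr (y.coeff k)
    have h1 : ∀ i, b.repr (y.coeff k) i = Algebra.trace K N (y.coeff k * b.traceDual i) := by
      intro i
      have := b.traceDual.traceDual_repr_apply (y.coeff k) i
      rwa [Basis.traceDual_traceDual] at this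
    simp only [h1] at h
    rw [map_sum]
    refine h.symm.trans (Finset.sum_congr rfl fun i _ => ?_)
    rw [PowerSeries.coeff_C_mul, PowerSeries.coeff_map, PowerSeries.coeff_mk, Algebra.smul_def]
    ring
  · intro i
    ext k
    rw [PowerSeries.coeff_map, PowerSeries.coeff_mk, trace_eq_sum_automorphisms, map_sum]
    simp [PowerSeries.coeff_mul_C]

/-- Extension of constants on power series, as a map of `K[X]`-algebras. -/
noncomputable def powerSeriesMapAlgHom (N : Type) [Field N] [Algebra K N] :
    PowerSeries K →ₐ[K[X]] PowerSeries N :=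
  ⟨PowerSeries.map (algebraMap K N), fun p => by
    change PowerSeries.map (algebraMap K N) _ = _
    ext k
    simp [PowerSeries.algebraMap_apply']⟩

theorem powerSeriesMapAlgHom_injective (N : Type) [Field N] [Algebra K N] :
    Function.Injective (powerSeriesMapAlgHom N : PowerSeries K →ₐ[K[X]] PowerSeries N) :=
  PowerSeries.map_injective _ (algebraMap K N).injective

variable (F : Type) [Field F] [Algebra K[X] F]

theorem IsSeparable.of_aeval_eq_zero {Λ : Type} [Field Λ] [Algebra K[X] Λ] [Algebra F Λ]
    [IsScalarTower K[X] F Λ] {P : K[X][X]} (hP : (P.map (algebraMap K[X] F)).Separable) {x : Λ}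
    (hx : aeval x P = 0) : IsSeparable F x :=
  hP.of_dvd (minpoly.dvd F x (by rwa [aeval_map_algebraMap]))

variable [IsFractionRing K[X] F]

theorem exists_powerSeries_primitive {ι : Type} [Finite ι] (u : ι → PowerSeries K)
    (P : ι → K[X][X]) (hPm : ∀ i, (P i).Monic)
    (hPs : ∀ i, ((P i).map (algebraMap K[X] F)).Separable) (hP : ∀ i, aeval (u i) (P i) = 0) :
    ∃ z : PowerSeries K, IsIntegral K[X] z ∧
      ((minpoly K[X] z).map (algebraMap K[X] F)).Separable ∧
      ∀ i, ∃ r : K[X], r ≠ 0 ∧ r • u i ∈ Algebra.adjoin K[X] {z} := by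
  let Λ := FractionRing (PowerSeries K)
  have hinjK : Function.Injective (algebraMap (PowerSeries K) Λ) := IsFractionRing.injective _ _
  have : FaithfulSMul K[X] Λ := (faithfulSMul_iff_algebraMap_injective _ _).mpr (by
    rw [IsScalarTower.algebraMap_eq K[X] (PowerSeries K) Λ]
    exact hinjK.comp (algebraMap_powerSeries_injective K))
  let _ : Algebra F Λ := (IsFractionRing.lift
    (FaithfulSMul.algebraMap_injective K[X] Λ) : F →+* Λ).toAlgebra
  have : IsScalarTower K[X] F Λ := IsScalarTower.of_algebraMap_eq fun p =>
    (IsFractionRing.lift_algebraMap (FaithfulSMul.algebraMap_injective K[X] Λ) p).symm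
  have hP' : ∀ i, aeval (algebraMap _ Λ (u i)) (P i) = 0 := fun i => by
    rw [aeval_algebraMap_apply, hP, map_zero]
  let x : ι → integralClosure K[X] Λ := fun i => ⟨algebraMap _ Λ (u i), P i, hPm i, hP' i⟩
  obtain ⟨w, hw, hws⟩ := exists_adjoin_simple_eq_adjoin F (Set.finite_range x) (by
    rintro _ ⟨i, rfl⟩
    exact IsSeparable.of_aeval_eq_zero F (hPs i) (hP' i))
  have hwi : IsIntegral K[X] (w : Λ) := w.2
  obtain ⟨z, hz⟩ := IsIntegrallyClosed.isIntegral_iff.mp (hwi.tower_top (A := PowerSeries K))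
  have hzw : minpoly K[X] (w : Λ) = minpoly K[X] z := by
    rw [← hz, minpoly.algebraMap_eq hinjK]
  refine ⟨z, ?_, ?_, fun i => ?_⟩
  · rw [← hz] at hwi
    exact (isIntegral_algebraMap_iff hinjK).mp hwi
  · rw [← hzw, ← minpoly.isIntegrallyClosed_eq_field_fractions' (R := K[X]) F hwi]
    exact hws
  · have hx : (x i : Λ) ∈ IntermediateField.adjoin F ((↑) '' {w}) := by
      rw [Set.image_singleton, hw]
      exact subset_adjoin _ _ ⟨x i, ⟨i, rfl⟩, rfl⟩
    obtain ⟨r, hr, hrx⟩ := exists_smul_mem_adjoin F hx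
    refine ⟨r, hr, ?_⟩
    have h1 : (integralClosure K[X] Λ).val (r • x i) ∈
        (Algebra.adjoin K[X] {w}).map (integralClosure K[X] Λ).val := ⟨_, hrx, rfl⟩
    rw [AlgHom.map_adjoin, Set.image_singleton] at h1
    have h2 : Algebra.adjoin K[X] {(integralClosure K[X] Λ).val w} =
        (Algebra.adjoin K[X] {z}).map (IsScalarTower.toAlgHom K[X] (PowerSeries K) Λ) := by
      rw [AlgHom.map_adjoin, Set.image_singleton]
      exact congrArg (fun t => Algebra.adjoin K[X] {t}) hz.symm
    rw [h2] at h1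
    obtain ⟨t, ht, hti⟩ := h1
    have h3 : t = r • u i := hinjK (hti.trans
      (map_smul (IsScalarTower.toAlgHom K[X] (PowerSeries K) Λ) r (u i)).symm)
    exact h3 ▸ ht

theorem aeval_C_powerSeries {N : Type} [Field N] [Algebra K N] (c : N) (p : K[X]) :
    aeval (PowerSeries.C c) (p.map C) = PowerSeries.C (aeval c p) := by
  have h : (algebraMap K[X] (PowerSeries N)).comp C = PowerSeries.C.comp (algebraMap K N) := by
    ext; simp [PowerSeries.algebraMap_apply']
  rw [aeval_def, eval₂_map, h, ← hom_eval₂, ← aeval_def]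

theorem exists_powerSeries_mem_adjoin {N : Type} [Field N] [Algebra K N] [FiniteDimensional K N]
    [IsGalois K N] {Λ : Type} [Field Λ] [Algebra (PowerSeries N) Λ] [FaithfulSMul (PowerSeries N) Λ]
    [Algebra K[X] Λ] [IsScalarTower K[X] (PowerSeries N) Λ] [FaithfulSMul K[X] Λ] [Algebra F Λ]
    [IsScalarTower K[X] F Λ] {θ : N} (hθ : K⟮θ⟯ = ⊤) {f : K[X][X]} (hf : f.Monic)
    (hfs : (f.map (algebraMap K[X] F)).Separable) {y : PowerSeries N} (hy : aeval y f = 0) :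
    ∃ z : PowerSeries K, IsIntegral K[X] z ∧
      ((minpoly K[X] z).map (algebraMap K[X] F)).Separable ∧
      algebraMap _ Λ y ∈ IntermediateField.adjoin F {algebraMap _ Λ (PowerSeries.C θ),
        algebraMap _ Λ (PowerSeries.map (algebraMap K N) z)} := by
  have hinj := FaithfulSMul.algebraMap_injective (PowerSeries N) Λ
  have hC : ∀ c : N, IsIntegral K[X] (PowerSeries.C c) ∧
      IsSeparable F (algebraMap _ Λ (PowerSeries.C c)) := fun c => by
    have h0 : aeval (PowerSeries.C c) ((minpoly K c).map C) = 0 := by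
      rw [aeval_C_powerSeries, minpoly.aeval, map_zero]
    refine ⟨⟨_, (minpoly.monic (Algebra.IsIntegral.isIntegral (R := K) c)).map C, h0⟩,
      IsSeparable.of_aeval_eq_zero F (P := (minpoly K c).map C) ?_ ?_⟩
    · rw [Polynomial.map_map]
      exact Separable.map (Algebra.IsSeparable.isSeparable K c : (minpoly K c).Separable)
    · rw [aeval_algebraMap_apply, h0, map_zero]
  have hσ : ∀ σ : N ≃ₐ[K] N, IsIntegral K[X] (PowerSeries.map (σ : N →+* N) y) ∧
      IsSeparable F (algebraMap _ Λ (PowerSeries.map (σ : N →+* N) y)) := fun σ => by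
    have hcomp : (PowerSeries.map (σ : N →+* N)).comp (algebraMap K[X] (PowerSeries N)) =
        algebraMap K[X] (PowerSeries N) := by
      ext <;> simp [PowerSeries.algebraMap_apply']
    have h0 : aeval (PowerSeries.map (σ : N →+* N) y) f = 0 := by
      rw [aeval_def, ← hcomp, ← hom_eval₂, ← aeval_def, hy, map_zero]
    exact ⟨⟨f, hf, h0⟩, IsSeparable.of_aeval_eq_zero F hfs (by
      rw [aeval_algebraMap_apply, h0, map_zero])⟩
  obtain ⟨ι, _, e, e', he⟩ := exists_powerSeries_coordinates (K := K) N
  obtain ⟨u, hyu, hu⟩ := he y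
  have huN : ∀ i, IsIntegral K[X] (PowerSeries.map (algebraMap K N) (u i)) ∧
      IsSeparable F (algebraMap _ Λ (PowerSeries.map (algebraMap K N) (u i))) := fun i => by
    rw [hu]
    refine ⟨IsIntegral.sum _ fun σ _ => (hσ σ).1.mul (hC _).1, ?_⟩
    rw [map_sum, ← mem_separableClosure_iff]
    refine sum_mem fun σ _ => ?_
    rw [map_mul]
    exact mul_mem (mem_separableClosure_iff.mpr (hσ σ).2) (mem_separableClosure_iff.mpr (hC _).2)
  have hus : ∀ i, ((minpoly K[X] (PowerSeries.map (algebraMap K N) (u i))).map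
      (algebraMap K[X] F)).Separable := fun i => by
    rw [← minpoly.algebraMap_eq hinj,
      ← minpoly.isIntegrallyClosed_eq_field_fractions' (R := K[X]) F (huN i).1.algebraMap]
    exact (huN i).2
  have hu0 : ∀ i, aeval (u i) (minpoly K[X] (PowerSeries.map (algebraMap K N) (u i))) = 0 :=
    fun i => by
      apply powerSeriesMapAlgHom_injective N
      exact (aeval_algHom_apply (powerSeriesMapAlgHom N) _ _).symm.trans ((minpoly.aeval _ _).trans (map_zero _).symm)
  obtain ⟨z, hz, hzs, hzr⟩ := exists_powerSeries_primitive F u _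
    (fun i => minpoly.monic (huN i).1) hus hu0
  refine ⟨z, hz, hzs, ?_⟩
  set E := IntermediateField.adjoin F {algebraMap _ Λ (PowerSeries.C θ),
    algebraMap _ Λ (PowerSeries.map (algebraMap K N) z)}
  have hE : ∀ x ∈ E, ∀ t ∈ Algebra.adjoin K[X] {x}, t ∈ E := fun x hx t ht =>
    (Algebra.adjoin_le (S := E.toSubalgebra.restrictScalars K[X])
      (Set.singleton_subset_iff.mpr hx)) ht
  rw [hyu, map_sum]
  refine sum_mem fun i _ => ?_
  rw [map_mul]
  refine mul_mem ?_ ?_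
  · obtain ⟨p, hp⟩ : ∃ p : K[X], aeval θ p = e i := by
      have hi : e i ∈ K⟮θ⟯.toSubalgebra := by rw [hθ]; trivial
      rw [adjoin_simple_toSubalgebra_of_isAlgebraic (Algebra.IsAlgebraic.isAlgebraic θ),
        Algebra.adjoin_singleton_eq_range_aeval] at hi
      exact hi
    rw [← hp, ← aeval_C_powerSeries, ← aeval_algebraMap_apply]
    exact hE _ (subset_adjoin _ _ (Or.inl rfl)) _ (aeval_mem_adjoin_singleton _ _)
  · obtain ⟨r, hr, hri⟩ := hzr i
    let χ := (IsScalarTower.toAlgHom K[X] (PowerSeries N) Λ).comp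
        (powerSeriesMapAlgHom N)
    have h1 : χ (r • u i) ∈ (Algebra.adjoin K[X] {z}).map χ := ⟨_, hri, rfl⟩
    rw [AlgHom.map_adjoin, Set.image_singleton] at h1
    have h2 := hE _ (subset_adjoin _ _ (Or.inr rfl)) _ h1
    rw [map_smul, ← algebraMap_smul F] at h2
    have hr' : algebraMap K[X] F r ≠ 0 := by
      simpa using hr
    have h3 := E.smul_mem h2 (x := (algebraMap K[X] F r)⁻¹)
    rwa [inv_smul_smul₀ hr'] at h3

end PowerSeriesDescent

section LinearDisjointness

open Filter IntermediateField Module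

variable {K : Type} [Field K]

theorem eventually_linearDisjoint {Ω ι : Type} [Field Ω] [Algebra K Ω]
    {E : ι → IntermediateField K Ω} [∀ i, FiniteDimensional K (E i)]
    (hE : ∀ i, (E i).LinearDisjoint ↥(⨆ (j : ι) (_ : j ≠ i), E j))
    (N : IntermediateField K Ω) [FiniteDimensional K N] [IsGalois K N] :
    ∀ᶠ i in cofinite, (E i).LinearDisjoint N := by
  have hfin : Finite (IntermediateField K N) :=
    Field.finite_intermediateField_of_exists_primitive_element K N
      (Field.exists_primitive_element K N)
  have hS : {i | N ⊓ E i ≠ ⊥}.Finite := by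
    refine Set.Finite.of_finite_image (f := fun i => (E i).comap N.val) (Set.toFinite _) ?_
    intro i hi j _ hij
    by_contra hne
    refine hi (eq_bot_iff.mpr fun x hx => ?_)
    have hxj : (⟨x, hx.1⟩ : N) ∈ (E j).comap N.val := by
      have : (⟨x, hx.1⟩ : N) ∈ (E i).comap N.val := hx.2
      exact (show (E i).comap N.val = (E j).comap N.val from hij) ▸ this
    have hd : (E i).LinearDisjoint (E j) :=
      (hE i).of_le_right (le_iSup₂_of_le j (Ne.symm hne) le_rfl)
    exact hd.inf_eq_bot ▸ ⟨hx.2, hxj⟩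
  filter_upwards [hS.compl_mem_cofinite] with i hi
  exact (LinearDisjoint.of_inf_eq_bot (not_not.mp hi)).symm

theorem irreducible_map_of_linearDisjoint {Ω : Type} [Field Ω] [Algebra K Ω] {b : Ω}
    {N : Type} [Field N] [Algebra K N] [Algebra N Ω] [IsScalarTower K N Ω]
    (h : K⟮b⟯.LinearDisjoint N) {p : K[X]} (hp : Irreducible p) (hb : aeval b p = 0) :
    Irreducible (p.map (algebraMap K N)) := by
  have hbi : IsIntegral K b := isAlgebraic_iff_isIntegral.mp ⟨p, hp.ne_zero, hb⟩
  have hbN : IsIntegral N b := hbi.tower_top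
  have : FiniteDimensional K K⟮b⟯ := adjoin.finiteDimensional hbi
  have : FiniteDimensional N N⟮b⟯ := adjoin.finiteDimensional hbN
  refine irreducible_of_natDegree_le_natDegree_minpoly (x := b) (by rwa [aeval_map_algebraMap])
    (map_ne_zero hp.ne_zero) ?_
  rw [natDegree_map, ← natDegree_minpoly_eq_of_irreducible hp hb, ← adjoin.finrank hbi,
    ← adjoin.finrank hbN, finrank, ← h.adjoin_rank_eq_rank_left_of_isAlgebraic_left]
  have hle : IntermediateField.adjoin N (K⟮b⟯ : Set Ω) ≤ N⟮b⟯ := by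
    refine adjoin_le_iff.mpr ?_
    change K⟮b⟯ ≤ IntermediateField.restrictScalars K N⟮b⟯
    rw [adjoin_simple_le_iff]
    exact mem_adjoin_simple_self N b
  exact LinearMap.finrank_le_finrank_of_injective (f := (inclusion hle).toLinearMap)
    (inclusion hle).injective

end LinearDisjointness

section FullyHilbertian

open Filter IntermediateField Module

variable {K : Type} [Field K]

theorem IsFullyHilbertian.infinite (hK : IsFullyHilbertian K) : Infinite K := by
  by_contra hfin
  rw [not_infinite_iff_finite] at hfin
  have hirr : Irreducible (C X * X + C 1 : (AlgebraicClosure K)[X][X]) :=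
    irreducible_C_mul_X_add_C X_ne_zero isRelPrime_one_right
  obtain ⟨A, b, hA, hcard, -⟩ := hK (C X * X + C 1) (by simpa using hirr) (by simp [X_ne_zero])
  have hA' : A = Set.univ := (Set.eq_univ_iff_ncard A).mpr (congrArg Cardinal.toNat hcard)
  have h0 : (0 : K) ∈ HilbertSet (C X * X + C 1 : K[X][X]) := hA (hA' ▸ trivial)
  simp [HilbertSet] at h0

theorem IsFullyHilbertian.frequently_irreducible_map (hK : IsFullyHilbertian K)
    (N : IntermediateField K (AlgebraicClosure K)) [FiniteDimensional K N] [IsGalois K N]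
    {h : K[X][X]}
    (hh : Irreducible (h.map (mapRingHom (algebraMap K (AlgebraicClosure K)))))
    (hd : derivative h ≠ 0) :
    ∃ᶠ a in cofinite, Irreducible ((h.map (evalRingHom a)).map (algebraMap K N)) := by
  have := hK.infinite
  obtain ⟨A, b, hA, hcard, hb, hdisj⟩ := hK h hh hd
  have hAinf : Infinite A := by
    rw [Cardinal.infinite_iff, hcard, ← Cardinal.infinite_iff]
    infer_instance
  have hfd : ∀ a, FiniteDimensional K K⟮b a⟯ := fun a =>
    adjoin.finiteDimensional (Algebra.IsIntegral.isIntegral _)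
  have hev := eventually_linearDisjoint hdisj N
  have hfr : ∃ᶠ a : A in cofinite,
      Irreducible ((h.map (evalRingHom (a : K))).map (algebraMap K N)) :=
    (hev.mono fun a ha => irreducible_map_of_linearDisjoint ha (hA a.2) (hb a)).frequently
  exact (Subtype.val_injective.tendsto_cofinite).frequently hfr

end FullyHilbertian

section Converse

open Filter IntermediateField Module

variable {K : Type} [Field K]

theorem IsFullyHilbertian.frequently_irreducible_of_separable (hK : IsFullyHilbertian K)
    {f : K[X][X]} (hf : Irreducible f) (hfm : f.Monic) (hd : derivative f ≠ 0)
    (hs : (f.map (evalRingHom 0)).Separable) :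
    ∃ᶠ a in cofinite, Irreducible (f.map (evalRingHom a)) := by
  set q := f.map (evalRingHom 0)
  let N := IntermediateField.adjoin K (q.rootSet (AlgebraicClosure K))
  have hsplit : q.IsSplittingField K N :=
    adjoin_rootSet_isSplittingField (IsAlgClosed.splits _)
  have : FiniteDimensional K N := IsSplittingField.finiteDimensional N q
  have : IsGalois K N := IsGalois.of_separable_splitting_field hs
  obtain ⟨c, hc⟩ : ∃ c : N, aeval c q = 0 := by
    have h1 := one_le_natDegree_of_derivative_ne_zero hd
    have h2 : (q.map (algebraMap K N)).degree ≠ 0 := by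
      rw [degree_map]
      exact (natDegree_pos_iff_degree_pos.mp (by rwa [hfm.natDegree_map])).ne'
    obtain ⟨c, hc⟩ := hsplit.splits.exists_eval_eq_zero h2
    exact ⟨c, by rwa [eval_map_algebraMap] at hc⟩
  obtain ⟨y, hy⟩ := exists_powerSeries_aeval_eq_zero hfm hc
    (hs.aeval_derivative_ne_zero hc)
  obtain ⟨θ, hθ⟩ := Field.exists_primitive_element K N
  let F := FractionRing K[X]
  let Λ := FractionRing (PowerSeries N)
  have hinj : Function.Injective (algebraMap (PowerSeries N) Λ) := IsFractionRing.injective _ _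
  have : FaithfulSMul K[X] Λ := (faithfulSMul_iff_algebraMap_injective _ _).mpr (by
    rw [IsScalarTower.algebraMap_eq K[X] (PowerSeries N) Λ,
      ← (powerSeriesMapAlgHom N : PowerSeries K →ₐ[K[X]] _).comp_algebraMap]
    exact hinj.comp ((powerSeriesMapAlgHom_injective N).comp
      (algebraMap_powerSeries_injective K)))
  let _ : Algebra F Λ := (IsFractionRing.lift
    (FaithfulSMul.algebraMap_injective K[X] Λ) : F →+* Λ).toAlgebra
  have : IsScalarTower K[X] F Λ := IsScalarTower.of_algebraMap_eq fun p =>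
    (IsFractionRing.lift_algebraMap (FaithfulSMul.algebraMap_injective K[X] Λ) p).symm
  have hfs : (f.map (algebraMap K[X] F)).Separable := by
    rw [separable_iff_derivative_ne_zero
      (hfm.irreducible_iff_irreducible_map_fraction_map.mp hf), derivative_map]
    exact (Polynomial.map_ne_zero_iff (IsFractionRing.injective K[X] F)).mpr hd
  obtain ⟨z, hz, hzs, hyz⟩ := exists_powerSeries_mem_adjoin F (Λ := Λ) hθ hfm hfs hy
  let χ : PowerSeries K →ₐ[K[X]] Λ := (IsScalarTower.toAlgHom K[X] (PowerSeries N) Λ).comp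
    (powerSeriesMapAlgHom N)
  have hχ : Function.Injective χ :=
    hinj.comp (powerSeriesMapAlgHom_injective N)
  have hzm : minpoly K[X] (χ z) = minpoly K[X] z := minpoly.algHom_eq χ hχ z
  have hzd : derivative (minpoly K[X] z) ≠ 0 := fun h0 => by
    have h1 := (separable_iff_derivative_ne_zero
      ((minpoly.monic hz).irreducible_iff_irreducible_map_fraction_map.mp
        (minpoly.irreducible hz))).mp hzs
    rw [derivative_map, h0, Polynomial.map_zero] at h1
    exact h1 rfl
  have hχz : aeval (χ z) (minpoly K[X] z) = 0 := hzm ▸ minpoly.aeval _ _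
  have hyΛ : aeval (algebraMap _ Λ y) f = 0 := by rw [aeval_algebraMap_apply, hy, map_zero]
  have hj : ∀ c : K, algebraMap _ Λ (PowerSeries.C (algebraMap K N c)) =
      algebraMap K[X] Λ (C c) := fun c => by
    rw [IsScalarTower.algebraMap_apply K[X] (PowerSeries N) Λ, PowerSeries.algebraMap_apply']
    simp
  have hev := eventually_irreducible_of_irreducible_map F
    ((algebraMap (PowerSeries N) Λ).comp (PowerSeries.C (R := N))) hj hθ hf hfm
    (y := ⟨algebraMap _ Λ y, f, hfm, hyΛ⟩) (z := ⟨χ z, hz.map χ⟩) hyΛ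
    (IsSeparable.of_aeval_eq_zero F hzs hχz) hyz
  refine (hK.frequently_irreducible_map N (irreducible_map_minpoly_powerSeries _ hz)
    hzd).mp (hev.mono fun a ha h => ha ?_)
  change Irreducible (((minpoly K[X] (χ z)).map _).map _)
  rwa [hzm]

theorem IsFullyHilbertian.isHilbertian (hK : IsFullyHilbertian K) : IsHilbertian K := by
  intro f hf hd
  have := hK.infinite
  have hdeg := one_le_natDegree_of_derivative_ne_zero hd
  have hg := irreducible_integralNormalization hf hdeg
  have hgm := monic_integralNormalization hf.ne_zero
  have hgd := derivative_integralNormalization_ne_zero hd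
  set g := f.integralNormalization with hgdef
  obtain ⟨c, hc⟩ := exists_separable_map_evalRingHom hg hgm hgd
  let e : K[X][X] ≃+* K[X][X] := mapEquiv (algEquivAevalXAddC c).toRingEquiv
  have he : ∀ p : K[X][X], e p = p.map ((algEquivAevalXAddC c : K[X] ≃ₐ[K] K[X]) : K[X] →+* K[X]) :=
    fun p => rfl
  have hcomp : ∀ a : K, (evalRingHom a).comp
      ((algEquivAevalXAddC c : K[X] ≃ₐ[K] K[X]) : K[X] →+* K[X]) = evalRingHom (a + c) := fun a => by
    ext <;> simp
  have heval : ∀ a : K, (e g).map (evalRingHom a) = g.map (evalRingHom (a + c)) := fun a => by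
    rw [he, Polynomial.map_map, hcomp]
  have hfr := hK.frequently_irreducible_of_separable (f := e g)
    ((MulEquiv.irreducible_iff e).mpr hg) (hgm.map _) (by
      rw [he, derivative_map]
      exact (map_ne_zero_iff e e.injective).mpr hgd) (by rwa [heval, zero_add])
  simp only [heval] at hfr
  have hfr' := (add_left_injective c).tendsto_cofinite.frequently
    (p := fun a => Irreducible (g.map (evalRingHom a))) hfr
  refine frequently_cofinite_iff_infinite.mp (hfr'.mp ?_)
  filter_upwards [eventually_irreducible_integralNormalization_iff hf.ne_zero hdeg K] with a ha h
  simpa using ha.mp (by simpa using h)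

end Converse

/-- A countable field is Hilbertian if and only if it is fully
Hilbertian. -/
theorem countable_hilbertian_iff_fullyHilbertian (K : Type) [Field K] [Countable K] :
    IsHilbertian K ↔ IsFullyHilbertian K :=
  ⟨IsHilbertian.isFullyHilbertian, IsFullyHilbertian.isHilbertian⟩
end
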